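/- arXiv:1202.3369 — 2 statements merged into one kernel-verified Lean document; each statement's English description precedes it below -/
import Mathlib

section
/- (Oblak's conjecture.) Suppose K is an infinite field. Let Q(B̂) = (ω̂_1,...,ω̂_ẑ) be the maximum Jordan type among nilpotent matrices commuting with a nilpotent Jordan matrix of type B̂. Then Q(B) = (ω_1(B), ω̂_1, ω̂_2, ..., ω̂_ẑ). -/
open Matrix Finset

/-- The nilpotent Jordan matrix which, for each `k : Fin u`, has `c k` Jordan blocks of
size `ν k`, realized on the index type `Σ k : Fin u, Fin (c k) × Fin (ν k)`. -/
def jordanMatrixM (K : Type*) [Field K] (u : ℕ) (c ν : Fin u → ℕ) :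
    Matrix (Σ k : Fin u, Fin (c k) × Fin (ν k)) (Σ k : Fin u, Fin (c k) × Fin (ν k)) K :=
  fun p q =>
    if p.1 = q.1 ∧ (p.2.1 : ℕ) = (q.2.1 : ℕ) ∧ (p.2.2 : ℕ) + 1 = (q.2.2 : ℕ) then 1 else 0

namespace Oblak

section Generic

variable {K : Type*} [Field K]

/-- Polynomial families of vectors. -/
inductive PolyFam {M : Type*} [AddCommGroup M] [Module K M] : (K → M) → Prop
  | const (c : M) : PolyFam fun _ => c
  | smul (F : K → M) : PolyFam F → PolyFam fun t => t • F t
  | add (F G : K → M) : PolyFam F → PolyFam G → PolyFam fun t => F t + G t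

variable {M M₁ M₂ M₃ : Type*} [AddCommGroup M] [Module K M] [AddCommGroup M₁] [Module K M₁]
  [AddCommGroup M₂] [Module K M₂] [AddCommGroup M₃] [Module K M₃]

theorem PolyFam.bilin (β : M₁ →ₗ[K] M₂ →ₗ[K] M₃) {F : K → M₁} {G : K → M₂} (hF : PolyFam F)
    (hG : PolyFam G) : PolyFam fun t => β (F t) (G t) := by
  induction hF with
  | const c =>
    induction hG with
    | const d => exact .const _
    | smul G _ ih => simpa using PolyFam.smul _ ih
    | add G H _ _ ihG ihH => simpa using PolyFam.add _ _ ihG ihH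
  | smul F _ ih => simpa using PolyFam.smul _ ih
  | add F F' _ _ ih ih' => simpa using PolyFam.add _ _ ih ih'

theorem PolyFam.comp {F : K → M₂ →ₗ[K] M₃} {G : K → M₁ →ₗ[K] M₂} (hF : PolyFam F)
    (hG : PolyFam G) : PolyFam fun t => F t ∘ₗ G t :=
  PolyFam.bilin (LinearMap.llcomp K M₁ M₂ M₃) hF hG

theorem PolyFam.mul {F G : K → Module.End K M} (hF : PolyFam F)
    (hG : PolyFam G) : PolyFam fun t => F t * G t :=
  PolyFam.comp hF hG

theorem PolyFam.pow {F : K → Module.End K M} (hF : PolyFam F) (m : ℕ) :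
    PolyFam fun t => F t ^ m := by
  induction m with
  | zero => simpa using PolyFam.const _
  | succ m ih => simpa only [pow_succ] using ih.mul hF

theorem PolyFam.map (ℓ : M₁ →ₗ[K] M₂) {F : K → M₁} (hF : PolyFam F) : PolyFam fun t => ℓ (F t) := by
  induction hF with
  | const c => exact .const _
  | smul F _ ih => simpa using PolyFam.smul _ ih
  | add F F' _ _ ih ih' => simpa using PolyFam.add _ _ ih ih'

theorem PolyFam.line (A B : M) : PolyFam fun t : K => A + t • B :=
  .add _ _ (.const _) (.smul _ (.const _))

theorem PolyFam.eval {F : K → K} (hF : PolyFam F) :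
    ∃ P : Polynomial K, ∀ t, F t = P.eval t := by
  induction hF with
  | const c => exact ⟨.C c, by simp⟩
  | smul F _ ih => obtain ⟨P, hP⟩ := ih; exact ⟨.X * P, by simp [hP]⟩
  | add F G _ _ ih ih' =>
    obtain ⟨P, hP⟩ := ih; obtain ⟨Q, hQ⟩ := ih'; exact ⟨P + Q, by simp [hP, hQ]⟩

/-- The rank of a linear map. -/
noncomputable abbrev rk (f : M₁ →ₗ[K] M₂) : ℕ := Module.finrank K (LinearMap.range f)

theorem rk_comp_le_left [FiniteDimensional K M₃] (f : M₂ →ₗ[K] M₃) (g : M₁ →ₗ[K] M₂) :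
    rk (f ∘ₗ g) ≤ rk f :=
  Submodule.finrank_mono (LinearMap.range_comp_le_range g f)

theorem rk_comp_le_right [FiniteDimensional K M₂] (f : M₂ →ₗ[K] M₃) (g : M₁ →ₗ[K] M₂) :
    rk (f ∘ₗ g) ≤ rk g := by
  rw [rk, LinearMap.range_comp]
  exact Submodule.finrank_map_le _ _

theorem rk_add_ker [FiniteDimensional K M₁] (f : M₁ →ₗ[K] M₂) :
    rk f + Module.finrank K (LinearMap.ker f) = Module.finrank K M₁ :=
  LinearMap.finrank_range_add_finrank_ker f

theorem exists_section_of_le_rk [FiniteDimensional K M₂] (f : M₁ →ₗ[K] M₂) {r : ℕ}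
    (hr : r ≤ rk f) :
    ∃ (a : (Fin r → K) →ₗ[K] M₁) (g : M₂ →ₗ[K] (Fin r → K)), g ∘ₗ f ∘ₗ a = LinearMap.id := by
  let b := Module.finBasis K (LinearMap.range f)
  have hb : ∀ i : Fin r, ∃ v, f v = b (Fin.castLE hr i) := fun i =>
    LinearMap.mem_range.1 (b (Fin.castLE hr i)).2
  choose v hv using hb
  have hli : LinearIndependent K fun i : Fin r => f (v i) := by
    simp only [hv]
    exact (b.linearIndependent.comp _ (Fin.castLE_injective hr)).map' _
      (Submodule.ker_subtype _)
  have hli' : LinearIndependent K v := LinearIndependent.of_comp f hli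
  have hinj : LinearMap.ker (f ∘ₗ Fintype.linearCombination K v) = ⊥ := by
    have : f ∘ₗ Fintype.linearCombination K v = Fintype.linearCombination K (f ∘ v) := by
      ext i; simp [Fintype.linearCombination_apply]
    rw [this]
    exact linearIndependent_iff_injective_fintypeLinearCombination.1 hli |> LinearMap.ker_eq_bot.2
  obtain ⟨g, hg⟩ := LinearMap.exists_leftInverse_of_injective _ hinj
  exact ⟨_, g, hg⟩

theorem PolyFam.finite_rk_lt [FiniteDimensional K M₂] {F : K → M₁ →ₗ[K] M₂}
    (hF : PolyFam F) {t₀ : K} {r : ℕ} (hr : r ≤ rk (F t₀)) : {t | rk (F t) < r}.Finite := by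
  classical
  obtain ⟨a, g, hag⟩ := exists_section_of_le_rk _ hr
  have hent : ∀ i j : Fin r, ∃ P : Polynomial K, ∀ t,
      LinearMap.toMatrix' (g ∘ₗ F t ∘ₗ a) i j = P.eval t := by
    intro i j
    have h : PolyFam fun t => (LinearMap.toMatrix' (g ∘ₗ F t ∘ₗ a)) i j := by
      have := PolyFam.map (LinearMap.proj i ∘ₗ LinearMap.applyₗ (R := K) (Pi.single j (1 : K)))
        (PolyFam.comp (.const g) (hF.comp (.const a)))
      simpa [LinearMap.toMatrix'_apply] using this
    exact h.eval
  choose P hP using hent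
  let D : Polynomial K := (Matrix.of P).det
  have hD : ∀ t, D.eval t = (LinearMap.toMatrix' (g ∘ₗ F t ∘ₗ a)).det := by
    intro t
    have : (Polynomial.evalRingHom t) D = _ := RingHom.map_det _ _
    rw [← Polynomial.coe_evalRingHom, this]
    congr 1
    ext i j
    simp [hP]
  have hD0 : D ≠ 0 := by
    intro h0
    have := hD t₀
    rw [hag, h0] at this
    simp at this
  refine (D.roots.toFinset.finite_toSet).subset fun t ht => ?_
  rw [Finset.mem_coe, Multiset.mem_toFinset, Polynomial.mem_roots hD0, Polynomial.IsRoot]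
  by_contra hne
  rw [hD, LinearMap.det_toMatrix'] at hne
  have hsurj : LinearMap.range (g ∘ₗ F t ∘ₗ a) = ⊤ := LinearMap.range_eq_top.2
    ((LinearEquiv.ofIsUnitDet (v := Pi.basisFun K (Fin r)) (v' := Pi.basisFun K (Fin r))
      (f := g ∘ₗ F t ∘ₗ a) (by
        rw [LinearMap.det_toMatrix]; exact isUnit_iff_ne_zero.2 hne)).surjective)
  have h1 : rk (g ∘ₗ F t ∘ₗ a) = r := by rw [rk, hsurj]; simp
  have h2 : rk (g ∘ₗ F t ∘ₗ a) ≤ rk (F t) := by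
    rw [← LinearMap.comp_assoc]
    refine (Submodule.finrank_mono (LinearMap.range_comp_le_range _ _)).trans ?_
    exact rk_comp_le_right _ _
  have h3 : rk (F t) < r := ht
  omega

/-- Conditions that hold for all but finitely many points on each line through a point
where they hold. -/
def OpenCond (C : M → Prop) : Prop :=
  ∀ A B, C A → {t : K | ¬ C (A + t • (B - A))}.Finite

theorem openCond_rk [FiniteDimensional K M₂] (Φ : M → M₁ →ₗ[K] M₂)
    (h : ∀ A B, PolyFam fun t : K => Φ (A + t • B)) (r : ℕ) :
    OpenCond (K := K) fun A => r ≤ rk (Φ A) := by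
  intro A B hA
  have := (h A (B - A)).finite_rk_lt (t₀ := 0) (r := r) (by simpa using hA)
  simpa using this

theorem OpenCond.and {C D : M → Prop} (hC : OpenCond (K := K) C) (hD : OpenCond (K := K) D) :
    OpenCond (K := K) fun A => C A ∧ D A := by
  intro A B h
  refine ((hC A B h.1).union (hD A B h.2)).subset fun t ht => ?_
  simp only [Set.mem_ofPred_eq, not_and_or] at ht
  exact ht

theorem OpenCond.exists_and [Infinite K] {C D : M → Prop} (hC : OpenCond (K := K) C)
    (hD : OpenCond (K := K) D) (U : Submodule K M) (h1 : ∃ A ∈ U, C A) (h2 : ∃ A ∈ U, D A) :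
    ∃ A ∈ U, C A ∧ D A := by
  obtain ⟨A, hAU, hA⟩ := h1
  obtain ⟨B, hBU, hB⟩ := h2
  have f1 := hC A B hA
  have f2 := hD B A hB
  have f3 : ((fun t : K => 1 - t) ⁻¹' {t : K | ¬ D (B + t • (A - B))}).Finite :=
    f2.preimage (fun x _ y _ h => by simpa using h)
  obtain ⟨t, ht⟩ := (f1.union f3).exists_notMem
  simp only [Set.mem_union, Set.mem_ofPred_eq, Set.mem_preimage, not_or, not_not] at ht
  refine ⟨A + t • (B - A), U.add_mem hAU (U.smul_mem _ (U.sub_mem hBU hAU)), ht.1, ?_⟩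
  have e : A + t • (B - A) = B + (1 - t) • (A - B) := by module
  rw [e]; exact ht.2

theorem OpenCond.all {ι : Type*} (s : Finset ι) {C : ι → M → Prop}
    (hC : ∀ i ∈ s, OpenCond (K := K) (C i)) : OpenCond (K := K) fun A => ∀ i ∈ s, C i A := by
  intro A B h
  refine (Set.Finite.biUnion s.finite_toSet fun i hi =>
    hC i hi A B (h i hi)).subset fun t ht => ?_
  simp only [Set.mem_ofPred_eq, not_forall] at ht
  obtain ⟨i, hi, h⟩ := ht
  exact Set.mem_biUnion (Finset.mem_coe.2 hi) h

end Generic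

section Shift

variable {K : Type*} [Field K] {ι : Type*} [Fintype ι] [DecidableEq ι]

/-- The linear map permuting the standard basis according to a partial map `s`. -/
noncomputable def partialShift (K : Type*) [Field K] (s : ι → Option ι) : Module.End K (ι → K) :=
  (Pi.basisFun K ι).constr K fun p => (s p).elim 0 fun q => Pi.single q 1

@[simp] theorem partialShift_single (s : ι → Option ι) (p : ι) :
    partialShift K s (Pi.single p 1) = (s p).elim 0 fun q => Pi.single q 1 := by
  rw [partialShift, ← Pi.basisFun_apply, Module.Basis.constr_basis]

theorem partialShift_mul (s t : ι → Option ι) :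
    partialShift K s * partialShift K t = partialShift K fun p => (t p).bind s := by
  refine (Pi.basisFun K ι).ext fun p => ?_
  rw [Pi.basisFun_apply, Module.End.mul_apply, partialShift_single, partialShift_single]
  cases t p <;> simp

theorem rk_partialShift (s : ι → Option ι)
    (hs : ∀ p p' q, s p = some q → s p' = some q → p = p') :
    rk (partialShift K s) = #{p | (s p).isSome} := by
  classical
  have hr : LinearMap.range (partialShift K s) = Submodule.span K
      (Set.range fun p : {p // (s p).isSome} =>
        (Pi.single ((s p.1).get p.2) 1 : ι → K)) := by
    rw [partialShift, Module.Basis.constr_range]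
    apply le_antisymm
    · rw [Submodule.span_le]
      rintro _ ⟨p, rfl⟩
      rcases h : s p with _ | q
      · simp [h]
      · refine Submodule.subset_span ⟨⟨p, by simp [h]⟩, ?_⟩
        simp [h]
    · apply Submodule.span_mono
      rintro _ ⟨⟨p, hp⟩, rfl⟩
      obtain ⟨q, hq⟩ := Option.isSome_iff_exists.1 hp
      exact ⟨p, by simp [hq]⟩
  rw [rk, hr, finrank_span_eq_card, Fintype.card_subtype]
  have hinj : Function.Injective fun p : {p // (s p).isSome} => (s p.1).get p.2 := by
    rintro ⟨p, hp⟩ ⟨p', hp'⟩ h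
    obtain ⟨q, hq⟩ := Option.isSome_iff_exists.1 hp
    obtain ⟨q', hq'⟩ := Option.isSome_iff_exists.1 hp'
    simp only [hq, hq', Option.get_some] at h
    exact Subtype.ext (hs p p' q hq (h ▸ hq'))
  have := (Pi.basisFun K ι).linearIndependent.comp _ hinj
  convert this using 2
  simp

variable {β : Type*} [Fintype β] [DecidableEq β]

/-- The nilpotent Jordan operator with blocks of sizes `len b`. -/
noncomputable def jordanOp (K : Type*) [Field K] (len : β → ℕ) :
    Module.End K ((Σ b, Fin (len b)) → K) :=
  partialShift K fun p => if h : (p.2 : ℕ) + 1 < len p.1 then some ⟨p.1, ⟨p.2 + 1, h⟩⟩ else none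

theorem jordanOp_pow (len : β → ℕ) (l : ℕ) :
    jordanOp K len ^ l = partialShift K fun p =>
      if h : (p.2 : ℕ) + l < len p.1 then some ⟨p.1, ⟨p.2 + l, h⟩⟩ else none := by
  induction l with
  | zero =>
    refine (Pi.basisFun K _).ext fun p => ?_
    simp
  | succ l ih =>
    rw [pow_succ', ih, jordanOp, partialShift_mul]
    congr 1
    ext1 p
    by_cases h : (p.2 : ℕ) + l < len p.1
    · simp [h, add_assoc]
    · have : ¬ (p.2 : ℕ) + (l + 1) < len p.1 := by omega
      simp [h, this]

theorem jordanOp_pow_single (len : β → ℕ) (l : ℕ) (b : β) (a : Fin (len b))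
    (h : (a : ℕ) + l < len b) :
    (jordanOp K len ^ l) (Pi.single ⟨b, a⟩ 1) = Pi.single ⟨b, ⟨a + l, h⟩⟩ 1 := by
  rw [jordanOp_pow, partialShift_single]; simp [h]

theorem jordanOp_pow_single_eq_zero (len : β → ℕ) (l : ℕ) (b : β) (a : Fin (len b))
    (h : ¬ (a : ℕ) + l < len b) :
    (jordanOp K len ^ l) (Pi.single ⟨b, a⟩ 1) = 0 := by
  rw [jordanOp_pow, partialShift_single]; simp [h]

theorem card_filter_add_lt (m l : ℕ) : #{a : Fin m | (a : ℕ) + l < m} = m - l := by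
  rw [← Fintype.card_subtype]
  refine (Fintype.card_congr (β := Fin (m - l)) ⟨fun a => ⟨a.1, by have := a.2; omega⟩,
    fun a => ⟨⟨a, by omega⟩, by have := a.2; dsimp; omega⟩, fun a => ?_, fun a => ?_⟩).trans
    (Fintype.card_fin _)
  · rfl
  · rfl

theorem rk_jordanOp_pow (len : β → ℕ) (l : ℕ) :
    rk (jordanOp K len ^ l) = ∑ b, (len b - l) := by
  rw [jordanOp_pow, rk_partialShift]
  · have : ({p | (if h : (p.2 : ℕ) + l < len p.1 then some (⟨p.1, ⟨p.2 + l, h⟩⟩ : Σ b, Fin (len b))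
        else none).isSome} : Finset (Σ b, Fin (len b))) =
        Finset.univ.sigma fun b => {a : Fin (len b) | (a : ℕ) + l < len b} := by
      ext p
      by_cases h : (p.2 : ℕ) + l < len p.1 <;> simp [h]
    rw [this, Finset.card_sigma]
    exact Finset.sum_congr rfl fun b _ => card_filter_add_lt _ _
  · rintro ⟨b, a⟩ ⟨b', a'⟩ q h h'
    dsimp only at h h'
    split_ifs at h h'
    obtain rfl := (Option.some.inj h)
    have h2 := Option.some.inj h'
    obtain rfl : b' = b := congrArg Sigma.fst h2
    simp only [Sigma.mk.injEq, heq_eq_eq, Fin.mk.injEq, true_and] at h2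
    simp only [Sigma.mk.injEq, heq_eq_eq, true_and]
    exact Fin.ext (by omega)

end Shift

section Types

/-- The ranks of the powers of a nilpotent map with `n i` Jordan blocks of size `i < N`. -/
def rho (N : ℕ) (n : ℕ → ℕ) (l : ℕ) : ℕ := ∑ i ∈ range N, n i * (i - l)

/-- The number of Jordan blocks of size larger than `a`. -/
def numGt (N : ℕ) (n : ℕ → ℕ) (a : ℕ) : ℕ := ∑ i ∈ range N with a < i, n i

theorem rho_eq_succ_add (N : ℕ) (n : ℕ → ℕ) (l : ℕ) :
    rho N n l = rho N n (l + 1) + numGt N n l := by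
  rw [rho, rho, numGt, Finset.sum_filter, ← Finset.sum_add_distrib]
  refine Finset.sum_congr rfl fun i _ => ?_
  split_ifs with h
  · obtain ⟨k, rfl⟩ := Nat.exists_eq_add_of_lt h
    have h1 : l + k + 1 - l = k + 1 := by omega
    have h2 : l + k + 1 - (l + 1) = k := by omega
    rw [h1, h2]; ring
  · have h1 : i - l = 0 := by omega
    have h2 : i - (l + 1) = 0 := by omega
    rw [h1, h2]; rfl

theorem rho_eq_zero {N : ℕ} (n : ℕ → ℕ) {l : ℕ} (h : N ≤ l) : rho N n l = 0 :=
  Finset.sum_eq_zero fun i hi => by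
    have := Finset.mem_range.1 hi
    rw [Nat.sub_eq_zero_of_le (by omega), mul_zero]

theorem numGt_antitone (N : ℕ) (n : ℕ → ℕ) : Antitone (numGt N n) := by
  intro a b hab
  refine Finset.sum_le_sum_of_subset fun i => ?_
  simp only [Finset.mem_filter]
  exact fun h => ⟨h.1, by omega⟩

theorem numGt_eq_zero {N : ℕ} (n : ℕ → ℕ) {a : ℕ} (h : N ≤ a) : numGt N n a = 0 := by
  have := rho_eq_succ_add N n a
  rw [rho_eq_zero n h, rho_eq_zero n (by omega)] at this
  omega

/-- The size of the `b`-th largest Jordan block. -/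
noncomputable def blockLen (N : ℕ) (n : ℕ → ℕ) (b : ℕ) : ℕ :=
  open Classical in
  Nat.find (p := fun a => numGt N n a ≤ b) ⟨N, by rw [numGt_eq_zero n le_rfl]; exact Nat.zero_le _⟩

theorem lt_blockLen {N : ℕ} {n : ℕ → ℕ} {a b : ℕ} : a < blockLen N n b ↔ b < numGt N n a := by
  rw [blockLen, Nat.lt_find_iff]
  constructor
  · intro h; exact not_le.1 (h a le_rfl)
  · intro h a' ha'; exact not_le.2 (h.trans_le (numGt_antitone N n ha'))

theorem sum_blockLen (N : ℕ) (n : ℕ → ℕ) (l : ℕ) :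
    ∑ b : Fin (numGt N n 0), (blockLen N n b - l) = rho N n l := by
  have step : ∀ l, ∑ b : Fin (numGt N n 0), (blockLen N n b - l) =
      ∑ b : Fin (numGt N n 0), (blockLen N n b - (l + 1)) + numGt N n l := by
    intro l
    have : numGt N n l = ∑ b : Fin (numGt N n 0), if l < blockLen N n b then 1 else 0 := by
      rw [← Finset.card_filter]
      simp only [lt_blockLen]
      have hle := numGt_antitone N n (Nat.zero_le l)
      rw [← Fintype.card_subtype]
      symm
      refine (Fintype.card_congr (β := Fin (numGt N n l)) ⟨fun a => ⟨a.1, a.2⟩,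
        fun a => ⟨⟨a, by omega⟩, a.2⟩, fun a => ?_, fun a => ?_⟩).trans (Fintype.card_fin _)
      · rfl
      · rfl
    rw [this, ← Finset.sum_add_distrib]
    refine Finset.sum_congr rfl fun b _ => ?_
    split_ifs <;> omega
  have key : ∀ k l, N ≤ l + k → ∑ b : Fin (numGt N n 0), (blockLen N n b - l) = rho N n l := by
    intro k
    induction k with
    | zero =>
      intro l hl
      rw [add_zero] at hl
      rw [rho_eq_zero n hl]
      refine Finset.sum_eq_zero fun b _ => ?_
      have : ¬ l < blockLen N n b := by
        rw [lt_blockLen, numGt_eq_zero n hl]; omega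
      omega
    | succ k ih =>
      intro l hl
      rw [step, rho_eq_succ_add, ih (l + 1) (by omega)]
  exact key N l (by omega)

end Types

section Model

variable {K : Type*} [Field K] {V : Type*} [AddCommGroup V] [Module K V]

/-- `J` is nilpotent with `n i` Jordan blocks of size `i` for `0 < i < N`. -/
def HasType (N : ℕ) (n : ℕ → ℕ) (J : Module.End K V) : Prop := ∀ l, rk (J ^ l) = rho N n l

theorem HasType.pow_eq_zero [FiniteDimensional K V] {N : ℕ} {n : ℕ → ℕ} {J : Module.End K V}
    (h : HasType N n J) : J ^ N = 0 := by
  have := h N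
  rw [rho_eq_zero n le_rfl, rk, Submodule.finrank_eq_zero, LinearMap.range_eq_bot] at this
  exact this

theorem HasType.finrank {N : ℕ} {n : ℕ → ℕ} {J : Module.End K V}
    (h : HasType N n J) : Module.finrank K V = rho N n 0 := by
  rw [← h 0, rk, pow_zero, Module.End.one_eq_id, LinearMap.range_id, finrank_top]

theorem isNilpotent_of_ker [FiniteDimensional K V] {J A : Module.End K V} (hJ : IsNilpotent J)
    (hAJ : Commute A J) {k : ℕ} (hA : ∀ v, J v = 0 → (A ^ k) v = 0) : IsNilpotent A := by
  obtain ⟨N, hN⟩ := hJ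
  set C := A ^ k with hC
  have hCJ : Commute C J := hAJ.pow_left k
  have key : ∀ l v, (J ^ l) v = 0 → (C ^ l) v = 0 := by
    intro l
    induction l with
    | zero => intro v hv; simpa using hv
    | succ l ih =>
      intro v hv
      rw [pow_succ, Module.End.mul_apply]
      apply ih
      have h1 : (J ^ l) (C v) = C ((J ^ l) v) := by
        rw [← Module.End.mul_apply, ← (hCJ.pow_right l).eq, Module.End.mul_apply]
      rw [h1]
      apply hA
      rw [← Module.End.mul_apply, ← pow_succ', hv]
  refine ⟨k * N, ?_⟩
  rw [pow_mul, ← hC]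
  ext1 v
  exact key N v (by rw [hN]; rfl)

theorem injective_of_ker [FiniteDimensional K V] {W : Type*} [AddCommGroup W] [Module K W]
    {J : Module.End K V} {J' : Module.End K W} (hJ : IsNilpotent J) (f : V →ₗ[K] W)
    (hf : f ∘ₗ J = J' ∘ₗ f) (h : ∀ v, J v = 0 → f v = 0 → v = 0) : Function.Injective f := by
  obtain ⟨N, hN⟩ := hJ
  have key : ∀ l v, (J ^ l) v = 0 → f v = 0 → v = 0 := by
    intro l
    induction l with
    | zero => intro v hv _; simpa using hv
    | succ l ih =>
      intro v hv hfv
      have h1 : J v = 0 := by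
        apply ih
        · rw [← Module.End.mul_apply, ← pow_succ, hv]
        · have := LinearMap.congr_fun hf v
          simp only [LinearMap.comp_apply] at this
          rw [this, hfv, map_zero]
      exact h v h1 hfv
  refine (injective_iff_map_eq_zero f).2 fun v hv => key N v (by rw [hN]; rfl) hv

variable (K) in
/-- The standard space carrying a nilpotent map of a given Jordan type. -/
abbrev StdSpace (N : ℕ) (n : ℕ → ℕ) : Type _ :=
  (Σ b : Fin (numGt N n 0), Fin (blockLen N n b)) → K

variable (K) in
/-- The standard nilpotent map of a given Jordan type. -/
noncomputable def stdOp (N : ℕ) (n : ℕ → ℕ) : Module.End K (StdSpace K N n) :=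
  jordanOp K fun b : Fin (numGt N n 0) => blockLen N n b

theorem hasType_stdOp (N : ℕ) (n : ℕ → ℕ) : HasType N n (stdOp K N n) := by
  intro l
  rw [stdOp, rk_jordanOp_pow, sum_blockLen]

theorem blockLen_pos {N : ℕ} {n : ℕ → ℕ} (b : Fin (numGt N n 0)) : 0 < blockLen N n b :=
  lt_blockLen.2 b.2

variable (K) in
/-- The standard basis of the kernel of `stdOp`. -/
noncomputable def socle (N : ℕ) (n : ℕ → ℕ) (b : Fin (numGt N n 0)) : StdSpace K N n :=
  Pi.single ⟨b, ⟨blockLen N n b - 1, Nat.sub_lt (blockLen_pos b) one_pos⟩⟩ 1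

theorem stdOp_socle (N : ℕ) (n : ℕ → ℕ) (b : Fin (numGt N n 0)) :
    stdOp K N n (socle K N n b) = 0 := by
  have := jordanOp_pow_single_eq_zero (K := K) (fun b : Fin (numGt N n 0) => blockLen N n b) 1 b
    ⟨blockLen N n b - 1, Nat.sub_lt (blockLen_pos b) one_pos⟩ (by simp; omega)
  simpa [stdOp, socle] using this

theorem finrank_ker_of_hasType [FiniteDimensional K V] {N : ℕ} {n : ℕ → ℕ} {J : Module.End K V}
    (h : HasType N n J) : Module.finrank K (LinearMap.ker J) = numGt N n 0 := by
  have h1 := rk_add_ker J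
  have h2 := h 1
  have h3 := rho_eq_succ_add N n 0
  rw [pow_one] at h2
  rw [h.finrank] at h1
  rw [zero_add] at h3
  omega

theorem linearIndependent_socle (N : ℕ) (n : ℕ → ℕ) : LinearIndependent K (socle K N n) := by
  have := (Pi.basisFun K (Σ b : Fin (numGt N n 0), Fin (blockLen N n b))).linearIndependent.comp
    (fun b : Fin (numGt N n 0) =>
      ⟨b, ⟨blockLen N n b - 1, Nat.sub_lt (blockLen_pos b) one_pos⟩⟩)
    (fun b b' h => congrArg Sigma.fst h)
  convert this using 1
  ext1 b
  rw [Function.comp_apply, Pi.basisFun_apply, socle]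

theorem span_socle (N : ℕ) (n : ℕ → ℕ) :
    Submodule.span K (Set.range (socle K N n)) = LinearMap.ker (stdOp K N n) := by
  apply Submodule.eq_of_le_of_finrank_eq
  · rw [Submodule.span_le]
    rintro _ ⟨b, rfl⟩
    exact stdOp_socle N n b
  · rw [finrank_span_eq_card (linearIndependent_socle N n),
      finrank_ker_of_hasType (hasType_stdOp N n), Fintype.card_fin]

variable (K) in
/-- A linear space of nilpotent maps commuting with `stdOp`, which up to conjugation contains
all of them. -/
noncomputable def stdNil (N : ℕ) (n : ℕ → ℕ) : Submodule K (Module.End K (StdSpace K N n)) where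
  carrier := {B | Commute B (stdOp K N n) ∧
    ∀ b, B (socle K N n b) ∈ Submodule.span K (socle K N n '' Set.Iio b)}
  add_mem' h h' := ⟨h.1.add_left h'.1, fun b => Submodule.add_mem _ (h.2 b) (h'.2 b)⟩
  zero_mem' := ⟨Commute.zero_left _, fun b => by simp⟩
  smul_mem' c _ h := ⟨h.1.smul_left c, fun b => Submodule.smul_mem _ c (h.2 b)⟩

theorem isNilpotent_stdOp (N : ℕ) (n : ℕ → ℕ) : IsNilpotent (stdOp K N n) :=
  ⟨N, (hasType_stdOp N n).pow_eq_zero⟩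

theorem isNilpotent_of_mem_stdNil {N : ℕ} {n : ℕ → ℕ} {B : Module.End K (StdSpace K N n)}
    (hB : B ∈ stdNil K N n) : IsNilpotent B := by
  have key : ∀ k, ∀ b : Fin (numGt N n 0), (b : ℕ) < k → (B ^ k) (socle K N n b) = 0 := by
    intro k
    induction k with
    | zero => intro b hb; omega
    | succ k ih =>
      intro b hb
      rw [pow_succ, Module.End.mul_apply]
      have h2 : Submodule.span K (socle K N n '' Set.Iio b) ≤ LinearMap.ker (B ^ k) := by
        rw [Submodule.span_le]
        rintro _ ⟨b', hb', rfl⟩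
        have : (b' : ℕ) < b := hb'
        exact ih b' (by omega)
      exact h2 (hB.2 b)
  refine isNilpotent_of_ker (isNilpotent_stdOp N n) hB.1 (k := numGt N n 0) fun v hv => ?_
  have h2 : LinearMap.ker (stdOp K N n) ≤ LinearMap.ker (B ^ numGt N n 0) := by
    rw [← span_socle, Submodule.span_le]
    rintro _ ⟨b, rfl⟩
    exact key _ b b.2
  exact h2 hv

theorem finrank_ker_inf_range [FiniteDimensional K V] {N : ℕ} {n : ℕ → ℕ} {J : Module.End K V}
    (h : HasType N n J) (i : ℕ) :
    Module.finrank K ↥(LinearMap.ker J ⊓ LinearMap.range (J ^ i)) = numGt N n i := by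
  have h1 := rk_add_ker (J.domRestrict (LinearMap.range (J ^ i)))
  have h2 : LinearMap.range (J.domRestrict (LinearMap.range (J ^ i))) =
      LinearMap.range (J ^ (i + 1)) := by
    rw [LinearMap.range_domRestrict, ← LinearMap.range_comp, pow_succ']; rfl
  have h3 : Module.finrank K (LinearMap.ker (J.domRestrict (LinearMap.range (J ^ i)))) =
      Module.finrank K ↥(LinearMap.ker J ⊓ LinearMap.range (J ^ i)) := by
    rw [LinearMap.ker_domRestrict, inf_comm, ← Submodule.map_comap_subtype]
    exact (Submodule.equivMapOfInjective _ (Submodule.subtype_injective _) _).finrank_eq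
  have h4 : rk (J ^ (i + 1)) = _ := h (i + 1)
  have h5 : rk (J ^ i) = _ := h i
  rw [rk, h2, h3] at h1
  rw [rk] at h4 h5
  rw [h4, h5, rho_eq_succ_add N n i] at h1
  omega

theorem exists_flag [FiniteDimensional K V] {N : ℕ} {n : ℕ → ℕ} {J A : Module.End K V}
    (h : HasType N n J) (hA : IsNilpotent A) (hAJ : Commute A J) (r : ℕ) (hr : r ≤ numGt N n 0) :
    ∃ σ : ℕ → V, ∀ j < r, σ j ∉ Submodule.span K (σ '' Set.Iio j) ∧
      A (σ j) ∈ Submodule.span K (σ '' Set.Iio j) ∧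
      J (σ j) = 0 ∧ σ j ∈ LinearMap.range (J ^ (blockLen N n j - 1)) := by
  induction r with
  | zero => exact ⟨0, by simp⟩
  | succ r ih =>
    obtain ⟨σ, hσ⟩ := ih (by omega)
    classical
    set T := Submodule.span K (σ '' Set.Iio r) with hT
    set i := blockLen N n r - 1
    have hpos : 0 < blockLen N n r := lt_blockLen.2 (by omega)
    have hir : r < numGt N n i := lt_blockLen.1 (by omega)
    have hTdim : Module.finrank K T ≤ r := by
      have h1 := finrank_span_finset_le_card (R := K) ((Finset.range r).image σ)
      have h2 : ((Finset.range r).image σ : Set V) = σ '' Set.Iio r := by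
        ext; simp
      rw [Set.finrank, h2] at h1
      exact h1.trans (Finset.card_image_le.trans (by simp))
    have hex : ∃ v ∈ LinearMap.ker J ⊓ LinearMap.range (J ^ i), v ∉ T := by
      by_contra! hcon
      have := Submodule.finrank_mono (show LinearMap.ker J ⊓ LinearMap.range (J ^ i) ≤ T from hcon)
      rw [finrank_ker_inf_range h] at this
      omega
    obtain ⟨v, hv, hvT⟩ := hex
    have hp : ∃ p, (A ^ p) v ∈ T := by
      obtain ⟨p, hp⟩ := hA
      exact ⟨p, by rw [hp]; exact T.zero_mem⟩
    have hp0 : Nat.find hp ≠ 0 := by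
      intro h0
      have := Nat.find_spec hp
      rw [h0] at this
      exact hvT (by simpa using this)
    obtain ⟨q, hq⟩ := Nat.exists_eq_succ_of_ne_zero hp0
    set w := (A ^ q) v with hw
    have hwT : w ∉ T := Nat.find_min hp (by omega)
    have hAw : A w ∈ T := by
      have := Nat.find_spec hp
      rw [hq, Nat.succ_eq_add_one, pow_succ'] at this
      exact this
    have hJw : J w = 0 := by
      rw [hw, ← Module.End.mul_apply, ← (hAJ.pow_left q).eq, Module.End.mul_apply,
        LinearMap.mem_ker.1 hv.1, map_zero]
    have hwR : w ∈ LinearMap.range (J ^ i) := by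
      obtain ⟨u, hu⟩ := hv.2
      exact ⟨(A ^ q) u, by
        rw [← Module.End.mul_apply, ← ((hAJ.pow_left q).pow_right i).eq, Module.End.mul_apply, hu]⟩
    have himg : ∀ j ≤ r, Function.update σ r w '' Set.Iio j = σ '' Set.Iio j := by
      intro j hj
      refine Set.image_congr fun k hk => Function.update_of_ne ?_ _ _
      have : k < j := hk
      omega
    refine ⟨Function.update σ r w, fun j hj => ?_⟩
    rw [himg j (by omega)]
    rcases Nat.lt_succ_iff_lt_or_eq.1 hj with hj | rfl
    · rw [Function.update_of_ne (by omega)]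
      exact hσ j hj
    · rw [Function.update_self]
      exact ⟨hwT, hAw, hJw, hwR⟩

theorem exists_stdNil [FiniteDimensional K V] {N : ℕ} {n : ℕ → ℕ} {J A : Module.End K V}
    (h : HasType N n J) (hA : IsNilpotent A) (hAJ : Commute A J) :
    ∃ Θ : StdSpace K N n ≃ₗ[K] V, Θ.conj (stdOp K N n) = J ∧ Θ.symm.conj A ∈ stdNil K N n := by
  obtain ⟨σ, hσ⟩ := exists_flag h hA hAJ _ le_rfl
  have he : ∀ b : Fin (numGt N n 0), ∃ e, (J ^ (blockLen N n b - 1)) e = σ b :=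
    fun b => (hσ b b.2).2.2.2
  choose e he using he
  let f : StdSpace K N n →ₗ[K] V := (Pi.basisFun K _).constr K fun p => (J ^ (p.2 : ℕ)) (e p.1)
  have hfs : ∀ p, f (Pi.single p 1) = (J ^ (p.2 : ℕ)) (e p.1) := fun p => by
    rw [← Pi.basisFun_apply, Module.Basis.constr_basis]
  have hfsoc : ∀ b, f (socle K N n b) = σ b := fun b => by rw [socle, hfs, ← he]
  have hfJ : f ∘ₗ stdOp K N n = J ∘ₗ f := by
    refine (Pi.basisFun K _).ext fun p => ?_
    rw [Pi.basisFun_apply, LinearMap.comp_apply, LinearMap.comp_apply, hfs]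
    by_cases hp : (p.2 : ℕ) + 1 < blockLen N n p.1
    · have := jordanOp_pow_single (K := K) (fun b : Fin (numGt N n 0) => blockLen N n b) 1 p.1 p.2 hp
      rw [pow_one] at this
      rw [stdOp, this, hfs, pow_succ', Module.End.mul_apply]
    · have := jordanOp_pow_single_eq_zero (K := K)
        (fun b : Fin (numGt N n 0) => blockLen N n b) 1 p.1 p.2 hp
      rw [pow_one] at this
      have h2 : (p.2 : ℕ) = blockLen N n p.1 - 1 := by have := p.2.2; omega
      rw [stdOp, this, map_zero, h2, he, (hσ _ p.1.2).2.2.1]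
  have hli : LinearIndependent K fun b : Fin (numGt N n 0) => σ b := by
    have key : ∀ k ≤ numGt N n 0, LinearIndependent K fun b : Fin k => σ b := by
      intro k
      induction k with
      | zero => exact fun _ => linearIndependent_empty_type
      | succ k ih =>
        intro hk
        refine linearIndependent_finSucc'.2 ⟨ih (by omega), fun hmem => (hσ k hk).1 ?_⟩
        rw [Fin.val_last] at hmem
        convert hmem using 2
        ext v
        simp only [Set.mem_image, Set.mem_Iio, Set.mem_range]
        constructor
        · rintro ⟨j, hj, rfl⟩; exact ⟨⟨j, hj⟩, rfl⟩
        · rintro ⟨j, rfl⟩; exact ⟨j, j.2, rfl⟩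
    exact key _ le_rfl
  have hinj : Function.Injective f := by
    refine injective_of_ker (isNilpotent_stdOp N n) f hfJ fun v hv hfv => ?_
    have hv' : v ∈ Submodule.span K (Set.range (socle K N n)) := by rw [span_socle]; exact hv
    rw [Submodule.mem_span_range_iff_exists_fun] at hv'
    obtain ⟨c, rfl⟩ := hv'
    simp only [map_sum, map_smul, hfsoc] at hfv
    have := Fintype.linearIndependent_iff.1 hli c hfv
    simp [this]
  have hdim : Module.finrank K (StdSpace K N n) = Module.finrank K V := by
    rw [h.finrank, (hasType_stdOp N n).finrank]
  let Θ := LinearEquiv.ofInjectiveOfFinrankEq f hinj hdim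
  have hΘ : ∀ v, Θ v = f v := fun v => rfl
  have hx : ∀ v, Θ (stdOp K N n v) = J (Θ v) := fun v => LinearMap.congr_fun hfJ v
  refine ⟨Θ, ?_, ?_, fun b => ?_⟩
  · ext v
    rw [LinearEquiv.conj_apply_apply, hx, LinearEquiv.apply_symm_apply]
  · refine LinearMap.ext fun v => Θ.injective ?_
    simp only [Module.End.mul_apply, LinearEquiv.conj_apply_apply, LinearEquiv.symm_symm, hx,
      LinearEquiv.apply_symm_apply]
    exact LinearMap.congr_fun hAJ.eq (Θ v)
  · rw [LinearEquiv.conj_apply_apply, LinearEquiv.symm_symm, hΘ, hfsoc]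
    have h1 := (hσ b b.2).2.1
    have h2 : Submodule.span K (σ '' Set.Iio (b : ℕ)) =
        (Submodule.span K (socle K N n '' Set.Iio b)).map Θ.toLinearMap := by
      rw [Submodule.map_span, ← Set.image_comp]
      congr 1
      ext v
      simp only [Set.mem_image, Set.mem_Iio, Function.comp_apply]
      constructor
      · rintro ⟨j, hj, rfl⟩
        exact ⟨⟨j, by omega⟩, hj, hfsoc _⟩
      · rintro ⟨j, hj, rfl⟩
        exact ⟨j, hj, (hfsoc _).symm⟩
    rw [h2] at h1
    obtain ⟨w, hw, hw'⟩ := h1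
    have : Θ.symm (A (σ b)) = w := by rw [← hw']; exact Θ.symm_apply_apply w
    rw [this]; exact hw

end Model

section MaxRank

variable {K : Type*} [Field K] {V : Type*} [AddCommGroup V] [Module K V]
  {W : Type*} [AddCommGroup W] [Module K W]

theorem rk_eq_of_intertwine (Θ : V ≃ₗ[K] W) {A : Module.End K V} {B : Module.End K W}
    (h : ∀ v, Θ (A v) = B (Θ v)) : rk A = rk B := by
  have h1 : Θ.toLinearMap ∘ₗ A = B ∘ₗ Θ.toLinearMap := LinearMap.ext h
  have h2 : LinearMap.range B = (LinearMap.range A).map Θ.toLinearMap := by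
    rw [← LinearMap.range_comp, h1, LinearMap.range_comp, LinearEquiv.range, Submodule.map_top]
  rw [rk, rk, h2]
  exact (LinearEquiv.finrank_map_eq Θ _).symm

theorem intertwine_mul (Θ : V →ₗ[K] W) {A A' : Module.End K V} {B B' : Module.End K W}
    (h : ∀ v, Θ (A v) = B (Θ v)) (h' : ∀ v, Θ (A' v) = B' (Θ v)) (v : V) :
    Θ ((A * A') v) = (B * B') (Θ v) := by
  rw [Module.End.mul_apply, Module.End.mul_apply, h, h']

theorem intertwine_pow (Θ : V →ₗ[K] W) {A : Module.End K V} {B : Module.End K W}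
    (h : ∀ v, Θ (A v) = B (Θ v)) (m : ℕ) (v : V) : Θ ((A ^ m) v) = (B ^ m) (Θ v) := by
  induction m generalizing v with
  | zero => simp
  | succ m ih => rw [pow_succ, pow_succ, Module.End.mul_apply, Module.End.mul_apply, ih, h]

theorem rk_le_finrank [FiniteDimensional K V] (A : W →ₗ[K] V) : rk A ≤ Module.finrank K V :=
  Submodule.finrank_le _

variable (K) in
/-- The largest rank of `A ^ m`, for `A` nilpotent commuting with a nilpotent map of type `n`. -/
noncomputable def maxRank (N : ℕ) (n : ℕ → ℕ) (m : ℕ) : ℕ :=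
  sSup {r | ∃ B ∈ stdNil K N n, rk (B ^ m) = r}

theorem bddAbove_ranks (N : ℕ) (n : ℕ → ℕ) (m : ℕ) :
    BddAbove {r | ∃ B ∈ stdNil K N n, rk (B ^ m) = r} :=
  ⟨_, fun _ ⟨_, _, h⟩ => h ▸ rk_le_finrank _⟩

variable (K) in
theorem exists_maxRank (N : ℕ) (n : ℕ → ℕ) (m : ℕ) :
    ∃ B ∈ stdNil K N n, rk (B ^ m) = maxRank K N n m :=
  have hne : {r | ∃ B ∈ stdNil K N n, rk (B ^ m) = r}.Nonempty :=
    ⟨_, 0, Submodule.zero_mem _, rfl⟩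
  Nat.sSup_mem hne (bddAbove_ranks N n m)

theorem exists_stdNil_rk [FiniteDimensional K V] {N : ℕ} {n : ℕ → ℕ} {J A : Module.End K V}
    (h : HasType N n J) (hA : IsNilpotent A) (hAJ : Commute A J) :
    ∃ B ∈ stdNil K N n, ∀ l m, rk (stdOp K N n ^ l * B ^ m) = rk (J ^ l * A ^ m) := by
  obtain ⟨Θ, h1, h2⟩ := exists_stdNil h hA hAJ
  refine ⟨_, h2, fun l m => rk_eq_of_intertwine Θ ?_⟩
  have e1 : ∀ v, Θ (stdOp K N n v) = J (Θ v) := fun v => by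
    rw [← h1, LinearEquiv.conj_apply_apply, LinearEquiv.symm_apply_apply]
  have e2 : ∀ v, Θ (Θ.symm.conj A v) = A (Θ v) := fun v => by
    rw [LinearEquiv.conj_apply_apply, LinearEquiv.symm_symm, LinearEquiv.apply_symm_apply]
  exact intertwine_mul Θ.toLinearMap (intertwine_pow Θ.toLinearMap e1 l)
    (intertwine_pow Θ.toLinearMap e2 m)

theorem rk_pow_le_maxRank [FiniteDimensional K V] {N : ℕ} {n : ℕ → ℕ} {J A : Module.End K V}
    (h : HasType N n J) (hA : IsNilpotent A) (hAJ : Commute A J) (m : ℕ) :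
    rk (A ^ m) ≤ maxRank K N n m := by
  obtain ⟨B, hB, hr⟩ := exists_stdNil_rk h hA hAJ
  have := hr 0 m
  rw [pow_zero, pow_zero, one_mul, one_mul] at this
  exact le_csSup (bddAbove_ranks N n m) ⟨B, hB, this⟩

theorem maxRank_congr {N : ℕ} {n n' : ℕ → ℕ} (h : ∀ l, rho N n l = rho N n' l) (m : ℕ) :
    maxRank K N n m = maxRank K N n' m := by
  apply le_antisymm
  · obtain ⟨B, hB, hr⟩ := exists_maxRank K N n m
    rw [← hr]
    exact rk_pow_le_maxRank (fun l => (hasType_stdOp N n l).trans (h l))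
      (isNilpotent_of_mem_stdNil hB) hB.1 m
  · obtain ⟨B, hB, hr⟩ := exists_maxRank K N n' m
    rw [← hr]
    exact rk_pow_le_maxRank (fun l => (hasType_stdOp N n' l).trans (h l).symm)
      (isNilpotent_of_mem_stdNil hB) hB.1 m

theorem maxRank_antitone (N : ℕ) (n : ℕ → ℕ) : Antitone (maxRank K N n) := by
  refine antitone_nat_of_succ_le fun m => ?_
  obtain ⟨B, hB, hr⟩ := exists_maxRank K N n (m + 1)
  rw [← hr, pow_succ']
  refine (rk_comp_le_right B (B ^ m)).trans ?_
  exact rk_pow_le_maxRank (hasType_stdOp N n) (isNilpotent_of_mem_stdNil hB) hB.1 m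

theorem maxRank_zero (N : ℕ) (n : ℕ → ℕ) : maxRank K N n 0 = rho N n 0 := by
  obtain ⟨B, hB, hr⟩ := exists_maxRank K N n 0
  rw [← hr, ← hasType_stdOp (K := K) N n 0, pow_zero, pow_zero]

theorem rk_prodMap [FiniteDimensional K V] [FiniteDimensional K W] (f : Module.End K V)
    (g : Module.End K W) : rk (f.prodMap g) = rk f + rk g := by
  have h : LinearMap.range (f.prodMap g) = LinearMap.range
      ((LinearMap.range f).subtype.prodMap (LinearMap.range g).subtype) := by
    rw [LinearMap.range_prodMap, LinearMap.range_prodMap, Submodule.range_subtype,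
      Submodule.range_subtype]
  rw [rk, h, LinearMap.finrank_range_of_inj, Module.finrank_prod]
  exact (Submodule.subtype_injective _).prodMap (Submodule.subtype_injective _)

theorem prodMap_pow (f : Module.End K V) (g : Module.End K W) (m : ℕ) :
    (f.prodMap g : Module.End K (V × W)) ^ m = (f ^ m).prodMap (g ^ m) := by
  induction m with
  | zero => rw [pow_zero, pow_zero, pow_zero]; exact LinearMap.prodMap_one.symm
  | succ m ih => rw [pow_succ, ih, pow_succ, pow_succ]; exact LinearMap.prodMap_mul _ _ _ _

/-- Adjoining a direct summand on which the nilpotent map is the `c`-th power of a regular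
nilpotent map of size `M`. -/
theorem exists_stdNil_summand {N : ℕ} {n n' : ℕ → ℕ} {M c : ℕ}
    (h : ∀ l, rho N n l = (M - c * l) + rho N n' l) {B' : Module.End K (StdSpace K N n')}
    (hB' : B' ∈ stdNil K N n') :
    ∃ B ∈ stdNil K N n, ∀ l m, rk (stdOp K N n ^ l * B ^ m) =
      (M - (c * l + m)) + rk (stdOp K N n' ^ l * B' ^ m) := by
  let S := jordanOp K fun _ : Unit => M
  have hS : ∀ k, rk (S ^ k) = M - k := fun k => by
    rw [rk_jordanOp_pow]; simp
  have hSnil : IsNilpotent S := by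
    refine ⟨M, ?_⟩
    have := hS M
    rw [Nat.sub_self, rk, Submodule.finrank_eq_zero, LinearMap.range_eq_bot] at this
    exact this
  let J : Module.End K (_ × _) := (S ^ c).prodMap (stdOp K N n')
  let A : Module.End K (_ × _) := S.prodMap B'
  have hJA : ∀ l m, J ^ l * A ^ m = (S ^ (c * l + m)).prodMap (stdOp K N n' ^ l * B' ^ m) := by
    intro l m
    rw [prodMap_pow, prodMap_pow, ← pow_mul, pow_add]
    exact LinearMap.prodMap_mul _ _ _ _
  have hrk : ∀ l m, rk (J ^ l * A ^ m) =
      (M - (c * l + m)) + rk (stdOp K N n' ^ l * B' ^ m) := fun l m => by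
    rw [hJA, rk_prodMap, hS]
  have hJ : HasType N n J := fun l => by
    have := hrk l 0
    rw [pow_zero, pow_zero, mul_one, mul_one, hasType_stdOp N n' l] at this
    rw [this, h, add_zero]
  have hAnil : IsNilpotent A := by
    obtain ⟨a, ha⟩ := hSnil
    obtain ⟨b, hb⟩ := isNilpotent_of_mem_stdNil hB'
    refine ⟨a + b, ?_⟩
    rw [prodMap_pow, pow_add, pow_add, ha, hb, zero_mul, mul_zero]
    exact LinearMap.prodMap_zero
  have hcomm : Commute A J := by
    have h1 : A * J = (S * S ^ c).prodMap (B' * stdOp K N n') := LinearMap.prodMap_mul _ _ _ _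
    have h2 : J * A = (S ^ c * S).prodMap (stdOp K N n' * B') := LinearMap.prodMap_mul _ _ _ _
    rw [Commute, SemiconjBy, h1, h2, hB'.1.eq, ← pow_succ, ← pow_succ']
  obtain ⟨B, hB, hr⟩ := exists_stdNil_rk hJ hAnil hcomm
  exact ⟨B, hB, fun l m => (hr l m).trans (hrk l m)⟩

theorem add_maxRank_le {N : ℕ} {n n' : ℕ → ℕ} {M c : ℕ}
    (h : ∀ l, rho N n l = (M - c * l) + rho N n' l) (m : ℕ) :
    (M - m) + maxRank K N n' m ≤ maxRank K N n m := by
  obtain ⟨B', hB', hr⟩ := exists_maxRank K N n' m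
  obtain ⟨B, hB, h2⟩ := exists_stdNil_summand h hB'
  have := h2 0 m
  rw [pow_zero, pow_zero, one_mul, one_mul, mul_zero, zero_add, hr] at this
  rw [← this]
  exact rk_pow_le_maxRank (hasType_stdOp N n) (isNilpotent_of_mem_stdNil hB) hB.1 m

end MaxRank

section UpperBound

variable {K : Type*} [Field K] {V : Type*} [AddCommGroup V] [Module K V] [FiniteDimensional K V]

theorem finrank_map_add_ker (A : Module.End K V) (U : Submodule K V) :
    Module.finrank K (U.map A) + Module.finrank K ↥(U ⊓ LinearMap.ker A) =
      Module.finrank K U := by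
  have h1 := rk_add_ker (A.domRestrict U)
  rw [rk, LinearMap.range_domRestrict, LinearMap.ker_domRestrict] at h1
  rw [← h1, ← Submodule.map_comap_subtype]
  congr 1
  exact (Submodule.equivMapOfInjective _ (Submodule.subtype_injective _) _).finrank_eq.symm

theorem not_ker_le_of_pos {N : ℕ} {n : ℕ → ℕ} {J : Module.End K V} (h : HasType N n J) {t : ℕ}
    (ht : 0 < t) (htN : t < N) (hn : 0 < n t) :
    ¬ LinearMap.ker (J ^ t) ≤
      LinearMap.ker (J ^ (t - 1)) ⊔ (LinearMap.ker (J ^ (t + 1))).map J := by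
  intro hle
  obtain ⟨s, rfl⟩ := Nat.exists_eq_add_of_lt ht
  simp only [zero_add, Nat.add_sub_cancel] at *
  have h1 : LinearMap.ker J ⊓ LinearMap.range (J ^ s) ≤
      LinearMap.ker J ⊓ LinearMap.range (J ^ (s + 1)) := by
    rintro v ⟨hv, w, rfl⟩
    refine ⟨hv, ?_⟩
    have hw : w ∈ LinearMap.ker (J ^ (s + 1)) := by
      rw [LinearMap.mem_ker, pow_succ']; exact hv
    obtain ⟨a, ha, b, ⟨u, hu, rfl⟩, rfl⟩ := Submodule.mem_sup.1 (hle hw)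
    refine ⟨u, ?_⟩
    rw [map_add, LinearMap.mem_ker.1 ha, zero_add, pow_succ, Module.End.mul_apply]
  have h2 := Submodule.finrank_mono h1
  rw [finrank_ker_inf_range h, finrank_ker_inf_range h, numGt, numGt] at h2
  have h3 : (range N).filter (s < ·) = insert (s + 1) ((range N).filter (s + 1 < ·)) := by
    ext i
    simp only [Finset.mem_filter, Finset.mem_range, Finset.mem_insert]
    omega
  rw [h3, Finset.sum_insert (by simp)] at h2
  omega

theorem rk_pow_mul_add_card_le {J A : Module.End K V} (hA : IsNilpotent A)
    (hAJ : Commute A J) (l : ℕ) (T : Finset ℕ) (b : ℕ → ℕ)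
    (hlb : ∀ t ∈ T, l ≤ b t) (hbt : ∀ t ∈ T, b t < t)
    (hT : ∀ t ∈ T, ¬ LinearMap.ker (J ^ t) ≤
      LinearMap.ker (J ^ (t - 1)) ⊔ (LinearMap.ker (J ^ (t + 1))).map J)
    (hmono : ∀ t' ∈ T, ∀ t ∈ T, t' < t → b t' < b t ∧ t' + b t < t + b t') :
    rk (J ^ l * A) + #T ≤ rk (J ^ l) := by
  classical
  have hAk : ∀ (k : ℕ) (v : V), (J ^ k) (A v) = A ((J ^ k) v) := fun k v => by
    rw [← Module.End.mul_apply, ← (hAJ.pow_right k).eq, Module.End.mul_apply]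
  let Z : ℕ → Submodule K V := fun t =>
    LinearMap.ker (J ^ (t - 1)) ⊔ (LinearMap.ker (J ^ (t + 1))).map J
  have hZA : ∀ t, (Z t).map A ≤ Z t := by
    intro t
    rw [Submodule.map_sup, ← Submodule.map_comp]
    refine sup_le_sup ?_ ?_
    · rintro _ ⟨v, hv, rfl⟩
      rw [LinearMap.mem_ker, hAk, LinearMap.mem_ker.1 hv, map_zero]
    · rintro _ ⟨v, hv, rfl⟩
      refine ⟨A v, ?_, ?_⟩
      · change (J ^ (t + 1)) (A v) = 0
        rw [hAk, LinearMap.mem_ker.1 hv, map_zero]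
      · have := hAk 1 v
        rwa [pow_one] at this
  have hfun : ∀ t ∈ T, ∃ f : V →ₗ[K] K, (∃ w ∈ LinearMap.ker (J ^ t), f w = 1) ∧
      (∀ z ∈ Z t, f z = 0) ∧ ∀ w ∈ LinearMap.ker (J ^ t), f (A w) = 0 := by
    intro t ht
    have hne : ¬ LinearMap.ker (J ^ t) ≤ Z t ⊔ (LinearMap.ker (J ^ t)).map A := by
      intro hle
      have key : ∀ k, LinearMap.ker (J ^ t) ≤ Z t ⊔ (LinearMap.ker (J ^ t)).map (A ^ k) := by
        intro k
        induction k with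
        | zero => rw [pow_zero, Module.End.one_eq_id, Submodule.map_id]; exact le_sup_right
        | succ k ih =>
          refine hle.trans (sup_le le_sup_left ?_)
          refine (Submodule.map_mono ih).trans ?_
          rw [Submodule.map_sup, ← Submodule.map_comp, pow_succ']
          exact sup_le_sup (hZA t) le_rfl
      obtain ⟨k, hk⟩ := hA
      have := key k
      rw [hk, Submodule.map_zero, sup_bot_eq] at this
      exact hT t ht this
    obtain ⟨w, hw, hw2⟩ := Set.not_subset.1 hne
    obtain ⟨f, hfw, hf⟩ := Submodule.exists_le_ker_of_notMem hw2
    refine ⟨(f w)⁻¹ • f, ⟨w, hw, by simp [hfw]⟩, fun z hz => ?_, fun w hw => ?_⟩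
    · have : f z = 0 := hf (Submodule.mem_sup_left hz)
      simp [this]
    · have : f (A w) = 0 := hf (Submodule.mem_sup_right ⟨w, hw, rfl⟩)
      simp [this]
  choose! f hf1 hf2 hf3 using hfun
  let P := ∀ t : T, LinearMap.ker (J ^ (t : ℕ))
  let Φ : P →ₗ[K] V := ∑ t : T, (J ^ b t) ∘ₗ (Submodule.subtype _) ∘ₗ LinearMap.proj t
  have hΦ : ∀ w : P, Φ w = ∑ t : T, (J ^ b t) (w t : V) := fun w => by
    simp only [Φ, LinearMap.sum_apply]; rfl
  let Λ : P →ₗ[K] (T → K) := LinearMap.pi fun t =>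
    f t ∘ₗ (Submodule.subtype _) ∘ₗ LinearMap.proj t
  have hΛsurj : LinearMap.range Λ = ⊤ := by
    rw [LinearMap.range_eq_top]
    intro y
    have : ∀ t : T, ∃ w ∈ LinearMap.ker (J ^ (t : ℕ)), f t w = 1 := fun t => hf1 t t.2
    choose w hw hw1 using this
    refine ⟨fun t => y t • ⟨w t, hw t⟩, ?_⟩
    ext t
    change f t (y t • w t) = y t
    rw [map_smul, hw1, smul_eq_mul, mul_one]
  have hker : LinearMap.ker Φ ≤ LinearMap.ker Λ := by
    intro w hw
    rw [LinearMap.mem_ker, hΦ] at hw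
    rw [LinearMap.mem_ker]
    ext t
    change f t (w t : V) = 0
    apply hf2 t t.2
    have hbt' := hbt t t.2
    let u : V := ∑ s : T, if t < s then (J ^ (b s - b t - 1)) (w s : V) else 0
    have hs : (J ^ ((t : ℕ) - 1)) ((w t : V) + J u) = 0 := by
      have e1 : (J ^ ((t : ℕ) - 1 - b t)) (∑ s : T, (J ^ b s) (w s : V)) = 0 := by
        rw [hw, map_zero]
      rw [← e1, map_add, ← Module.End.mul_apply, ← pow_succ, map_sum, map_sum]
      conv_rhs =>
        rw [← Finset.add_sum_erase _ _ (Finset.mem_univ t), ← Module.End.mul_apply, ← pow_add,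
          Nat.sub_add_cancel (show b t ≤ (t : ℕ) - 1 by omega)]
      congr 1
      rw [← Finset.add_sum_erase _ _ (Finset.mem_univ t), if_neg (lt_irrefl t), map_zero,
        zero_add]
      refine Finset.sum_congr rfl fun s hs => ?_
      have hst : s ≠ t := Finset.ne_of_mem_erase hs
      rw [← Module.End.mul_apply, ← pow_add]
      split_ifs with hlt
      · have := hmono t t.2 s s.2 hlt
        rw [← Module.End.mul_apply, ← pow_add]
        congr 2
        omega
      · have hlt' : s < t := lt_of_le_of_ne (not_lt.1 hlt) hst
        have := hmono s s.2 t t.2 hlt'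
        have h0 : (J ^ (s : ℕ)) (w s : V) = 0 := (w s).2
        have e : (t : ℕ) - 1 - b t + b s = ((t : ℕ) - 1 - b t + b s - s) + s := by omega
        rw [map_zero, e, pow_add, Module.End.mul_apply, h0, map_zero]
    have hu : (J ^ ((t : ℕ) + 1)) u = 0 := by
      have e1 : (J ^ ((t : ℕ) - 1 + 1)) ((w t : V) + J u) = 0 := by
        rw [pow_succ', Module.End.mul_apply, hs, map_zero]
      have h0 : (J ^ (t : ℕ)) (w t : V) = 0 := (w t).2
      rw [Nat.sub_add_cancel (by omega), map_add, h0, zero_add, ← Module.End.mul_apply,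
        ← pow_succ] at e1
      exact e1
    have : (w t : V) = ((w t : V) + J u) - J u := by abel
    rw [this]
    exact Submodule.sub_mem _ (Submodule.mem_sup_left hs) (Submodule.mem_sup_right ⟨u, hu, rfl⟩)
  set U := LinearMap.range Φ with hU
  have hAU : U.map A ≤ (LinearMap.ker Λ).map Φ := by
    rintro _ ⟨_, ⟨w, rfl⟩, rfl⟩
    have hAw : ∀ t : T, A (w t : V) ∈ LinearMap.ker (J ^ (t : ℕ)) := fun t => by
      rw [LinearMap.mem_ker, hAk, LinearMap.mem_ker.1 (w t).2, map_zero]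
    refine ⟨fun t => ⟨A (w t), hAw t⟩, ?_, ?_⟩
    · change Λ _ = 0
      ext t
      exact hf3 t t.2 _ (w t).2
    · rw [hΦ, hΦ, map_sum]
      exact Finset.sum_congr rfl fun t _ => hAk _ _
  have d1 : Module.finrank K (U.map A) + #T ≤ Module.finrank K U := by
    have a1 := rk_add_ker Φ
    have a2 := rk_add_ker Λ
    have a3 : rk Λ = #T := by rw [rk, hΛsurj]; simp
    have a4 := rk_add_ker (Φ.domRestrict (LinearMap.ker Λ))
    have a5 := Submodule.finrank_mono hAU
    have a6 : Module.finrank K (LinearMap.ker (Φ.domRestrict (LinearMap.ker Λ))) =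
        Module.finrank K (LinearMap.ker Φ) := by
      rw [LinearMap.ker_domRestrict]
      exact (Submodule.comapSubtypeEquivOfLe hker).finrank_eq
    rw [rk, LinearMap.range_domRestrict] at a4
    have a7 : rk Φ = Module.finrank K U := rfl
    omega
  have d2 := finrank_map_add_ker A U
  have d3 := finrank_map_add_ker A (LinearMap.range (J ^ l))
  have d4 : Module.finrank K ↥(U ⊓ LinearMap.ker A) ≤
      Module.finrank K ↥(LinearMap.range (J ^ l) ⊓ LinearMap.ker A) := by
    refine Submodule.finrank_mono (inf_le_inf ?_ le_rfl)
    rintro _ ⟨w, rfl⟩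
    rw [hΦ]
    refine Submodule.sum_mem _ fun t _ => ⟨(J ^ (b t - l)) (w t : V), ?_⟩
    rw [← Module.End.mul_apply, ← pow_add, Nat.add_sub_cancel' (hlb t t.2)]
  have d5 : rk (J ^ l * A) = Module.finrank K ((LinearMap.range (J ^ l)).map A) := by
    rw [rk, ← (hAJ.pow_right l).eq, ← LinearMap.range_comp]; rfl
  have d6 : rk (J ^ l) = Module.finrank K (LinearMap.range (J ^ l)) := rfl
  omega

end UpperBound

section Greedy

/-- Auxiliary recursion for `tau`. -/
def tauAux (n : ℕ → ℕ) : ℕ → ℕ → ℕ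
  | 0, _ => 0
  | k + 1, i => if 0 < n i ∧ tauAux n k (i + 1) = 0 then 1 else 0

/-- The indicator of the largest parts of the groups obtained by greedily splitting a partition,
from the top, into runs of parts whose sizes differ by at most one. -/
def tau (N : ℕ) (n : ℕ → ℕ) (i : ℕ) : ℕ := tauAux n (N - i) i

theorem tau_of_lt {N : ℕ} (n : ℕ → ℕ) {i : ℕ} (h : i < N) :
    tau N n i = if 0 < n i ∧ tau N n (i + 1) = 0 then 1 else 0 := by
  obtain ⟨k, hk⟩ : ∃ k, N - i = k + 1 := ⟨N - i - 1, by omega⟩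
  have h2 : N - (i + 1) = k := by omega
  rw [tau, tau, hk, h2, tauAux]

theorem tau_of_ge {N : ℕ} (n : ℕ → ℕ) {i : ℕ} (h : N ≤ i) : tau N n i = 0 := by
  rw [tau, Nat.sub_eq_zero_of_le h, tauAux]

theorem tau_le_one (N : ℕ) (n : ℕ → ℕ) (i : ℕ) : tau N n i ≤ 1 := by
  rcases lt_or_ge i N with h | h
  · rw [tau_of_lt n h]; split_ifs <;> omega
  · rw [tau_of_ge n h]; omega

theorem tau_unique {N : ℕ} {n f : ℕ → ℕ} (k : ℕ) (h0 : ∀ i, N ≤ i → f i = 0)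
    (h : ∀ i, k ≤ i → i < N → f i = if 0 < n i ∧ f (i + 1) = 0 then 1 else 0) (i : ℕ)
    (hi : k ≤ i) : f i = tau N n i := by
  have key : ∀ d i, k ≤ i → N ≤ i + d → f i = tau N n i := by
    intro d
    induction d with
    | zero => intro i _ hi; rw [add_zero] at hi; rw [h0 i hi, tau_of_ge n hi]
    | succ d ih =>
      intro i hki hi
      rcases lt_or_ge i N with hlt | hge
      · rw [h i hki hlt, tau_of_lt n hlt, ih (i + 1) (by omega) (by omega)]
      · rw [h0 i hge, tau_of_ge n hge]
  exact key N i hi (by omega)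

theorem pos_of_tau {N : ℕ} {n : ℕ → ℕ} {i : ℕ} (h : tau N n i ≠ 0) :
    i < N ∧ 0 < n i ∧ tau N n (i + 1) = 0 := by
  rcases lt_or_ge i N with hlt | hge
  · rw [tau_of_lt n hlt] at h
    split_ifs at h with h2
    · exact ⟨hlt, h2⟩
    · exact absurd rfl h
  · exact absurd (tau_of_ge n hge) h

theorem tau_le (N : ℕ) (n : ℕ → ℕ) (i : ℕ) : tau N n i ≤ n i := by
  have h1 := tau_le_one N n i
  by_cases h : tau N n i = 0
  · omega
  · have := (pos_of_tau h).2.1; omega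

/-- The type of the restriction of a nilpotent map of type `n` to the range of a generic
nilpotent map commuting with it. -/
def del (N : ℕ) (n : ℕ → ℕ) (i : ℕ) : ℕ := n i - tau N n i + tau N n (i + 1)

/-- The tops of the greedy groups that are larger than `l`. -/
def tops (N : ℕ) (n : ℕ → ℕ) (l : ℕ) : Finset ℕ := {t ∈ range N | l < t ∧ tau N n t ≠ 0}

theorem mem_tops {N : ℕ} {n : ℕ → ℕ} {l t : ℕ} : t ∈ tops N n l ↔ l < t ∧ tau N n t ≠ 0 := by
  simp only [tops, Finset.mem_filter, Finset.mem_range]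
  exact ⟨fun h => h.2, fun h => ⟨(pos_of_tau h.2).1, h⟩⟩

theorem rho_del_add_card (N : ℕ) (n : ℕ → ℕ) (l : ℕ) :
    rho N (del N n) l + #(tops N n l) = rho N n l := by
  have h1 : ∑ i ∈ range N, tau N n (i + 1) * (i - l) =
      ∑ i ∈ range N, tau N n i * (i - 1 - l) := by
    have a := Finset.sum_range_succ (fun i => tau N n i * (i - 1 - l)) N
    rw [tau_of_ge n le_rfl, zero_mul, add_zero] at a
    have b := Finset.sum_range_succ' (fun i => tau N n i * (i - 1 - l)) N
    simp only [Nat.add_sub_cancel, Nat.zero_sub, mul_zero, add_zero] at b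
    rw [← a, b]
  have h2 : #(tops N n l) + ∑ i ∈ range N, tau N n i * (i - 1 - l) =
      ∑ i ∈ range N, tau N n i * (i - l) := by
    rw [tops, Finset.card_filter, ← Finset.sum_add_distrib]
    refine Finset.sum_congr rfl fun i _ => ?_
    have := tau_le_one N n i
    interval_cases h : tau N n i
    · simp
    · split_ifs <;> omega
  have h3 : rho N (del N n) l + ∑ i ∈ range N, tau N n i * (i - l) =
      rho N n l + ∑ i ∈ range N, tau N n (i + 1) * (i - l) := by
    rw [rho, rho, ← Finset.sum_add_distrib, ← Finset.sum_add_distrib]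
    refine Finset.sum_congr rfl fun i _ => ?_
    have := tau_le N n i
    rw [← add_mul, ← add_mul, del]
    congr 1
    omega
  omega

/-- The type obtained by removing all parts of sizes `i` and `j`. -/
def erase (n : ℕ → ℕ) (i j k : ℕ) : ℕ := if k = i ∨ k = j then 0 else n k

theorem rho_erase {N : ℕ} (n : ℕ → ℕ) {i j : ℕ} (hi : i < N) (hj : j < N) (hij : i ≠ j) (l : ℕ) :
    rho N n l = n i * (i - l) + n j * (j - l) + rho N (erase n i j) l := by
  rw [rho, rho, ← Finset.add_sum_erase _ _ (Finset.mem_range.2 hi), add_assoc,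
    ← Finset.add_sum_erase _ _ (Finset.mem_erase.2 ⟨hij.symm, Finset.mem_range.2 hj⟩),
    ← Finset.add_sum_erase (range N) (fun k => erase n i j k * (k - l)) (Finset.mem_range.2 hi),
    ← Finset.add_sum_erase _ (fun k => erase n i j k * (k - l))
      (Finset.mem_erase.2 ⟨hij.symm, Finset.mem_range.2 hj⟩)]
  have e1 : erase n i j i = 0 := by simp [erase]
  have e2 : erase n i j j = 0 := by simp [erase]
  rw [e1, e2, zero_mul, zero_mul, zero_add, zero_add]
  congr 2
  refine Finset.sum_congr rfl fun k hk => ?_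
  simp only [Finset.mem_erase] at hk
  rw [erase, if_neg (by tauto)]

theorem rho_erase_pair {N : ℕ} (n : ℕ → ℕ) {i : ℕ} (hi0 : 0 < i) (hi : i < N) (l : ℕ) :
    rho N n l = (n i * i + n (i - 1) * (i - 1) - (n i + n (i - 1)) * l) +
      rho N (erase n i (i - 1)) l := by
  rw [rho_erase n hi (show i - 1 < N by omega) (by omega)]
  congr 1
  rcases lt_or_ge l i with h | h
  · rw [Nat.mul_sub, Nat.mul_sub, add_mul]
    have a1 : n i * l ≤ n i * i := Nat.mul_le_mul_left _ (by omega)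
    have a2 : n (i - 1) * l ≤ n (i - 1) * (i - 1) := Nat.mul_le_mul_left _ (by omega)
    omega
  · rw [Nat.sub_eq_zero_of_le h, Nat.sub_eq_zero_of_le (show i - 1 ≤ l by omega)]
    have a1 : n i * i ≤ n i * l := Nat.mul_le_mul_left _ (by omega)
    have a2 : n (i - 1) * (i - 1) ≤ n (i - 1) * l := Nat.mul_le_mul_left _ (by omega)
    rw [add_mul]
    omega

theorem rho_erase_single {N : ℕ} (n : ℕ → ℕ) {i : ℕ} (hi : i < N) (l : ℕ) :
    rho N n l = (n i * i - n i * l) + rho N (erase n i i) l := by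
  rw [rho, rho, ← Finset.add_sum_erase _ _ (Finset.mem_range.2 hi),
    ← Finset.add_sum_erase (range N) (fun k => erase n i i k * (k - l)) (Finset.mem_range.2 hi)]
  have e1 : erase n i i i = 0 := by simp [erase]
  rw [e1, zero_mul, zero_add, Nat.mul_sub]
  congr 1
  refine Finset.sum_congr rfl fun k hk => ?_
  simp only [Finset.mem_erase] at hk
  rw [erase, if_neg (by tauto)]

variable {K : Type*} [Field K]

variable (K) in
theorem exists_stdNil_rho_del_le (N : ℕ) (n : ℕ → ℕ) :
    ∃ B ∈ stdNil K N n, ∀ l, rho N (del N n) l ≤ rk (stdOp K N n ^ l * B) := by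
  have key : ∀ k ≤ N, ∀ n : ℕ → ℕ, (∀ j, k ≤ j → j < N → n j = 0) →
      ∃ B ∈ stdNil K N n, ∀ l, rho N (del N n) l ≤ rk (stdOp K N n ^ l * B) := by
    intro k
    induction k using Nat.strong_induction_on with
    | _ k ih =>
    intro hkN n hn
    rcases Nat.lt_or_ge 1 k with hk | hk
    swap
    · refine ⟨0, Submodule.zero_mem _, fun l => ?_⟩
      have h1 := rho_del_add_card N n l
      have h2 : rho N n l = 0 := Finset.sum_eq_zero fun i hi => by
        rcases Nat.eq_zero_or_pos i with rfl | h
        · simp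
        · rw [hn i (by omega) (Finset.mem_range.1 hi), zero_mul]
      omega
    obtain ⟨i, rfl⟩ : ∃ i, k = i + 1 := ⟨k - 1, by omega⟩
    rcases Nat.eq_zero_or_pos (n i) with h0 | hpos
    · refine ih i (by omega) (by omega) n fun j hj hjN => ?_
      rcases Nat.eq_or_lt_of_le hj with rfl | h
      · exact h0
      · exact hn j h hjN
    have htop : ∀ j, i < j → tau N n j = 0 := fun j hj => by
      by_contra hne
      have := pos_of_tau hne
      rw [hn j (by omega) this.1] at this
      omega
    have hti : tau N n i = 1 := by
      rw [tau_of_lt n (by omega), if_pos ⟨hpos, htop _ (by omega)⟩]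
    have hti' : tau N n (i - 1) = 0 := by
      rw [tau_of_lt n (by omega), if_neg]
      rw [Nat.sub_add_cancel (by omega), hti]
      simp
    have htau : ∀ j, (if j = i then 0 else tau N n j) = tau N (erase n i (i - 1)) j := by
      intro j
      refine tau_unique (f := fun j => if j = i then 0 else tau N n j) 0
        (fun j hj => by rw [tau_of_ge n hj, ite_self]) (fun j _ hj => ?_) j
        (Nat.zero_le _)
      by_cases h1 : j = i
      · simp [h1, erase]
      by_cases h2 : j = i - 1
      · simp [h2, erase, hti']
      · rw [if_neg h1, if_neg (show j + 1 ≠ i by omega), erase, if_neg (not_or.2 ⟨h1, h2⟩),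
          tau_of_lt n hj]
    obtain ⟨B', hB', hr'⟩ := ih (i - 1) (by omega) (by omega) (erase n i (i - 1))
      (fun j hj hjN => by
        rw [erase]
        split_ifs with h
        · rfl
        · exact hn j (by omega) hjN)
    obtain ⟨B, hB, hr⟩ := exists_stdNil_summand
      (rho_erase_pair n (show 0 < i by omega) (show i < N by omega)) hB'
    refine ⟨B, hB, fun l => ?_⟩
    have h1 := hr l 1
    rw [pow_one, pow_one] at h1
    have h2 := hr' l
    have h3 := rho_del_add_card N n l
    have h4 := rho_del_add_card N (erase n i (i - 1)) l
    have h5 := rho_erase_pair n (show 0 < i by omega) (show i < N by omega) l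
    rw [h1]
    rcases lt_or_ge l i with hl | hl
    · have h6 : tops N n l = insert i (tops N (erase n i (i - 1)) l) := by
        ext t
        simp only [Finset.mem_insert, mem_tops, ← htau]
        by_cases hti : t = i
        · subst hti; simp [*]
        · simp [hti]
      have h7 : #(tops N n l) = #(tops N (erase n i (i - 1)) l) + 1 := by
        rw [h6, Finset.card_insert_of_notMem]
        simp [mem_tops, ← htau]
      omega
    · have h6 : tops N n l = tops N (erase n i (i - 1)) l := by
        ext t
        simp only [mem_tops, ← htau]
        by_cases hti : t = i
        · subst hti; simp [hl]
        · simp [hti]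
      have a1 : n i * i ≤ n i * l := Nat.mul_le_mul_left _ (by omega)
      have a2 : n (i - 1) * (i - 1) ≤ n (i - 1) * l := Nat.mul_le_mul_left _ (by omega)
      rw [h6] at h3
      rw [add_mul] at h5
      omega
  exact key N le_rfl n fun j h1 h2 => by omega

theorem rk_pow_mul_le_rho_del {V : Type*} [AddCommGroup V] [Module K V] [FiniteDimensional K V]
    {N : ℕ} {n : ℕ → ℕ} {J A : Module.End K V} (h : HasType N n J) (hA : IsNilpotent A)
    (hAJ : Commute A J) (l : ℕ) : rk (J ^ l * A) ≤ rho N (del N n) l := by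
  have h1 := rho_del_add_card N n l
  rw [← h l] at h1
  have hsub : ∀ t, {s ∈ tops N n l | s < t} ⊆ Finset.Ioo l t := fun t s hs => by
    rw [Finset.mem_filter, mem_tops] at hs
    exact Finset.mem_Ioo.2 ⟨hs.1.1, hs.2⟩
  have h2 := rk_pow_mul_add_card_le hA hAJ l (tops N n l)
    (fun t => l + #{s ∈ tops N n l | s < t}) (fun t _ => by omega) (fun t ht => by
      have a := Finset.card_le_card (hsub t)
      have b := (mem_tops.1 ht).1
      rw [Nat.card_Ioo] at a
      omega) (fun t ht => by
      have a := mem_tops.1 ht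
      have b := pos_of_tau a.2
      exact not_ker_le_of_pos h (by omega) b.1 b.2.1) (fun t' ht' t ht hlt => by
      have e : ({s ∈ tops N n l | s < t} : Finset ℕ) =
          {s ∈ tops N n l | s < t'} ∪ {s ∈ tops N n l | t' ≤ s ∧ s < t} := by
        ext s
        simp only [Finset.mem_filter, Finset.mem_union]
        constructor
        · rintro ⟨a, b⟩
          rcases lt_or_ge s t' with h | h
          · exact .inl ⟨a, h⟩
          · exact .inr ⟨a, h, b⟩
        · rintro (⟨a, b⟩ | ⟨a, b, c⟩)
          · exact ⟨a, by omega⟩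
          · exact ⟨a, c⟩
      have e2 : Disjoint ({s ∈ tops N n l | s < t'}) ({s ∈ tops N n l | t' ≤ s ∧ s < t}) := by
        rw [Finset.disjoint_left]
        intro s hs hs'
        rw [Finset.mem_filter] at hs hs'
        omega
      have e3 : 0 < #{s ∈ tops N n l | t' ≤ s ∧ s < t} :=
        Finset.card_pos.2 ⟨t', Finset.mem_filter.2 ⟨ht', le_rfl, hlt⟩⟩
      have e4 : ({s ∈ tops N n l | t' ≤ s ∧ s < t} : Finset ℕ) ⊆
          (Finset.Ico t' t).erase (t' + 1) := by
        intro s hs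
        rw [Finset.mem_filter] at hs
        refine Finset.mem_erase.2 ⟨?_, Finset.mem_Ico.2 hs.2⟩
        rintro rfl
        exact (mem_tops.1 hs.1).2 (pos_of_tau (mem_tops.1 ht').2).2.2
      have e5 := Finset.card_le_card e4
      have hne : t ≠ t' + 1 := by
        rintro rfl
        exact (mem_tops.1 ht).2 (pos_of_tau (mem_tops.1 ht').2).2.2
      rw [Finset.card_erase_of_mem (Finset.mem_Ico.2 ⟨by omega, by omega⟩), Nat.card_Ico] at e5
      rw [e, Finset.card_union_of_disjoint e2]
      omega)
  omega

theorem openCond_rk_pow_mul_pow [Infinite K] {V : Type*} [AddCommGroup V] [Module K V]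
    [FiniteDimensional K V] (J : Module.End K V) (m r : ℕ) :
    OpenCond (K := K) fun A : Module.End K V => r ≤ rk (J * A ^ m) :=
  openCond_rk (fun A : Module.End K V => J * A ^ m)
    (fun A B => (PolyFam.const J).mul ((PolyFam.line A B).pow m)) r

theorem maxRank_le_del [Infinite K] (N : ℕ) (n : ℕ → ℕ) {m : ℕ} (hm : 0 < m) :
    maxRank K N n m ≤ maxRank K N (del N n) (m - 1) := by
  obtain ⟨B₁, hB₁, hr₁⟩ := exists_maxRank K N n m
  obtain ⟨B₂, hB₂, hr₂⟩ := exists_stdNil_rho_del_le K N n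
  obtain ⟨A, hAU, hA1, hA2⟩ := OpenCond.exists_and
    (openCond_rk_pow_mul_pow (1 : Module.End K (StdSpace K N n)) m (maxRank K N n m))
    (OpenCond.all (range N) fun l _ =>
      openCond_rk_pow_mul_pow (stdOp K N n ^ l) 1 (rho N (del N n) l)) (stdNil K N n)
    ⟨B₁, hB₁, by rw [one_mul, hr₁]⟩ ⟨B₂, hB₂, fun l _ => by rw [pow_one]; exact hr₂ l⟩
  have hAnil := isNilpotent_of_mem_stdNil hAU
  have hcomm : Commute A (stdOp K N n) := hAU.1
  have htype : ∀ l, rk (stdOp K N n ^ l * A) = rho N (del N n) l := by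
    intro l
    refine le_antisymm (rk_pow_mul_le_rho_del (hasType_stdOp N n) hAnil hcomm l) ?_
    rcases lt_or_ge l N with h | h
    · have := hA2 l (Finset.mem_range.2 h)
      rwa [pow_one] at this
    · rw [rho_eq_zero _ h]; exact Nat.zero_le _
  let U := LinearMap.range A
  have hJU : ∀ v ∈ U, stdOp K N n v ∈ U := by
    rintro _ ⟨v, rfl⟩
    exact ⟨stdOp K N n v, LinearMap.congr_fun hcomm.eq v⟩
  have hAU' : ∀ v ∈ U, A v ∈ U := fun v _ => ⟨v, rfl⟩
  let J' := (stdOp K N n).restrict hJU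
  let A' := A.restrict hAU'
  have hrk : ∀ (B : Module.End K (StdSpace K N n)) (B' : Module.End K U),
      (∀ v : U, (B' v : StdSpace K N n) = B v) → rk B' = rk (B * A) := by
    intro B B' h
    have e : LinearMap.range (B * A) = (LinearMap.range B').map U.subtype := by
      rw [← LinearMap.range_comp]
      ext v
      constructor
      · rintro ⟨w, rfl⟩
        exact ⟨⟨A w, w, rfl⟩, h ⟨A w, w, rfl⟩⟩
      · rintro ⟨⟨_, w, rfl⟩, rfl⟩
        exact ⟨w, (h ⟨A w, w, rfl⟩).symm⟩
    rw [rk, rk, e]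
    exact (Submodule.equivMapOfInjective _ (Submodule.subtype_injective _) _).finrank_eq
  have h1 : HasType N (del N n) J' := fun l => by
    rw [← htype]
    exact hrk _ _ fun v => intertwine_pow U.subtype (fun v => rfl) l v
  have h2 : rk (A' ^ (m - 1)) = rk (A ^ m) := by
    obtain ⟨k, rfl⟩ : ∃ k, m = k + 1 := ⟨m - 1, by omega⟩
    rw [pow_succ, Nat.add_sub_cancel]
    exact hrk _ _ fun v => intertwine_pow U.subtype (fun v => rfl) k v
  have h3 : IsNilpotent A' := by
    obtain ⟨k, hk⟩ := hAnil
    refine ⟨k, LinearMap.ext fun v => Subtype.ext ?_⟩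
    have := intertwine_pow U.subtype (A := A') (B := A) (fun v => rfl) k v
    rw [hk] at this
    exact this
  have h4 : Commute A' J' := LinearMap.ext fun v => Subtype.ext
    (LinearMap.congr_fun hcomm.eq (v : StdSpace K N n))
  rw [one_mul] at hA1
  rw [← h2] at hA1
  exact hA1.trans (rk_pow_le_maxRank h1 h3 h4 (m - 1))

end Greedy

section Cyclic
variable {K : Type*} [Field K] {V : Type*} [AddCommGroup V] [Module K V]

/-- The map whose surjectivity says that `v` generates `V` over `K[J]` modulo the range of `A`. -/
def genMap (N : ℕ) (J : Module.End K V) (v : V) (A : Module.End K V) :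
    (Fin N → K) × V →ₗ[K] V :=
  (Fintype.linearCombination K fun s : Fin N => (J ^ (s : ℕ)) v).coprod A

/-- The map whose injectivity says that `φ` vanishes on no nonzero `K[J]`-submodule of the
kernel of `A`. -/
def cogenMap (N : ℕ) (J : Module.End K V) (φ : V →ₗ[K] K) (A : Module.End K V) :
    V →ₗ[K] (Fin N → K) × V :=
  (LinearMap.pi fun s : Fin N => φ ∘ₗ (J ^ (s : ℕ))).prod A

theorem genMap_apply (N : ℕ) (J : Module.End K V) (v : V) (A : Module.End K V)
    (z : (Fin N → K) × V) :
    genMap N J v A z = ∑ s : Fin N, z.1 s • (J ^ (s : ℕ)) v + A z.2 := by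
  simp [genMap, Fintype.linearCombination_apply]

theorem openCond_genMap [FiniteDimensional K V] [Infinite K] (N : ℕ) (J : Module.End K V) (v : V)
    (r : ℕ) : OpenCond (K := K) fun A : Module.End K V => r ≤ rk (genMap N J v A) := by
  refine openCond_rk _ (fun A B => ?_) r
  have e : (fun t : K => genMap N J v (A + t • B)) =
      fun t => genMap N J v A + t • B ∘ₗ LinearMap.snd K (Fin N → K) V := by
    funext t
    ext <;> simp [genMap]
  rw [e]
  exact .line _ _

theorem openCond_cogenMap [FiniteDimensional K V] [Infinite K] (N : ℕ) (J : Module.End K V)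
    (φ : V →ₗ[K] K) (r : ℕ) :
    OpenCond (K := K) fun A : Module.End K V => r ≤ rk (cogenMap N J φ A) := by
  refine openCond_rk _ (fun A B => ?_) r
  have e : (fun t : K => cogenMap N J φ (A + t • B)) =
      fun t => cogenMap N J φ A + t • LinearMap.inr K (Fin N → K) V ∘ₗ B := by
    funext t
    ext <;> simp [cogenMap]
  rw [e]
  exact .line _ _

theorem genMap_conj [FiniteDimensional K V] {W : Type*} [AddCommGroup W] [Module K W]
    (N : ℕ) (Θ : W ≃ₗ[K] V)
    {J A : Module.End K V} {J' A' : Module.End K W} (hJ : ∀ w, Θ (J' w) = J (Θ w))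
    (hA : ∀ w, Θ (A' w) = A (Θ w)) (v : V) (h : Function.Surjective (genMap N J v A)) :
    Function.Surjective (genMap N J' (Θ.symm v) A') := by
  intro w
  obtain ⟨z, hz⟩ := h (Θ w)
  refine ⟨(z.1, Θ.symm z.2), Θ.injective ?_⟩
  rw [← hz, genMap_apply, genMap_apply, map_add, map_sum, hA]
  congr 1
  · refine Finset.sum_congr rfl fun s _ => ?_
    rw [map_smul]
    congr 1
    have := intertwine_pow Θ.toLinearMap (A := J') (B := J) hJ s (Θ.symm v)
    simpa using this
  · simp

theorem blockLen_antitone (N : ℕ) (n : ℕ → ℕ) : Antitone (blockLen N n) := fun b b' h => by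
  by_contra hlt
  have a1 := lt_blockLen.1 (not_le.1 hlt)
  exact lt_irrefl _ (lt_blockLen.2 (h.trans_lt a1))

variable (K) in
theorem exists_stdNil_genMap (N : ℕ) (n : ℕ → ℕ) : ∃ v, ∃ B ∈ stdNil K N n,
    Function.Surjective (genMap N (stdOp K N n) v B) := by
  classical
  set r := numGt N n 0 with hr
  let s : (Σ b : Fin r, Fin (blockLen N n b)) → Option (Σ b : Fin r, Fin (blockLen N n b)) :=
    fun p => if h : ∃ h : (p.1 : ℕ) + 1 < r, (p.2 : ℕ) < blockLen N n (⟨p.1 + 1, h⟩ : Fin r) then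
      some ⟨⟨p.1 + 1, h.1⟩, ⟨p.2, h.2⟩⟩ else none
  let y : Module.End K (StdSpace K N n) := partialShift K s
  have hlen : ∀ b b' : ℕ, b ≤ b' → blockLen N n b' ≤ blockLen N n b :=
    fun _ _ h => blockLen_antitone N n h
  have hcomm : Commute y (stdOp K N n) := by
    rw [Commute, SemiconjBy, stdOp, jordanOp, partialShift_mul, partialShift_mul]
    congr 1
    funext ⟨b, a⟩
    by_cases h1 : (b : ℕ) + 1 < r
    · have h2 := hlen b (b + 1) (by omega)
      by_cases h3 : (a : ℕ) + 1 < blockLen N n b <;> by_cases h4 : (a : ℕ) < blockLen N n (b + 1) <;>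
        by_cases h5 : (a : ℕ) + 1 < blockLen N n (b + 1) <;> simp [s, h1, h3, h4, h5] <;> omega
    · by_cases h3 : (a : ℕ) + 1 < blockLen N n b <;> simp [s, h1, h3]
  have hypow : ∀ k (b : Fin r) (a), r ≤ b + k → (y ^ k) (Pi.single ⟨b, a⟩ 1) = 0 := by
    intro k
    induction k with
    | zero => intro b a h; have := b.2; omega
    | succ k ih =>
      intro b a h
      rw [pow_succ, Module.End.mul_apply, partialShift_single]
      by_cases h1 : ∃ h : (b : ℕ) + 1 < r, (a : ℕ) < blockLen N n (⟨b + 1, h⟩ : Fin r)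
      · simp only [s]
        rw [dif_pos h1]
        exact ih _ _ (by simp only; omega)
      · simp only [s]
        rw [dif_neg h1]
        simp
  have hnil : IsNilpotent y := ⟨r, (Pi.basisFun K _).ext fun ⟨b, a⟩ => by
    rw [Pi.basisFun_apply, hypow r b a (by omega)]; rfl⟩
  have hv : ∃ v, Function.Surjective (genMap N (stdOp K N n) v y) := by
    rcases Nat.eq_zero_or_pos r with h0 | hpos
    · refine ⟨0, fun w => ⟨0, ?_⟩⟩
      funext p
      have := p.1.2
      omega
    · have h0 : 0 < blockLen N n (⟨0, hpos⟩ : Fin r) := blockLen_pos _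
      refine ⟨Pi.single ⟨⟨0, hpos⟩, ⟨0, h0⟩⟩ 1, ?_⟩
      rw [← LinearMap.range_eq_top, eq_top_iff, ← (Pi.basisFun K _).span_eq, Submodule.span_le]
      rintro _ ⟨⟨b, a⟩, rfl⟩
      rw [Pi.basisFun_apply]
      obtain ⟨b, hb⟩ := b
      rcases b with _ | b
      · have ha : (a : ℕ) < N := by
          have h1 := lt_blockLen.1 a.2
          by_contra h2
          rw [numGt_eq_zero n (not_lt.1 h2)] at h1
          omega
        refine ⟨(Pi.single ⟨a, ha⟩ 1, 0), ?_⟩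
        rw [genMap_apply, Finset.sum_eq_single ⟨a, ha⟩]
        · have := jordanOp_pow_single (K := K) (fun b : Fin r => blockLen N n b) a ⟨0, hpos⟩
            ⟨0, h0⟩ (by simp)
          simp only [Pi.single_eq_same, one_smul, map_zero, add_zero]
          rw [stdOp]
          simpa using this
        · intro q _ hq
          simp [hq]
        · simp
      · refine ⟨(0, Pi.single ⟨⟨b, by omega⟩, ⟨a, a.2.trans_le (hlen b (b + 1) (by omega))⟩⟩ 1), ?_⟩
        rw [genMap_apply]
        simp only [Pi.zero_apply, zero_smul, Finset.sum_const_zero, zero_add]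
        rw [partialShift_single]
        have h1 : ∃ h : b + 1 < r, (a : ℕ) < blockLen N n (⟨b + 1, h⟩ : Fin r) := ⟨hb, a.2⟩
        simp only [s]
        rw [dif_pos h1]
        rfl
  obtain ⟨v, hv⟩ := hv
  obtain ⟨Θ, h1, h2⟩ := exists_stdNil (hasType_stdOp N n) hnil hcomm
  refine ⟨Θ.symm v, _, h2, genMap_conj N Θ (fun w => ?_) (fun w => ?_) v hv⟩
  · conv_rhs => rw [← h1]
    rw [LinearEquiv.conj_apply_apply, LinearEquiv.symm_apply_apply]
  · rw [LinearEquiv.conj_apply_apply, LinearEquiv.symm_symm, LinearEquiv.apply_symm_apply]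

variable (K) in
theorem exists_stdNil_cogenMap (N : ℕ) (n : ℕ → ℕ) : ∃ φ, ∃ B ∈ stdNil K N n,
    Function.Injective (cogenMap N (stdOp K N n) φ B) := by
  classical
  set r := numGt N n 0 with hr
  have hlen : ∀ b : Fin r, blockLen N n b ≤ blockLen N n (b - 1 : ℕ) := fun b =>
    blockLen_antitone N n (by omega)
  let s : (Σ b : Fin r, Fin (blockLen N n b)) → Option (Σ b : Fin r, Fin (blockLen N n b)) :=
    fun p => if 0 < (p.1 : ℕ) then
      some ⟨⟨p.1 - 1, by have := p.1.2; omega⟩,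
        ⟨p.2 + (blockLen N n (p.1 - 1 : ℕ) - blockLen N n p.1), by
          have h1 := p.2.2
          have h2 := hlen p.1
          dsimp only
          omega⟩⟩ else none
  let y : Module.End K (StdSpace K N n) := partialShift K s
  have hcomm : Commute y (stdOp K N n) := by
    rw [Commute, SemiconjBy, stdOp, jordanOp, partialShift_mul, partialShift_mul]
    congr 1
    funext ⟨b, a⟩
    have h2 := hlen b
    by_cases h1 : 0 < (b : ℕ)
    · by_cases h3 : (a : ℕ) + 1 < blockLen N n b
      · have h4 : (a : ℕ) + (blockLen N n (b - 1 : ℕ) - blockLen N n b) + 1 <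
          blockLen N n (b - 1 : ℕ) := by omega
        simp [s, h1, h3, h4]
        omega
      · have h4 : ¬ ((a : ℕ) + (blockLen N n (b - 1 : ℕ) - blockLen N n b) + 1 <
          blockLen N n (b - 1 : ℕ)) := by omega
        simp [s, h1, h3, h4]
    · by_cases h3 : (a : ℕ) + 1 < blockLen N n b <;> simp [s, h1, h3]
  have hysoc : ∀ b : Fin r, 0 < (b : ℕ) →
      y (socle K N n b) = socle K N n ⟨b - 1, by have := b.2; omega⟩ := by
    intro b hb
    rw [socle, socle, partialShift_single]
    simp only [s]
    rw [if_pos hb]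
    have h1 := hlen b
    have h2 := blockLen_pos b
    have h3 : blockLen N n b - 1 + (blockLen N n (b - 1 : ℕ) - blockLen N n b) =
      blockLen N n (b - 1 : ℕ) - 1 := by omega
    simp [h3]
  have hysoc0 : ∀ b : Fin r, ¬ 0 < (b : ℕ) → y (socle K N n b) = 0 := by
    intro b hb
    rw [socle, partialShift_single]
    simp only [s]
    rw [if_neg hb]
    rfl
  have hmem : y ∈ stdNil K N n := by
    refine ⟨hcomm, fun b => ?_⟩
    by_cases hb : 0 < (b : ℕ)
    · rw [hysoc b hb]
      exact Submodule.subset_span ⟨_, Fin.lt_def.2 (show (b : ℕ) - 1 < b by omega), rfl⟩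
    · rw [hysoc0 b hb]
      exact Submodule.zero_mem _
  have key : ∃ φ : StdSpace K N n →ₗ[K] K, ∀ w, stdOp K N n w = 0 → φ w = 0 → y w = 0 → w = 0 := by
    rcases Nat.eq_zero_or_pos r with h0 | hpos
    · refine ⟨0, fun w _ _ _ => ?_⟩
      funext p
      have := p.1.2
      omega
    · refine ⟨LinearMap.proj ⟨⟨0, hpos⟩, ⟨blockLen N n (⟨0, hpos⟩ : Fin r) - 1,
        Nat.sub_lt (blockLen_pos _) one_pos⟩⟩, fun w hw h1 h2 => ?_⟩
      rw [← LinearMap.mem_ker, ← span_socle, Submodule.mem_span_range_iff_exists_fun] at hw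
      obtain ⟨g, rfl⟩ := hw
      have hli := Fintype.linearIndependent_iff.1 (linearIndependent_socle (K := K) N n)
      have hg : ∀ b : Fin r, g b = 0 := by
        intro b
        by_cases hb : 0 < (b : ℕ)
        · rw [map_sum] at h2
          have h3 : ∑ b' : Fin r, (if h : (b' : ℕ) + 1 < r then g ⟨b' + 1, h⟩ else 0) •
              socle K N n b' = 0 := by
            rw [← h2, ← Finset.sum_filter_of_ne (p := fun b' : Fin r => (b' : ℕ) + 1 < r),
              ← Finset.sum_filter_of_ne (p := fun b' : Fin r => 0 < (b' : ℕ)) (s := univ)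
                (f := fun b' => y (g b' • socle K N n b'))]
            · refine Finset.sum_bij' (fun b' hb' => ⟨b' + 1, (Finset.mem_filter.1 hb').2⟩)
                (fun b' _ => ⟨b' - 1, by have := b'.2; omega⟩) (fun b' hb' => by simp)
                (fun b' hb' => ?_) (fun b' hb' => by simp) (fun b' hb' => ?_) (fun b' hb' => ?_)
              · have h5 := (Finset.mem_filter.1 hb').2
                have := b'.2
                exact Finset.mem_filter.2 ⟨Finset.mem_univ _, by simp only; omega⟩
              · have h5 := (Finset.mem_filter.1 hb').2
                exact Fin.ext (by simp only; omega)
              · rw [map_smul, hysoc _ (by simp), dif_pos (Finset.mem_filter.1 hb').2]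
                rfl
            · intro b' _ h
              by_contra hb'
              exact h (by rw [map_smul, hysoc0 b' hb', smul_zero])
            · intro b' _ h
              by_contra hb'
              exact h (by rw [dif_neg hb', zero_smul])
          have h4 := hli _ h3 ⟨b - 1, by have := b.2; omega⟩
          have h5 : (b : ℕ) - 1 + 1 < r := by have := b.2; omega
          simp only at h4
          rw [dif_pos h5] at h4
          rw [← h4]
          congr 1
          exact Fin.ext (by simp only; omega)
        · rw [LinearMap.proj_apply, Finset.sum_apply,
            Finset.sum_eq_single (⟨0, hpos⟩ : Fin r)] at h1
          · have : b = ⟨0, hpos⟩ := Fin.ext (by simp only; omega)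
            rw [this]
            simpa [socle] using h1
          · intro b' _ hb'
            rw [Pi.smul_apply, socle, Pi.single_apply, if_neg, smul_zero]
            intro h
            exact hb' (congrArg Sigma.fst h).symm
          · simp
      exact Finset.sum_eq_zero fun b _ => by rw [hg b, zero_smul]
  obtain ⟨φ, hφ⟩ := key
  refine ⟨φ, y, hmem, ?_⟩
  rw [← LinearMap.ker_eq_bot, LinearMap.ker_eq_bot']
  intro w hw
  have hw1 : ∀ l < N, φ ((stdOp K N n ^ l) w) = 0 := fun l hl =>
    congrFun (congrArg Prod.fst hw) ⟨l, hl⟩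
  have hw2 : y w = 0 := congrArg Prod.snd hw
  have desc : ∀ l, (stdOp K N n ^ l) w = 0 → l ≤ N → w = 0 := by
    intro l
    induction l with
    | zero => intro h _; simpa using h
    | succ l ih =>
      intro h hl
      refine ih (hφ _ ?_ (hw1 l (by omega)) ?_) (by omega)
      · rw [← Module.End.mul_apply, ← pow_succ', h]
      · rw [← Module.End.mul_apply, (hcomm.pow_right l).eq, Module.End.mul_apply, hw2, map_zero]
  exact desc N (by rw [(hasType_stdOp N n).pow_eq_zero]; rfl) le_rfl

/-- The nullity of a generic nilpotent map commuting with a nilpotent map of type `n`. -/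
noncomputable def nullity (K : Type*) [Field K] (N : ℕ) (n : ℕ → ℕ) : ℕ :=
  maxRank K N n 0 - maxRank K N n 1

theorem two_mul_nullity_le (N : ℕ) (k : ℕ) (hk : k ≤ N) (n : ℕ → ℕ)
    (hn : ∀ j, k ≤ j → j < N → n j = 0) : 2 * nullity K N n ≤ k := by
  induction k using Nat.strong_induction_on generalizing n with
  | _ k ih =>
  rcases Nat.lt_or_ge 1 k with h1 | h1
  swap
  · have h2 : rho N n 0 = 0 := Finset.sum_eq_zero fun i hi => by
      rcases Nat.eq_zero_or_pos i with rfl | h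
      · simp
      · rw [hn i (by omega) (Finset.mem_range.1 hi), zero_mul]
    rw [nullity, maxRank_zero, h2]
    omega
  obtain ⟨i, rfl⟩ : ∃ i, k = i + 1 := ⟨k - 1, by omega⟩
  rcases Nat.eq_zero_or_pos (n i) with h0 | hpos
  · have := ih i (by omega) (by omega) n fun j hj hjN => by
      rcases Nat.eq_or_lt_of_le hj with rfl | h
      · exact h0
      · exact hn j h hjN
    omega
  · have h2 := ih (i - 1) (by omega) (by omega) (erase n i (i - 1)) (fun j hj hjN => by
        rw [erase]
        split_ifs with h
        · rfl
        · exact hn j (by omega) hjN)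
    have h3 := rho_erase_pair n (show 0 < i by omega) (show i < N by omega)
    have h4 := add_maxRank_le (K := K) h3 1
    have h5 := h3 0
    have h6 := maxRank_antitone (K := K) N (erase n i (i - 1)) (show 0 ≤ 1 by omega)
    rw [nullity, maxRank_zero] at h2 ⊢
    rw [maxRank_zero] at h6
    have h7 : 1 ≤ n i * i := Nat.mul_pos hpos (by omega)
    omega

theorem exists_stdNil_generic [Infinite K] (N : ℕ) (n : ℕ → ℕ) (m : ℕ) :
    ∃ A ∈ stdNil K N n, ∃ v φ, rk A = maxRank K N n 1 ∧ rk (A ^ m) = maxRank K N n m ∧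
      Function.Surjective (genMap N (stdOp K N n) v A) ∧
      Function.Injective (cogenMap N (stdOp K N n) φ A) := by
  obtain ⟨v, B₁, hB₁, h1⟩ := exists_stdNil_genMap K N n
  obtain ⟨φ, B₂, hB₂, h2⟩ := exists_stdNil_cogenMap K N n
  obtain ⟨B₃, hB₃, h3⟩ := exists_maxRank K N n 1
  obtain ⟨B₄, hB₄, h4⟩ := exists_maxRank K N n m
  have e1 : ∀ A, Function.Surjective (genMap N (stdOp K N n) v A) ↔
      rho N n 0 ≤ rk (genMap N (stdOp K N n) v A) := fun A => by
    rw [← (hasType_stdOp (K := K) N n).finrank, ← LinearMap.range_eq_top]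
    constructor
    · intro h; rw [rk, h, finrank_top]
    · intro h
      exact Submodule.eq_top_of_finrank_eq (le_antisymm (Submodule.finrank_le _) h)
  have e2 : ∀ A, Function.Injective (cogenMap N (stdOp K N n) φ A) ↔
      rho N n 0 ≤ rk (cogenMap N (stdOp K N n) φ A) := fun A => by
    have := rk_add_ker (cogenMap N (stdOp K N n) φ A)
    rw [← (hasType_stdOp (K := K) N n).finrank, ← LinearMap.ker_eq_bot,
      ← Submodule.finrank_eq_zero (R := K)]
    omega
  have o : ∀ m r, OpenCond (K := K) fun A : Module.End K (StdSpace K N n) => r ≤ rk (A ^ m) :=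
    fun m r => by simpa using openCond_rk_pow_mul_pow (1 : Module.End K (StdSpace K N n)) m r
  have h12 := (openCond_genMap N (stdOp K N n) v (rho N n 0)).exists_and
    (openCond_cogenMap N (stdOp K N n) φ (rho N n 0)) (stdNil K N n)
    ⟨B₁, hB₁, (e1 _).1 h1⟩ ⟨B₂, hB₂, (e2 _).1 h2⟩
  have h34 := (o 1 _).exists_and (o m _) (stdNil K N n) ⟨B₃, hB₃, h3.ge⟩ ⟨B₄, hB₄, h4.ge⟩
  obtain ⟨A, hA, ⟨a1, a2⟩, a3, a4⟩ := ((openCond_genMap N (stdOp K N n) v _).and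
    (openCond_cogenMap N (stdOp K N n) φ _)).exists_and ((o 1 _).and (o m _)) _ h12 h34
  have hle := rk_pow_le_maxRank (hasType_stdOp (K := K) N n) (isNilpotent_of_mem_stdNil hA) hA.1
  refine ⟨A, hA, v, φ, ?_, le_antisymm (hle m) a4, (e1 A).2 a1, (e2 A).2 a2⟩
  have := le_antisymm (hle 1) a3
  rwa [pow_one] at this

end Cyclic

section Restrict
variable {K : Type*} [Field K] {V : Type*} [AddCommGroup V] [Module K V] [FiniteDimensional K V]

theorem pow_finrank_eq_zero {f : Module.End K V} (hf : IsNilpotent f) :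
    f ^ Module.finrank K V = 0 := by
  have := LinearMap.aeval_self_charpoly f
  rwa [IsNilpotent.charpoly_eq_X_pow_finrank hf, map_pow, Polynomial.aeval_X] at this

theorem pow_apply_eq_zero_of_ker {J A : Module.End K V} (hJ : IsNilpotent J) (hAJ : Commute A J)
    {w : V} (hw : A w = 0) : (J ^ Module.finrank K (LinearMap.ker A)) w = 0 := by
  have hst : ∀ v ∈ LinearMap.ker A, J v ∈ LinearMap.ker A := fun v hv => by
    rw [LinearMap.mem_ker] at hv ⊢
    rw [← Module.End.mul_apply, hAJ.eq, Module.End.mul_apply, hv, map_zero]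
  have hp : ∀ k v, ((J.restrict hst) ^ k) v = (J ^ k) (v : V) := fun k v =>
    intertwine_pow (LinearMap.ker A).subtype (fun v => rfl) k v
  have hnil : IsNilpotent (J.restrict hst) := by
    obtain ⟨k, hk⟩ := hJ
    refine ⟨k, LinearMap.ext fun v => Subtype.ext ?_⟩
    rw [hp, hk]
    rfl
  rw [← hp _ ⟨w, hw⟩, pow_finrank_eq_zero hnil]
  rfl

theorem pow_apply_mem_range {J A : Module.End K V} (hJ : IsNilpotent J) (hAJ : Commute A J)
    (v : V) : (J ^ Module.finrank K (LinearMap.ker A)) v ∈ LinearMap.range A := by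
  have hst : LinearMap.range A ≤ (LinearMap.range A).comap J := by
    rintro _ ⟨v, rfl⟩
    exact ⟨J v, LinearMap.congr_fun hAJ.eq v⟩
  have hnil : IsNilpotent ((LinearMap.range A).mapQ _ J hst) := by
    obtain ⟨k, hk⟩ := hJ
    refine ⟨k, ?_⟩
    rw [← Submodule.mapQ_pow, ← Submodule.mapQ_zero]
    congr 1
  have h1 := pow_finrank_eq_zero hnil
  have h2 := Submodule.finrank_quotient_add_finrank (LinearMap.range A)
  have h3 := rk_add_ker A
  have h4 : Module.finrank K (V ⧸ LinearMap.range A) = Module.finrank K (LinearMap.ker A) := by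
    rw [rk] at h3; omega
  rw [h4, ← Submodule.mapQ_pow] at h1
  have h5 := LinearMap.congr_fun h1 ((LinearMap.range A).mkQ v)
  rwa [Submodule.mkQ_apply, Submodule.mapQ_apply, LinearMap.zero_apply,
    Submodule.Quotient.mk_eq_zero] at h5

theorem genMap_surjective_finrank {J A : Module.End K V} (hJ : IsNilpotent J) (hAJ : Commute A J)
    {N : ℕ} {v : V} (h : Function.Surjective (genMap N J v A)) :
    Function.Surjective (genMap (Module.finrank K (LinearMap.ker A)) J v A) := by
  set χ := Module.finrank K (LinearMap.ker A) with hχ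
  rw [← LinearMap.range_eq_top, eq_top_iff]
  have hA : ∀ w, A w ∈ LinearMap.range (genMap χ J v A) := fun w =>
    ⟨(0, w), by simp [genMap_apply]⟩
  have hv : ∀ s, (J ^ s) v ∈ LinearMap.range (genMap χ J v A) := by
    intro s
    rcases lt_or_ge s χ with hs | hs
    · refine ⟨(Pi.single ⟨s, hs⟩ 1, 0), ?_⟩
      rw [genMap_apply, Finset.sum_eq_single ⟨s, hs⟩]
      · simp
      · intro q _ hq; simp [hq]
      · simp
    · obtain ⟨k, rfl⟩ := Nat.exists_eq_add_of_le hs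
      obtain ⟨w, hw⟩ := pow_apply_mem_range hJ hAJ ((J ^ k) v)
      rw [pow_add, Module.End.mul_apply, hχ, ← hw]
      exact hA w
  intro w _
  obtain ⟨z, rfl⟩ := h w
  rw [genMap_apply]
  exact Submodule.add_mem _ (Submodule.sum_mem _ fun s _ => Submodule.smul_mem _ _ (hv s)) (hA _)

theorem genMap_eq_zero {J A : Module.End K V} {v : V}
    (h : Function.Surjective (genMap (Module.finrank K (LinearMap.ker A)) J v A))
    (z : (Fin (Module.finrank K (LinearMap.ker A)) → K) × V)
    (hz : genMap (Module.finrank K (LinearMap.ker A)) J v A z = 0) : z.1 = 0 ∧ A z.2 = 0 := by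
  set χ := Module.finrank K (LinearMap.ker A) with hχ
  have h1 := rk_add_ker (genMap χ J v A)
  rw [rk, LinearMap.range_eq_top.2 h, finrank_top, Module.finrank_prod, Module.finrank_fin_fun] at h1
  have h2 : (LinearMap.ker A).map (LinearMap.inr K (Fin χ → K) V) = LinearMap.ker (genMap χ J v A) := by
    apply Submodule.eq_of_le_of_finrank_eq
    · rintro _ ⟨w, hw, rfl⟩
      rw [LinearMap.mem_ker, genMap_apply]
      simpa using hw
    · rw [← (Submodule.equivMapOfInjective _ LinearMap.inr_injective _).finrank_eq]
      omega
  rw [← LinearMap.mem_ker, ← h2] at hz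
  obtain ⟨w, hw, rfl⟩ := hz
  exact ⟨rfl, hw⟩

theorem cogenMap_injective_finrank {J A : Module.End K V} (hJ : IsNilpotent J) (hAJ : Commute A J)
    {N : ℕ} {φ : V →ₗ[K] K} (h : Function.Injective (cogenMap N J φ A)) {w : V} (hw : A w = 0)
    (hφ : ∀ s < Module.finrank K (LinearMap.ker A), φ ((J ^ s) w) = 0) : w = 0 := by
  apply h
  rw [map_zero]
  refine Prod.ext (funext fun s => ?_) hw
  change φ ((J ^ (s : ℕ)) w) = 0
  rcases lt_or_ge (s : ℕ) (Module.finrank K (LinearMap.ker A)) with hs | hs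
  · exact hφ s hs
  · obtain ⟨k, hk⟩ := Nat.exists_eq_add_of_le hs
    rw [hk, add_comm, pow_add, Module.End.mul_apply, pow_apply_eq_zero_of_ker hJ hAJ hw, map_zero,
      map_zero]

end Restrict

section Degenerate
variable {K : Type*} [Field K] {X W : Type*} [AddCommGroup X] [Module K X] [FiniteDimensional K X]
  [AddCommGroup W] [Module K W] [FiniteDimensional K W]

/-- Ranks of powers can only drop along a degeneration. -/
theorem exists_rk_pow_le [Infinite K] {A : K → Module.End K W} (hA : PolyFam A)
    {σ : K → X →ₗ[K] W} {D : Module.End K X} {E : X →ₗ[K] W} {θ : K → W →ₗ[K] X} (hθ : PolyFam θ)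
    (Z : Submodule K W) (h1 : ∀ t x, A t (σ t x) = σ t (D x) + t • E x)
    (h2 : ∀ t x, θ t (σ t x) = t • x) (hE : ∀ x, E x ∈ Z) (hZ : ∀ z ∈ Z, A 0 z ∈ Z)
    (hθZ : ∀ z ∈ Z, θ 0 z = 0) (m : ℕ) : ∃ t ≠ 0, rk (D ^ m) ≤ rk (A t ^ m) := by
  have key : ∀ m, ∃ H : K → X →ₗ[K] W, PolyFam H ∧ (∀ x, H 0 x ∈ Z) ∧
      ∀ t x, (A t ^ m) (σ t x) = σ t ((D ^ m) x) + t • H t x := by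
    intro m
    induction m with
    | zero => exact ⟨fun _ => 0, .const 0, by simp, by simp⟩
    | succ m ih =>
      obtain ⟨H, hH, hHZ, hm⟩ := ih
      refine ⟨fun t => E ∘ₗ D ^ m + A t ∘ₗ H t, .add _ _ (.const _) (hA.comp hH), fun x => ?_,
        fun t x => ?_⟩
      · exact Z.add_mem (hE _) (hZ _ (hHZ x))
      · rw [pow_succ', Module.End.mul_apply, hm, map_add, h1, map_smul, pow_succ',
          Module.End.mul_apply]
        simp only [LinearMap.add_apply, LinearMap.comp_apply, smul_add]
        abel
  obtain ⟨H, hH, hHZ, hm⟩ := key m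
  have hG : PolyFam fun t => D ^ m + θ t ∘ₗ H t := .add _ _ (.const _) (hθ.comp hH)
  have h0 : D ^ m + θ 0 ∘ₗ H 0 = D ^ m := by
    ext x
    simp [hθZ _ (hHZ x)]
  have hfin := hG.finite_rk_lt (t₀ := 0) (r := rk (D ^ m)) (by rw [h0])
  obtain ⟨t, ht⟩ := (hfin.union (Set.finite_singleton 0)).infinite_compl.nonempty
  simp only [Set.mem_compl_iff, Set.mem_union, Set.mem_ofPred_eq, Set.mem_singleton_iff,
    not_or, not_lt] at ht
  refine ⟨t, ht.2, ht.1.trans ?_⟩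
  have e : t • (D ^ m + θ t ∘ₗ H t) = θ t ∘ₗ (A t ^ m) ∘ₗ σ t := by
    ext x
    simp [hm, h2]
  rw [rk, ← LinearMap.range_smul _ t ht.2, e]
  exact (rk_comp_le_right _ _).trans (rk_comp_le_left _ _)

theorem rk_le_rk_pow_add (f : Module.End K X) (m : ℕ) :
    Module.finrank K X ≤ rk (f ^ m) + m * Module.finrank K (LinearMap.ker f) := by
  induction m with
  | zero => rw [pow_zero, rk, Module.End.one_eq_id, LinearMap.range_id, finrank_top]; omega
  | succ m ih =>
    have h := finrank_map_add_ker f (LinearMap.range (f ^ m))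
    have h2 : Module.finrank K ↥(LinearMap.range (f ^ m) ⊓ LinearMap.ker f) ≤
      Module.finrank K (LinearMap.ker f) := Submodule.finrank_mono inf_le_right
    rw [← LinearMap.range_comp] at h
    have e : f ∘ₗ f ^ m = f ^ (m + 1) := (pow_succ' f m).symm
    rw [e] at h
    rw [add_mul, rk]
    rw [rk] at ih
    omega

end Degenerate

section Pull
variable (K : Type*) [Field K] {ι κ : Type*}

/-- The linear map between function spaces that pulls back along a partial function. -/
def pull (s : ι → Option κ) : (κ → K) →ₗ[K] (ι → K) where
  toFun g q := (s q).elim 0 g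
  map_add' g g' := by funext q; cases h : s q <;> simp [h]
  map_smul' a g := by funext q; cases h : s q <;> simp [h]

variable {K} in
theorem pull_apply (s : ι → Option κ) (g : κ → K) (q : ι) : pull K s g q = (s q).elim 0 g := rfl

theorem partialShift_eq_pull [Fintype ι] [DecidableEq ι] (s t : ι → Option ι)
    (h : ∀ p q, s p = some q ↔ t q = some p) : partialShift K s = pull K t := by
  refine (Pi.basisFun K ι).ext fun p => ?_
  rw [Pi.basisFun_apply, partialShift_single]
  funext q
  rw [pull_apply]
  by_cases hq : t q = some p
  · rw [hq, (h p q).2 hq]; simp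
  · have h1 : (t q).elim 0 (Pi.single p (1 : K)) = (0 : K) := by
      cases h2 : t q with
      | none => rfl
      | some p' =>
        have : p' ≠ p := fun e => hq (by rw [h2, e])
        simp [this]
    rw [h1]
    cases h2 : s p with
    | none => rfl
    | some q' =>
      have : q ≠ q' := fun e => hq ((h p q).1 (by rw [h2, e]))
      simp [this]

end Pull

section Model
variable {K : Type*} [Field K]

variable (K) in
/-- The space of functions on a grid with `c` rows and `i` columns. -/
abbrev Grid (c i : ℕ) : Type _ := (Σ _ : Fin c, Fin i) → K

variable (K) in
/-- The shift of the rows of a grid. -/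
def rowShift (c i : ℕ) : Module.End K (Grid K c i) :=
  pull K fun p => if 0 < (p.1 : ℕ) then some ⟨⟨p.1 - 1, by have := p.1.2; omega⟩, p.2⟩ else none

variable (K) in
/-- The shift of the columns of a grid. -/
def colShift (c i : ℕ) : Module.End K (Grid K c i) :=
  pull K fun p => if 0 < (p.2 : ℕ) then some ⟨p.1, ⟨p.2 - 1, by have := p.2.2; omega⟩⟩ else none

variable (K) in
/-- Extension by zero from the first `r` columns. -/
def extFirst (c i r : ℕ) : Grid K c r →ₗ[K] Grid K c i :=
  pull K fun p => if h : (p.2 : ℕ) < r then some ⟨p.1, ⟨p.2, h⟩⟩ else none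

variable (K) in
/-- Extension by zero from the last `r` columns, numbered backwards. -/
def extLast (c i r : ℕ) : Grid K c r →ₗ[K] Grid K c i :=
  pull K fun p => if h : i - 1 - (p.2 : ℕ) < r then some ⟨p.1, ⟨i - 1 - p.2, h⟩⟩ else none

variable (K) in
/-- Restriction to the first `r` columns. -/
def resFirst (c : ℕ) {i r : ℕ} (h : r ≤ i) : Grid K c i →ₗ[K] Grid K c r :=
  pull K fun p => some ⟨p.1, ⟨p.2, p.2.2.trans_le h⟩⟩

variable (K) in
/-- Restriction to the last `r` columns, numbered backwards. -/
def resLast (c : ℕ) {i r : ℕ} (h : r ≤ i) : Grid K c i →ₗ[K] Grid K c r :=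
  pull K fun p => some ⟨p.1, ⟨i - 1 - p.2, by have := p.2.2; omega⟩⟩

theorem rowShift_apply {c i : ℕ} (g : Grid K c i) (j : Fin c) (s : Fin i) :
    rowShift K c i g ⟨j, s⟩ = if 0 < (j : ℕ) then g ⟨⟨j - 1, by have := j.2; omega⟩, s⟩ else 0 := by
  rw [rowShift, pull_apply]; dsimp only; split_ifs <;> rfl

theorem colShift_apply {c i : ℕ} (g : Grid K c i) (j : Fin c) (s : Fin i) :
    colShift K c i g ⟨j, s⟩ = if 0 < (s : ℕ) then g ⟨j, ⟨s - 1, by have := s.2; omega⟩⟩ else 0 := by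
  rw [colShift, pull_apply]; dsimp only; split_ifs <;> rfl

theorem extFirst_apply {c i r : ℕ} (g : Grid K c r) (j : Fin c) (s : Fin i) :
    extFirst K c i r g ⟨j, s⟩ = if h : (s : ℕ) < r then g ⟨j, ⟨s, h⟩⟩ else 0 := by
  rw [extFirst, pull_apply]; dsimp only; split_ifs <;> rfl

theorem extLast_apply {c i r : ℕ} (g : Grid K c r) (j : Fin c) (s : Fin i) :
    extLast K c i r g ⟨j, s⟩ = if h : i - 1 - (s : ℕ) < r then g ⟨j, ⟨i - 1 - s, h⟩⟩ else 0 := by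
  rw [extLast, pull_apply]; dsimp only; split_ifs <;> rfl

theorem resFirst_apply {c i r : ℕ} (h : r ≤ i) (g : Grid K c i) (j : Fin c) (s : Fin r) :
    resFirst K c h g ⟨j, s⟩ = g ⟨j, ⟨s, s.2.trans_le h⟩⟩ := rfl

theorem resLast_apply {c i r : ℕ} (h : r ≤ i) (g : Grid K c i) (j : Fin c) (s : Fin r) :
    resLast K c h g ⟨j, s⟩ = g ⟨j, ⟨i - 1 - s, by have := s.2; omega⟩⟩ := rfl

theorem rowShift_extFirst {c i r : ℕ} (g : Grid K c r) :
    rowShift K c i (extFirst K c i r g) = extFirst K c i r (rowShift K c r g) := by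
  funext ⟨j, s⟩
  simp only [rowShift_apply, extFirst_apply]
  split_ifs <;> rfl

theorem rowShift_extLast {c i r : ℕ} (g : Grid K c r) :
    rowShift K c i (extLast K c i r g) = extLast K c i r (rowShift K c r g) := by
  funext ⟨j, s⟩
  simp only [rowShift_apply, extLast_apply]
  split_ifs <;> rfl

theorem resLast_rowShift {c i r : ℕ} (h : r ≤ i) (g : Grid K c i) :
    resLast K c h (rowShift K c i g) = rowShift K c r (resLast K c h g) := by
  funext ⟨j, s⟩
  simp only [rowShift_apply, resLast_apply]

theorem resFirst_extFirst {c i r : ℕ} (h : r ≤ i) (g : Grid K c r) :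
    resFirst K c h (extFirst K c i r g) = g := by
  funext ⟨j, s⟩
  simp only [resFirst_apply, extFirst_apply, dif_pos s.2]

theorem resLast_extLast {c i r : ℕ} (h : r ≤ i) (g : Grid K c r) :
    resLast K c h (extLast K c i r g) = g := by
  funext ⟨j, s⟩
  have h1 : i - 1 - (i - 1 - (s : ℕ)) = s := by have := s.2; omega
  simp only [resLast_apply, extLast_apply, h1, dif_pos s.2]

theorem resFirst_extLast {c i r : ℕ} (h : r ≤ i) (h2 : 2 * r ≤ i) (g : Grid K c r) :
    resFirst K c h (extLast K c i r g) = 0 := by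
  funext ⟨j, s⟩
  have h1 : ¬ i - 1 - (s : ℕ) < r := by have := s.2; omega
  simp only [resFirst_apply, extLast_apply, dif_neg h1]
  rfl

theorem resLast_extFirst {c i r : ℕ} (h : r ≤ i) (h2 : 2 * r ≤ i) (g : Grid K c r) :
    resLast K c h (extFirst K c i r g) = 0 := by
  funext ⟨j, s⟩
  have h1 : ¬ i - 1 - (s : ℕ) < r := by have := s.2; omega
  simp only [resLast_apply, extFirst_apply, dif_neg h1]
  rfl

theorem rowShift_pow_apply {c i : ℕ} (k : ℕ) (g : Grid K c i) (j : Fin c) (s : Fin i)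
    (h : (j : ℕ) < k) : (rowShift K c i ^ k) g ⟨j, s⟩ = 0 := by
  induction k generalizing j with
  | zero => omega
  | succ k ih =>
    rw [pow_succ', Module.End.mul_apply, rowShift_apply]
    split_ifs with h1
    · exact ih _ (by simp only; omega)
    · rfl

theorem rowShift_pow_self (c i : ℕ) : rowShift K c i ^ c = 0 :=
  LinearMap.ext fun g => funext fun ⟨j, s⟩ => rowShift_pow_apply c g j s j.2

theorem colShift_eq_jordanOp (c i : ℕ) : colShift K c i = jordanOp K fun _ : Fin c => i := by
  rw [colShift, jordanOp, partialShift_eq_pull]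
  rintro ⟨j, s⟩ ⟨j', s'⟩
  by_cases h1 : (s : ℕ) + 1 < i <;> by_cases h2 : 0 < (s' : ℕ) <;>
    simp [h1, h2, Fin.ext_iff] <;> omega

theorem rk_colShift_pow (c i l : ℕ) : rk (colShift K c i ^ l) = c * i - c * l := by
  rw [colShift_eq_jordanOp, rk_jordanOp_pow, ← Nat.mul_sub]
  simp

variable {V : Type*} [AddCommGroup V] [Module K V]

/-- The map from the last row of a grid to `V` given by a vector `v`. -/
def rowOut {c : ℕ} (hc : 0 < c) (i : ℕ) (J : Module.End K V) (v : V) : Grid K c i →ₗ[K] V :=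
  (Fintype.linearCombination K fun s : Fin i => (J ^ (s : ℕ)) v) ∘ₗ
    LinearMap.funLeft K K fun s : Fin i => (⟨⟨c - 1, Nat.sub_lt hc one_pos⟩, s⟩ : Σ _ : Fin c, Fin i)

/-- The map from `V` to the first row of a grid given by a linear form `φ`. -/
def rowIn (c i : ℕ) (J : Module.End K V) (φ : V →ₗ[K] K) : V →ₗ[K] Grid K c i :=
  LinearMap.pi fun p => if (p.1 : ℕ) = 0 then φ ∘ₗ (J ^ (i - 1 - (p.2 : ℕ))) else 0

theorem rowOut_apply {c : ℕ} (hc : 0 < c) (i : ℕ) (J : Module.End K V) (v : V) (g : Grid K c i) :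
    rowOut hc i J v g =
      ∑ s : Fin i, g ⟨⟨c - 1, Nat.sub_lt hc one_pos⟩, s⟩ • (J ^ (s : ℕ)) v := by
  simp [rowOut, Fintype.linearCombination_apply, LinearMap.funLeft_apply]

theorem rowIn_apply (c i : ℕ) (J : Module.End K V) (φ : V →ₗ[K] K) (w : V) (j : Fin c)
    (s : Fin i) : rowIn c i J φ w ⟨j, s⟩ = if (j : ℕ) = 0 then φ ((J ^ (i - 1 - (s : ℕ))) w) else 0 := by
  simp only [rowIn, LinearMap.pi_apply]
  split_ifs <;> rfl

theorem rowOut_extFirst {c : ℕ} (hc : 0 < c) {i r : ℕ} (h : r ≤ i) (J : Module.End K V) (v : V)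
    (f : Grid K c r) : rowOut hc i J v (extFirst K c i r f) =
      ∑ s : Fin r, f ⟨⟨c - 1, Nat.sub_lt hc one_pos⟩, s⟩ • (J ^ (s : ℕ)) v := by
  rw [rowOut_apply]
  symm
  refine Finset.sum_of_injOn (Fin.castLE h) (fun _ _ _ _ e => Fin.castLE_injective h e)
    (fun _ _ => Finset.mem_coe.2 (Finset.mem_univ _)) (fun s _ hs => ?_) (fun s _ => ?_)
  · rw [extFirst_apply, dif_neg, zero_smul]
    intro hlt
    exact hs ⟨⟨s, hlt⟩, by simp, rfl⟩
  · rw [extFirst_apply]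
    simp

theorem rowOut_colShift {c : ℕ} (hc : 0 < c) {i : ℕ} {J : Module.End K V} (hJ : J ^ i = 0) (v : V)
    (g : Grid K c i) : rowOut hc i J v (colShift K c i g) = J (rowOut hc i J v g) := by
  rw [rowOut_apply, rowOut_apply, map_sum]
  rcases i with _ | i
  · simp
  · rw [Fin.sum_univ_succ, Fin.sum_univ_castSucc, colShift_apply]
    simp only [map_smul, ← Module.End.mul_apply, ← pow_succ', Fin.val_last, hJ, colShift_apply]
    simp
    rfl

theorem rowIn_apply_map {c i : ℕ} {J : Module.End K V} (hJ : J ^ i = 0) (φ : V →ₗ[K] K) (w : V) :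
    rowIn c i J φ (J w) = colShift K c i (rowIn c i J φ w) := by
  funext ⟨j, s⟩
  rw [colShift_apply, rowIn_apply, rowIn_apply, ← Module.End.mul_apply, ← pow_succ]
  have := s.2
  rcases Nat.eq_zero_or_pos (s : ℕ) with h | h
  · rw [if_neg (show ¬ 0 < (s : ℕ) by omega), h, show i - 1 - 0 + 1 = i by omega, hJ]
    simp
  · rw [if_pos h]
    simp only
    rw [show i - 1 - (s : ℕ) + 1 = i - 1 - (s - 1) by omega]

theorem rowShift_colShift {c i : ℕ} (g : Grid K c i) :
    rowShift K c i (colShift K c i g) = colShift K c i (rowShift K c i g) := by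
  funext ⟨j, s⟩
  simp only [rowShift_apply, colShift_apply]
  split_ifs <;> rfl

end Model

section Glue
variable {K : Type*} [Field K] {V : Type*} [AddCommGroup V] [Module K V]

/-- The operator on `Grid K c i × V` that glues the row shift and `A` along `v` and `t • φ`. -/
def glue {c : ℕ} (hc : 0 < c) (i : ℕ) (J A : Module.End K V) (v : V) (φ : V →ₗ[K] K) (t : K) :
    Module.End K (Grid K c i × V) :=
  (rowShift K c i ∘ₗ LinearMap.fst K _ _ + t • rowIn c i J φ ∘ₗ LinearMap.snd K _ _).prod
    (rowOut hc i J v ∘ₗ LinearMap.fst K _ _ + A ∘ₗ LinearMap.snd K _ _)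

/-- The degeneration of `glue`. -/
def degGlue {c : ℕ} (hc : 0 < c) {i r : ℕ} (h : r ≤ i) (J A : Module.End K V) (v : V)
    (φ : V →ₗ[K] K) : Module.End K (Grid K c r × V × Grid K c r) :=
  (rowShift K c r ∘ₗ LinearMap.fst K _ _).prod
    ((rowOut hc i J v ∘ₗ extFirst K c i r ∘ₗ LinearMap.fst K _ _ +
      A ∘ₗ LinearMap.fst K _ _ ∘ₗ LinearMap.snd K _ _).prod
    (resLast K c h ∘ₗ rowIn c i J φ ∘ₗ LinearMap.fst K _ _ ∘ₗ LinearMap.snd K _ _ +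
      rowShift K c r ∘ₗ LinearMap.snd K _ _ ∘ₗ LinearMap.snd K _ _))

variable {c : ℕ} (hc : 0 < c) {i r : ℕ} {J A : Module.End K V} {v : V} {φ : V →ₗ[K] K}

theorem glue_apply (t : K) (z : Grid K c i × V) : glue hc i J A v φ t z =
    (rowShift K c i z.1 + t • rowIn c i J φ z.2, rowOut hc i J v z.1 + A z.2) := rfl

theorem degGlue_apply (h : r ≤ i) (z : Grid K c r × V × Grid K c r) : degGlue hc h J A v φ z =
    (rowShift K c r z.1, rowOut hc i J v (extFirst K c i r z.1) + A z.2.1,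
      resLast K c h (rowIn c i J φ z.2.1) + rowShift K c r z.2.2) := rfl

theorem polyFam_glue : PolyFam fun t : K => glue hc i J A v φ t := by
  have e : (fun t : K => glue hc i J A v φ t) = fun t => glue hc i J A v φ 0 +
      t • LinearMap.inl K _ _ ∘ₗ rowIn c i J φ ∘ₗ LinearMap.snd K _ _ := by
    funext t
    refine LinearMap.ext fun z => ?_
    simp [glue_apply]
  rw [e]
  exact .line _ _

theorem commute_glue (hJ : J ^ i = 0) (hAJ : Commute A J) (t : K) :
    Commute (glue hc i J A v φ t) ((colShift K c i).prodMap J) := by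
  refine LinearMap.ext fun z => ?_
  rw [Module.End.mul_apply, Module.End.mul_apply, glue_apply, glue_apply, LinearMap.prodMap_apply,
    LinearMap.prodMap_apply, rowShift_colShift, rowIn_apply_map hJ, rowOut_colShift hc hJ]
  have := LinearMap.congr_fun hAJ.eq z.2
  rw [Module.End.mul_apply, Module.End.mul_apply] at this
  simp [this]

theorem isNilpotent_glue [FiniteDimensional K V] (hi : 0 < i) (hJ : J ^ (i - 1) = 0)
    (hAJ : Commute A J) (hA : IsNilpotent A)
    (t : K) : IsNilpotent (glue hc i J A v φ t) := by
  have hJi : J ^ i = 0 := by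
    rw [show i = i - 1 + 1 by omega, pow_succ, hJ, zero_mul]
  have hcomm := commute_glue hc (v := v) (φ := φ) hJi hAJ t
  obtain ⟨k, hk⟩ := hA
  have hnil : IsNilpotent ((colShift K c i).prodMap J : Module.End K (Grid K c i × V)) := by
    refine ⟨i, ?_⟩
    have h2 : colShift K c i ^ i = 0 := by
      have := rk_colShift_pow (K := K) c i i
      rwa [Nat.sub_self, rk, Submodule.finrank_eq_zero, LinearMap.range_eq_bot] at this
    rw [prodMap_pow, h2, hJi]
    rfl
  have hker : ∀ g : Grid K c i, colShift K c i g = 0 → rowOut hc i J v g = 0 := by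
    intro g hg
    rw [rowOut_apply]
    refine Finset.sum_eq_zero fun s _ => ?_
    rcases Nat.lt_or_ge ((s : ℕ) + 1) i with h | h
    · have := congrFun hg ⟨⟨c - 1, Nat.sub_lt hc one_pos⟩, ⟨s + 1, h⟩⟩
      rw [colShift_apply, if_pos (by simp)] at this
      simp only [Nat.add_sub_cancel, Pi.zero_apply] at this
      rw [this, zero_smul]
    · rw [show (s : ℕ) = i - 1 by have := s.2; omega, hJ]
      simp
  have step : ∀ a z, (colShift K c i).prodMap J z = 0 →
      (colShift K c i).prodMap J ((glue hc i J A v φ t ^ a) z) = 0 ∧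
      ((glue hc i J A v φ t ^ a) z).2 = (A ^ a) z.2 := by
    intro a
    induction a with
    | zero => intro z hz; exact ⟨hz, rfl⟩
    | succ a ih =>
      intro z hz
      obtain ⟨h1, h2⟩ := ih z hz
      constructor
      · rw [← Module.End.mul_apply, ← (hcomm.pow_left _).eq, Module.End.mul_apply, hz, map_zero]
      · have h3 : rowOut hc i J v ((glue hc i J A v φ t ^ a) z).1 = 0 :=
          hker _ (congrArg Prod.fst h1)
        rw [pow_succ', Module.End.mul_apply, glue_apply]
        change rowOut hc i J v _ + A _ = _
        rw [h3, zero_add, h2, pow_succ', Module.End.mul_apply]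
  have step2 : ∀ a z, (colShift K c i).prodMap J z = 0 → z.2 = 0 →
      (glue hc i J A v φ t ^ a) z = ((rowShift K c i ^ a) z.1, 0) := by
    intro a
    induction a with
    | zero => intro z _ hz; exact Prod.ext rfl hz
    | succ a ih =>
      intro z hz hz2
      have h1 := (step a z hz).1
      rw [ih z hz hz2] at h1
      rw [pow_succ', Module.End.mul_apply, ih z hz hz2, glue_apply]
      simp only [map_zero, smul_zero, add_zero]
      have h3 : rowOut hc i J v ((rowShift K c i ^ a) z.1) = 0 := hker _ (congrArg Prod.fst h1)
      rw [h3, pow_succ', Module.End.mul_apply]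
  refine isNilpotent_of_ker hnil hcomm (k := c + k) fun z hz => ?_
  obtain ⟨h1, h2⟩ := step k z hz
  rw [pow_add, Module.End.mul_apply, step2 c _ h1 (by rw [h2, hk]; rfl), rowShift_pow_self]
  rfl

theorem exists_rk_degGlue_le [Infinite K] [FiniteDimensional K V] (h2 : 2 * r ≤ i) (h : r ≤ i) (m : ℕ) :
    ∃ t : K, rk (degGlue hc h J A v φ ^ m) ≤ rk (glue hc i J A v φ t ^ m) := by
  refine Exists.imp (fun t ht => ht.2) (exists_rk_pow_le (polyFam_glue hc (i := i) (J := J) (A := A) (v := v) (φ := φ))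
    (σ := fun t => (extFirst K c i r ∘ₗ LinearMap.fst K _ _ +
      t • extLast K c i r ∘ₗ LinearMap.snd K _ _ ∘ₗ LinearMap.snd K _ _).prod
        (LinearMap.fst K _ _ ∘ₗ LinearMap.snd K _ _))
    (D := degGlue hc h J A v φ)
    (E := ((LinearMap.id - extLast K c i r ∘ₗ resLast K c h) ∘ₗ rowIn c i J φ ∘ₗ
      LinearMap.fst K _ _ ∘ₗ LinearMap.snd K _ _).prod
        (rowOut hc i J v ∘ₗ extLast K c i r ∘ₗ LinearMap.snd K _ _ ∘ₗ LinearMap.snd K _ _))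
    (θ := fun t => (LinearMap.inr K _ _ ∘ₗ LinearMap.inr K _ _ ∘ₗ resLast K c h ∘ₗ
        LinearMap.fst K _ _) +
      t • ((resFirst K c h ∘ₗ LinearMap.fst K _ _).prod
        (LinearMap.inl K _ _ ∘ₗ LinearMap.snd K _ _)))
    (.line _ _) (LinearMap.ker (resLast K c h ∘ₗ LinearMap.fst K (Grid K c i) V)) ?_ ?_ ?_ ?_ ?_ m)
  · rintro t ⟨f, w, b⟩
    rw [glue_apply, degGlue_apply]
    refine Prod.ext ?_ ?_
    · simp only [LinearMap.prod_apply, Function.prod, LinearMap.add_apply, LinearMap.comp_apply,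
        LinearMap.fst_apply, LinearMap.snd_apply, LinearMap.smul_apply, LinearMap.sub_apply,
        LinearMap.id_apply, map_add, map_smul, rowShift_extFirst, rowShift_extLast,
        Prod.fst_add, Prod.smul_fst, smul_add, smul_sub]
      abel
    · simp only [LinearMap.prod_apply, Function.prod, LinearMap.add_apply, LinearMap.comp_apply,
        LinearMap.fst_apply, LinearMap.snd_apply, LinearMap.smul_apply, map_add, map_smul,
        Prod.snd_add, Prod.smul_snd]
      abel
  · rintro t ⟨f, w, b⟩
    simp [resFirst_extFirst, resLast_extLast, resFirst_extLast h h2, resLast_extFirst h h2]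
  · rintro ⟨f, w, b⟩
    simp [resLast_extLast]
  · rintro ⟨g, w⟩ hz
    have hz' : resLast K c h g = 0 := hz
    simp [glue_apply, resLast_rowShift, hz']
  · rintro ⟨g, w⟩ hz
    have hz' : resLast K c h g = 0 := hz
    simp [hz']

theorem finrank_grid (c i : ℕ) : Module.finrank K (Grid K c i) = c * i := by
  rw [Module.finrank_pi]; simp

theorem finrank_ker_degGlue_le (h : r ≤ i)
    (hv : ∀ z : (Fin r → K) × V, genMap r J v A z = 0 → z.1 = 0 ∧ A z.2 = 0)
    (hφ : ∀ w, A w = 0 → (∀ s < r, φ ((J ^ s) w) = 0) → w = 0) :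
    Module.finrank K (LinearMap.ker (degGlue hc h J A v φ)) ≤ r := by
  let ℓ : Grid K c r × V × Grid K c r →ₗ[K] (Fin r → K) :=
    LinearMap.funLeft K K (fun s : Fin r => (⟨⟨c - 1, Nat.sub_lt hc one_pos⟩, s⟩ : Σ _ : Fin c, Fin r))
      ∘ₗ LinearMap.snd K _ _ ∘ₗ LinearMap.snd K _ _
  have hrow : ∀ g : Grid K c r, rowShift K c r g = 0 →
      (∀ s, g ⟨⟨c - 1, Nat.sub_lt hc one_pos⟩, s⟩ = 0) → g = 0 := by
    intro g hg hs
    funext ⟨j, s⟩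
    have := j.2
    rcases Nat.lt_or_ge ((j : ℕ) + 1) c with h1 | h1
    · have := congrFun hg ⟨⟨j + 1, h1⟩, s⟩
      rw [rowShift_apply, if_pos (by simp)] at this
      simpa using this
    · have : j = ⟨c - 1, Nat.sub_lt hc one_pos⟩ := Fin.ext (by simp only; omega)
      rw [this]
      exact hs s
  have hinj : Function.Injective (ℓ.domRestrict (LinearMap.ker (degGlue hc h J A v φ))) := by
    rw [← LinearMap.ker_eq_bot, LinearMap.ker_eq_bot']
    rintro ⟨⟨f, w, b⟩, hz⟩ hb
    rw [LinearMap.mem_ker, degGlue_apply] at hz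
    have h1 : rowShift K c r f = 0 := congrArg Prod.fst hz
    have h2 : rowOut hc i J v (extFirst K c i r f) + A w = 0 :=
      congrArg (fun z => z.2.1) hz
    have h3 : resLast K c h (rowIn c i J φ w) + rowShift K c r b = 0 :=
      congrArg (fun z => z.2.2) hz
    obtain ⟨h4, h5⟩ := hv (fun s => f ⟨⟨c - 1, Nat.sub_lt hc one_pos⟩, s⟩, w) (by
      rw [genMap_apply, ← h2, rowOut_extFirst hc h])
    have hf : f = 0 := hrow f h1 (congrFun h4)
    have hw : w = 0 := by
      refine hφ w h5 fun s hs => ?_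
      have h6 := congrFun h3 ⟨⟨0, hc⟩, ⟨s, hs⟩⟩
      rw [Pi.add_apply, resLast_apply, rowIn_apply, rowShift_apply, if_pos rfl,
        if_neg (lt_irrefl _), add_zero] at h6
      simp only at h6
      rwa [show i - 1 - (i - 1 - s) = s by omega] at h6
    have hb' : b = 0 := by
      subst hw
      rw [map_zero, map_zero, zero_add] at h3
      exact hrow b h3 (congrFun hb)
    subst hf hw hb'
    rfl
  have := LinearMap.finrank_le_finrank_of_injective hinj
  rwa [Module.finrank_fin_fun] at this

theorem le_rk_degGlue_pow [FiniteDimensional K V] (h : r ≤ i)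
    (hk : Module.finrank K (LinearMap.ker (degGlue hc h J A v φ)) ≤ r) (m : ℕ) :
    rk (A ^ (m - 2 * c)) + (2 * c - m) * r ≤ rk (degGlue hc h J A v φ ^ m) := by
  set D := degGlue hc h J A v φ with hD
  have hX : Module.finrank K (Grid K c r × V × Grid K c r) = Module.finrank K V + 2 * (c * r) := by
    rw [Module.finrank_prod, Module.finrank_prod, finrank_grid]; ring
  have hrk : ∀ k, Module.finrank K V + 2 * (c * r) ≤ rk (D ^ k) + k * r := fun k => by
    have h1 := rk_le_rk_pow_add D k
    have h2 := Nat.mul_le_mul_left k hk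
    omega
  rcases le_or_gt m (2 * c) with hm | hm
  · obtain ⟨d, hd⟩ := Nat.exists_eq_add_of_le hm
    have h1 := hrk m
    rw [Nat.sub_eq_zero_of_le hm, show 2 * c - m = d by omega, pow_zero]
    have h2 : rk (1 : Module.End K V) = Module.finrank K V := by
      rw [rk, Module.End.one_eq_id, LinearMap.range_id, finrank_top]
    have h3 : 2 * (c * r) = m * r + d * r := by rw [← mul_assoc, hd, add_mul]
    omega
  obtain ⟨k, rfl⟩ := Nat.exists_eq_add_of_lt hm
  rw [show 2 * c + k + 1 - 2 * c = k + 1 by omega, Nat.sub_eq_zero_of_le (by omega), zero_mul,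
    add_zero, add_assoc]
  generalize k + 1 = k
  let π₁ : Grid K c r × V × Grid K c r →ₗ[K] Grid K c r := LinearMap.fst K _ _
  let π₂ : Grid K c r × V × Grid K c r →ₗ[K] V := LinearMap.fst K _ _ ∘ₗ LinearMap.snd K _ _
  have hfst : ∀ a z, ((D ^ a) z).1 = (rowShift K c r ^ a) z.1 := fun a z =>
    intertwine_pow π₁ (A := D) (B := rowShift K c r) (fun _ => rfl) a z
  have hsnd : ∀ a z, z.1 = 0 → ((D ^ a) z).2.1 = (A ^ a) z.2.1 := by
    intro a z hz
    induction a with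
    | zero => rfl
    | succ a ih =>
      have h1 := hfst a z
      rw [hz, map_zero] at h1
      rw [pow_succ', Module.End.mul_apply, hD, degGlue_apply, ← hD, h1]
      change rowOut hc i J v (extFirst K c i r 0) + A _ = _
      rw [map_zero, map_zero, zero_add, ih, pow_succ', Module.End.mul_apply]
  have hthd : ∀ a b, (D ^ a) (0, 0, b) = (0, 0, (rowShift K c r ^ a) b) := by
    intro a b
    induction a with
    | zero => rfl
    | succ a ih =>
      rw [pow_succ', Module.End.mul_apply, ih, hD, degGlue_apply, pow_succ', Module.End.mul_apply]
      simp
  have hrange : LinearMap.range (D ^ c) = LinearMap.ker π₁ := by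
    have h3 : LinearMap.range (D ^ c) ≤ LinearMap.ker π₁ := by
      rintro _ ⟨z, rfl⟩
      change ((D ^ c) z).1 = 0
      rw [hfst, rowShift_pow_self]
      rfl
    refine Submodule.eq_of_le_of_finrank_le h3 ?_
    have h4 := rk_add_ker π₁
    rw [rk, LinearMap.range_eq_top.2 Prod.fst_surjective, finrank_top, finrank_grid, hX] at h4
    have h5 := hrk c
    rw [rk] at h5
    omega
  have hker : LinearMap.ker (D ^ c) ≤ LinearMap.ker π₂ := by
    have h3 : LinearMap.range (LinearMap.inr K (Grid K c r) (V × Grid K c r) ∘ₗ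
        LinearMap.inr K V (Grid K c r)) ≤ LinearMap.ker (D ^ c) := by
      rintro _ ⟨b, rfl⟩
      change (D ^ c) (0, 0, b) = 0
      rw [hthd, rowShift_pow_self]
      rfl
    have h4 : Module.finrank K (LinearMap.range (LinearMap.inr K (Grid K c r) (V × Grid K c r) ∘ₗ
        LinearMap.inr K V (Grid K c r))) = c * r := by
      rw [LinearMap.finrank_range_of_inj (f := _ ∘ₗ _)
        (LinearMap.inr_injective.comp LinearMap.inr_injective), finrank_grid]
    rw [← Submodule.eq_of_le_of_finrank_le h3 (by
      have h5 := hrk c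
      have h6 := rk_add_ker (D ^ c)
      omega)]
    rintro _ ⟨b, rfl⟩
    rfl
  set U := (LinearMap.ker π₁).map (D ^ k) with hU
  have e1 : LinearMap.range (D ^ (2 * c + k)) = U.map (D ^ c) := by
    rw [hU, ← hrange, ← LinearMap.range_comp, ← LinearMap.range_comp]
    congr 1
    rw [← Module.End.mul_eq_comp, ← Module.End.mul_eq_comp, ← pow_add, ← pow_add]
    congr 1
    omega
  have e2 : LinearMap.range (A ^ k) ≤ U.map π₂ := by
    rintro _ ⟨w, rfl⟩
    exact ⟨(D ^ k) (0, w, 0), ⟨(0, w, 0), rfl, rfl⟩, hsnd k (0, w, 0) rfl⟩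
  have e3 := Submodule.finrank_mono e2
  have e4 := finrank_map_add_ker (D ^ c) U
  have e5 := rk_add_ker (π₂.domRestrict U)
  rw [rk, LinearMap.range_domRestrict, LinearMap.ker_domRestrict] at e5
  have e6 : Module.finrank K ↥(U ⊓ LinearMap.ker (D ^ c)) ≤
      Module.finrank K ↥((LinearMap.ker π₂).comap U.subtype) := by
    refine (Submodule.finrank_mono ?_).trans
      (Submodule.finrank_map_le U.subtype ((LinearMap.ker π₂).comap U.subtype))
    rintro z ⟨h1, h2⟩
    exact ⟨⟨z, h1⟩, hker h2, rfl⟩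
  change Module.finrank K (LinearMap.range (A ^ k)) ≤ Module.finrank K (LinearMap.range _)
  rw [e1]
  omega

theorem le_maxRank_of_top [Infinite K] {N i : ℕ} {n : ℕ → ℕ} (hi0 : 0 < i) (hi : i < N)
    (hn : ∀ j, i < j → j < N → n j = 0) (hc : 0 < n i) (m : ℕ) :
    maxRank K N (erase n i i) (m - 2 * n i) + (2 * n i - m) * nullity K N (erase n i i) ≤
      maxRank K N n m := by
  set n' := erase n i i with hn'
  obtain ⟨A, hA, v, φ, h1, h2, h3, h4⟩ := exists_stdNil_generic (K := K) N n' (m - 2 * n i)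
  have hAnil := isNilpotent_of_mem_stdNil hA
  have hJnil := isNilpotent_stdOp (K := K) N n'
  have hker : Module.finrank K (LinearMap.ker A) = nullity K N n' := by
    have := rk_add_ker A
    rw [(hasType_stdOp (K := K) N n').finrank, h1] at this
    rw [nullity, maxRank_zero]
    omega
  have hχ : 2 * nullity K N n' ≤ i := two_mul_nullity_le N i hi.le n' fun j hj hjN => by
    rw [hn', erase]
    split_ifs with h
    · rfl
    · exact hn j (by omega) hjN
  have hJ : stdOp K N n' ^ (i - 1) = 0 := by
    have := hasType_stdOp (K := K) N n' (i - 1)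
    rw [show rho N n' (i - 1) = 0 from Finset.sum_eq_zero fun j hj => by
      rcases lt_or_ge j i with h | h
      · rw [Nat.sub_eq_zero_of_le (by omega), mul_zero]
      · rw [hn', erase]
        split_ifs with h'
        · rw [zero_mul]
        · rw [hn j (by omega) (Finset.mem_range.1 hj), zero_mul], rk,
      Submodule.finrank_eq_zero, LinearMap.range_eq_bot] at this
    exact this
  have hJi : stdOp K N n' ^ i = 0 := by
    rw [show i = i - 1 + 1 by omega, pow_succ, hJ, zero_mul]
  have hgen := genMap_eq_zero (genMap_surjective_finrank hJnil hA.1 h3)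
  have hcog := fun w => cogenMap_injective_finrank hJnil hA.1 h4 (w := w)
  rw [hker] at hgen hcog
  have hχ' : nullity K N n' ≤ i := by omega
  obtain ⟨t, ht⟩ := exists_rk_degGlue_le (J := stdOp K N n') (A := A) (v := v) (φ := φ) hc hχ hχ' m
  have h5 := le_rk_degGlue_pow hc (J := stdOp K N n') (A := A) (v := v) (φ := φ) hχ'
    (finrank_ker_degGlue_le hc hχ' hgen hcog) m
  rw [← h2]
  refine (h5.trans ht).trans (rk_pow_le_maxRank
    (J := (colShift K (n i) i).prodMap (stdOp K N n')) (fun l => ?_)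
    (isNilpotent_glue hc hi0 hJ hA.1 hAnil t) (commute_glue hc hJi hA.1 t) m)
  rw [prodMap_pow, rk_prodMap, rk_colShift_pow, hasType_stdOp, ← rho_erase_single n hi]

end Glue

/-- The length of the two-step chain through the parts `v` and `v - 1`. -/
def chainLen (N : ℕ) (n : ℕ → ℕ) (v : ℕ) : ℕ := v * n v + (v - 1) * n (v - 1) + 2 * numGt N n v

/-- Remove the parts `v` and `v - 1`, and decrease the larger ones by `2`. -/
def hat (n : ℕ → ℕ) (v i : ℕ) : ℕ := if v - 1 ≤ i then n (i + 2) else n i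

variable {N : ℕ} {n : ℕ → ℕ}

theorem tau_eq (hN : ∀ i, N ≤ i → n i = 0) (i : ℕ) :
    tau N n i = if 0 < n i ∧ tau N n (i + 1) = 0 then 1 else 0 := by
  rcases lt_or_ge i N with h | h
  · exact tau_of_lt n h
  · rw [tau_of_ge n h, if_neg]
    rw [hN i h]
    omega

theorem del_add_tau (i : ℕ) : del N n i + tau N n i = n i + tau N n (i + 1) := by
  have := tau_le N n i
  rw [del]
  omega

theorem del_eq_zero (hN : ∀ i, N ≤ i → n i = 0) {i : ℕ} (h : N ≤ i) : del N n i = 0 := by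
  have := del_add_tau (N := N) (n := n) i
  rw [hN i h, tau_of_ge n h, tau_of_ge n (h.trans i.le_succ)] at this
  omega

theorem numGt_succ (hN : ∀ i, N ≤ i → n i = 0) (v : ℕ) :
    numGt N n v = n (v + 1) + numGt N n (v + 1) := by
  rcases le_or_gt N (v + 1) with h | h
  · rw [numGt_eq_zero n h, hN _ h]
    refine Finset.sum_eq_zero fun i hi => ?_
    rw [Finset.mem_filter, Finset.mem_range] at hi
    omega
  · rw [numGt, numGt, ← Finset.add_sum_erase _ _
      (Finset.mem_filter.2 ⟨Finset.mem_range.2 h, Nat.lt_succ_self v⟩)]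
    congr 1
    refine Finset.sum_congr (Finset.ext fun i => ?_) fun _ _ => rfl
    simp only [Finset.mem_erase, Finset.mem_filter, Finset.mem_range]
    omega

theorem numGt_del_add (hN : ∀ i, N ≤ i → n i = 0) (v : ℕ) :
    numGt N (del N n) v + tau N n (v + 1) = numGt N n v := by
  have key : ∀ k v, N ≤ v + k → numGt N (del N n) v + tau N n (v + 1) = numGt N n v := by
    intro k
    induction k with
    | zero =>
      intro v h
      rw [add_zero] at h
      rw [numGt_eq_zero _ h, numGt_eq_zero _ h, tau_of_ge n (h.trans v.le_succ)]
    | succ k ih =>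
      intro v h
      have h1 := ih (v + 1) (by omega)
      have h2 := del_add_tau (N := N) (n := n) (v + 1)
      rw [numGt_succ hN, numGt_succ (n := del N n) fun i hi => del_eq_zero hN hi]
      omega
  exact key N v (Nat.le_add_left _ _)

theorem exists_next (hN : ∀ i, N ≤ i → n i = 0) {w : ℕ} (h : 0 < numGt N n w) :
    ∃ p, w < p ∧ 0 < n p ∧ numGt N n w = n p + numGt N n p := by
  have key : ∀ k w, N ≤ w + k → 0 < numGt N n w →
      ∃ p, w < p ∧ 0 < n p ∧ numGt N n w = n p + numGt N n p := by
    intro k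
    induction k with
    | zero =>
      intro w hw h
      rw [add_zero] at hw
      rw [numGt_eq_zero _ hw] at h
      omega
    | succ k ih =>
      intro w hw h
      have h1 := numGt_succ hN w
      rcases Nat.eq_zero_or_pos (n (w + 1)) with h2 | h2
      · rw [h2, zero_add] at h1
        obtain ⟨p, hp, hp2⟩ := ih (w + 1) (by omega) (h1 ▸ h)
        exact ⟨p, by omega, hp2.1, h1.trans hp2.2⟩
      · exact ⟨w + 1, by omega, h2, h1⟩
  exact key N w (Nat.le_add_left _ _) h

theorem exists_chainLen_gt (hN : ∀ i, N ≤ i → n i = 0) {w : ℕ} (hw : 2 ≤ w)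
    (h : 0 < numGt N n w) : ∃ p, w < p ∧ 2 * numGt N n w < chainLen N n p := by
  obtain ⟨p, hp, h1, h2⟩ := exists_next hN h
  refine ⟨p, hp, ?_⟩
  rw [chainLen, h2]
  have : 3 * n p ≤ p * n p := Nat.mul_le_mul_right _ (by omega)
  omega

theorem chainLen_del (hN : ∀ i, N ≤ i → n i = 0) {v : ℕ} (hv : 0 < v) :
    chainLen N (del N n) v + v * tau N n v + (v - 1) * tau N n (v - 1) + 2 * tau N n (v + 1) =
      chainLen N n v + v * tau N n (v + 1) + (v - 1) * tau N n v := by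
  have h1 := congrArg (v * ·) (del_add_tau (N := N) (n := n) v)
  have h2 := congrArg ((v - 1) * ·) (del_add_tau (N := N) (n := n) (v - 1))
  have h3 := numGt_del_add hN v
  rw [show v - 1 + 1 = v by omega] at h2
  simp only [mul_add] at h1 h2
  rw [chainLen, chainLen]
  omega

/-- `v` maximizes the chain length. -/
structure IsMaxChain (N : ℕ) (n : ℕ → ℕ) (v : ℕ) : Prop where
  two_le : 2 ≤ v
  pos : v = 2 ∨ 0 < n v + n (v - 1)
  max : ∀ w, 2 ≤ w → chainLen N n w ≤ chainLen N n v

theorem chainLen_eq_zero (hN : ∀ i, N ≤ i → n i = 0) {w : ℕ} (h : N + 1 ≤ w) :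
    chainLen N n w = 0 := by
  rw [chainLen, hN w (by omega), hN (w - 1) (by omega), numGt_eq_zero n (show N ≤ w by omega)]
  simp

theorem IsMaxChain.reduce (hN : ∀ i, N ≤ i → n i = 0) {v : ℕ} (h : IsMaxChain N n v)
    (hv : v ≠ 2) (h0 : n v = 0) :
    IsMaxChain N n (v - 1) ∧ 0 < n (v - 1) ∧ chainLen N n v = chainLen N n (v - 1) ∧
      n (v - 1 - 1) = 0 := by
  have h1 := h.two_le
  have h2 := h.max (v - 1) (by omega)
  have h3 := h.pos.resolve_left hv
  have h4 := numGt_succ hN (v - 1)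
  rw [show v - 1 + 1 = v by omega, h0] at h4
  have h6 : chainLen N n v = chainLen N n (v - 1) ∧ (v - 1 - 1) * n (v - 1 - 1) = 0 := by
    rw [chainLen, chainLen, h0, mul_zero] at *
    omega
  refine ⟨⟨by omega, Or.inr (by omega), fun w hw => h6.1 ▸ h.max w hw⟩, by omega, h6.1, ?_⟩
  exact (Nat.mul_eq_zero.1 h6.2).resolve_left (by omega)

theorem exists_isMaxChain (hN : ∀ i, N ≤ i → n i = 0) :
    ∃ v, IsMaxChain N n v ∧ (v = 2 ∨ 0 < n v) := by
  obtain ⟨v, hv, hmax⟩ := Finset.exists_max_image (Finset.Icc 2 (N + 2)) (chainLen N n)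
    ⟨2, Finset.mem_Icc.2 (by omega)⟩
  rw [Finset.mem_Icc] at hv
  have hmax' : ∀ w, 2 ≤ w → chainLen N n w ≤ chainLen N n v := by
    intro w hw
    rcases le_or_gt w (N + 2) with h | h
    · exact hmax w (Finset.mem_Icc.2 ⟨hw, h⟩)
    · rw [chainLen_eq_zero hN (by omega)]
      exact Nat.zero_le _
  have key : ∃ v, IsMaxChain N n v := by
    rcases Nat.eq_zero_or_pos (chainLen N n v) with h | h
    · exact ⟨2, le_rfl, Or.inl rfl, fun w hw => (hmax' w hw).trans (by omega)⟩
    · refine ⟨v, hv.1, Or.inr ?_, hmax'⟩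
      by_contra h2
      have h3 : chainLen N n v = 2 * numGt N n v := by
        rw [chainLen, show n v = 0 by omega, show n (v - 1) = 0 by omega]
        simp
      obtain ⟨p, hp, h4⟩ := exists_chainLen_gt hN hv.1 (by omega)
      have := hmax' p (by omega)
      omega
  obtain ⟨v, hv⟩ := key
  by_cases h : v = 2 ∨ 0 < n v
  · exact ⟨v, hv, h⟩
  · obtain ⟨h1, h2, -⟩ := hv.reduce hN (by omega) (by omega)
    exact ⟨v - 1, h1, Or.inr h2⟩

theorem tau_zero_or_one (i : ℕ) : tau N n i = 0 ∨ tau N n i = 1 := by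
  have := tau_le_one N n i
  omega

theorem eq_zero_of_tau (hN : ∀ i, N ≤ i → n i = 0) {i : ℕ} (h0 : tau N n i = 0)
    (h1 : tau N n (i + 1) = 0) : n i = 0 := by
  by_contra h
  rw [tau_eq hN, if_pos ⟨Nat.pos_of_ne_zero h, h1⟩] at h0
  omega

theorem tau_succ_of_tau {i : ℕ} (h : tau N n i = 1) : tau N n (i + 1) = 0 :=
  (pos_of_tau (N := N) (n := n) (i := i) (by omega)).2.2

theorem IsMaxChain.pos_chainLen (hN : ∀ i, N ≤ i → n i = 0) {v : ℕ} (h : IsMaxChain N n v)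
    (hne : 0 < numGt N n 0) : 0 < chainLen N n v := by
  have h2 := h.max 2 le_rfl
  have h3 := numGt_succ hN 0
  have h4 := numGt_succ hN 1
  simp only [zero_add, Nat.reduceAdd] at h3 h4
  rw [chainLen] at h2
  simp only [Nat.add_one_sub_one] at h2
  omega

theorem IsMaxChain.chainLen_del_lt (hN : ∀ i, N ≤ i → n i = 0) {v : ℕ} (h : IsMaxChain N n v)
    (hne : 0 < numGt N n 0) {w : ℕ} (hw : 2 ≤ w) : chainLen N (del N n) w < chainLen N n v := by
  have h1 := chainLen_del hN (show 0 < w by omega)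
  have h2 := h.max w hw
  have h0 := h.pos_chainLen hN hne
  have hw1 : w - 1 + 1 = w := by omega
  obtain ⟨k, rfl⟩ := Nat.exists_eq_add_of_le' hw
  have e1 := tau_succ_of_tau (N := N) (n := n) (i := k + 2)
  have e2 := tau_succ_of_tau (N := N) (n := n) (i := k + 2 - 1)
  rw [hw1] at e2
  rcases tau_zero_or_one (N := N) (n := n) (k + 2) with t1 | t1 <;>
  rcases tau_zero_or_one (N := N) (n := n) (k + 2 + 1) with t2 | t2 <;>
  rcases tau_zero_or_one (N := N) (n := n) (k + 2 - 1) with t3 | t3 <;>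
  rw [t1, t2, t3] at h1 <;> simp only [mul_zero, mul_one, add_zero] at h1 <;> try omega
  · have z1 := eq_zero_of_tau hN t1 t2
    have z2 := eq_zero_of_tau hN t3 (hw1.symm ▸ t1)
    have h3 : chainLen N n (k + 2) = 2 * numGt N n (k + 2) := by
      rw [chainLen, z1, z2]
      simp
    rcases Nat.eq_zero_or_pos (numGt N n (k + 2)) with h4 | h4
    · omega
    · obtain ⟨p, hp, h5⟩ := exists_chainLen_gt hN (by omega) h4
      have := h.max p (by omega)
      omega
  · have z2 := eq_zero_of_tau hN t3 (hw1.symm ▸ t1)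
    have h3 := h.max (k + 2 + 1) (by omega)
    have h4 := numGt_succ hN (k + 2)
    have h5 := (pos_of_tau (N := N) (n := n) (i := k + 2 + 1) (by omega)).2.1
    rw [chainLen] at h3
    rw [show chainLen N n (k + 2) = (k + 2) * n (k + 2) + (k + 2 - 1) * 0 +
      2 * numGt N n (k + 2) by rw [← z2, chainLen]] at h1
    have h6 : (k + 1) * 1 ≤ (k + 1) * n (k + 2 + 1) := Nat.mul_le_mul_left _ h5
    have h7 : (k + 2 + 1) * n (k + 2 + 1) = (k + 1) * n (k + 2 + 1) + 2 * n (k + 2 + 1) := by ring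
    simp only [Nat.add_sub_cancel] at h3
    omega

theorem IsMaxChain.tau_cases (hN : ∀ i, N ≤ i → n i = 0) {v : ℕ} (h : IsMaxChain N n v)
    (hne : 0 < numGt N n 0) (hv : v = 2 ∨ 0 < n v) :
    (v = 2 ∨ tau N n (v + 1) = tau N n (v - 1)) ∧
      chainLen N (del N n) v + 1 = chainLen N n v := by
  have h1 := h.chainLen_del_lt hN hne h.two_le
  have h2 := chainLen_del hN (show 0 < v by have := h.two_le; omega)
  obtain ⟨k, rfl⟩ := Nat.exists_eq_add_of_le' h.two_le
  have hw1 : k + 2 - 1 + 1 = k + 2 := by omega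
  have e1 := tau_succ_of_tau (N := N) (n := n) (i := k + 2)
  have e2 := tau_succ_of_tau (N := N) (n := n) (i := k + 2 - 1)
  have e3 := eq_zero_of_tau hN (i := k + 2)
  rw [hw1] at e2
  rcases tau_zero_or_one (N := N) (n := n) (k + 2) with t1 | t1 <;>
  rcases tau_zero_or_one (N := N) (n := n) (k + 2 + 1) with t2 | t2 <;>
  rcases tau_zero_or_one (N := N) (n := n) (k + 2 - 1) with t3 | t3 <;>
  rw [t1, t2, t3] at h2 <;> simp only [mul_zero, mul_one, add_zero] at h2 <;>
  constructor <;> omega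

theorem IsMaxChain.del (hN : ∀ i, N ≤ i → n i = 0) {v : ℕ} (h : IsMaxChain N n v)
    (hne : 0 < numGt N n 0) (hv : v = 2 ∨ 0 < n v) : IsMaxChain N (del N n) v := by
  have h1 := h.tau_cases hN hne hv
  refine ⟨h.two_le, ?_, fun w hw => ?_⟩
  · rcases eq_or_ne v 2 with h2 | h2
    · exact Or.inl h2
    have h3 := hv.resolve_left h2
    have h4 := del_add_tau (N := N) (n := n) v
    have h5 := del_add_tau (N := N) (n := n) (v - 1)
    rw [show v - 1 + 1 = v by have := h.two_le; omega] at h5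
    omega
  · have := h.chainLen_del_lt hN hne hw
    omega

theorem hat_eq_zero (hN : ∀ i, N ≤ i → n i = 0) (v : ℕ) {i : ℕ} (h : N ≤ i) : hat n v i = 0 := by
  rw [hat]
  split_ifs
  · exact hN _ (by omega)
  · exact hN _ h

theorem IsMaxChain.hat_del (hN : ∀ i, N ≤ i → n i = 0) {v : ℕ} (h : IsMaxChain N n v)
    (hne : 0 < numGt N n 0) (hv : v = 2 ∨ 0 < n v) {i : ℕ} (hi : 0 < i) :
    Oblak.del N (hat n v) i = hat (Oblak.del N n) v i := by
  have h2 := h.two_le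
  have hN' := fun i (hi : N ≤ i) => hat_eq_zero hN v hi
  have big : ∀ i, v - 1 ≤ i → tau N (hat n v) i = tau N n (i + 2) := by
    intro i hi
    refine (tau_unique (f := fun i => tau N n (i + 2)) (v - 1) (fun i hi => tau_of_ge n (by omega))
      (fun i hi hiN => ?_) i hi).symm
    rw [tau_eq hN (i + 2), hat, if_pos hi]
  have hb := big (v - 1) le_rfl
  rw [show v - 1 + 2 = v + 1 by omega] at hb
  have small : v = 2 ∨ ∀ k, k ≤ v - 1 → tau N (hat n v) (v - 1 - k) = tau N n (v - 1 - k) := by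
    rcases (h.tau_cases hN hne hv).1 with h3 | h3
    · exact Or.inl h3
    refine Or.inr fun k => ?_
    induction k with
    | zero => intro _; rw [Nat.sub_zero, hb, h3]
    | succ k ih =>
      intro hk
      rw [tau_eq hN, tau_eq hN', show v - 1 - (k + 1) + 1 = v - 1 - k by omega, ih (by omega), hat,
        if_neg (show ¬ v - 1 ≤ v - 1 - (k + 1) by omega)]
  have h3 := del_add_tau (N := N) (n := hat n v) i
  have h4 := del_add_tau (N := N) (n := n) i
  have h5 := del_add_tau (N := N) (n := n) (i + 2)
  rcases le_or_gt (v - 1) i with h6 | h6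
  · rw [big i h6, big (i + 1) (by omega), hat, if_pos h6] at h3
    rw [hat, if_pos h6]
    rw [show i + 2 + 1 = i + 1 + 2 by ring] at h5
    omega
  · have h7 := small.resolve_left (by omega)
    have h8 := h7 (v - 1 - i) (by omega)
    have h9 := h7 (v - 1 - (i + 1)) (by omega)
    rw [show v - 1 - (v - 1 - i) = i by omega] at h8
    rw [show v - 1 - (v - 1 - (i + 1)) = i + 1 by omega] at h9
    rw [h8, h9, hat, if_neg (by omega)] at h3
    rw [hat, if_neg (by omega)]
    omega

theorem rho_congr {n' : ℕ → ℕ} (h : ∀ i, 0 < i → i < N → n i = n' i) (l : ℕ) :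
    rho N n l = rho N n' l := by
  refine Finset.sum_congr rfl fun i hi => ?_
  rcases Nat.eq_zero_or_pos i with rfl | h0
  · simp
  · rw [h i h0 (Finset.mem_range.1 hi)]

theorem rho_hat (hN : ∀ i, N ≤ i → n i = 0) {v : ℕ} (hv : 0 < v) :
    rho N n 0 = chainLen N n v + rho N (hat n v) 0 := by
  have ext : ∀ (f : ℕ → ℕ), (∀ i, N ≤ i → f i = 0) → ∀ M, N ≤ M →
      ∑ i ∈ range N, f i = ∑ i ∈ range M, f i := fun f hf M hM =>
    Finset.sum_subset (Finset.range_subset_range.2 hM) fun i _ hi =>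
      hf i (by rw [Finset.mem_range] at hi; omega)
  obtain ⟨k, rfl⟩ := Nat.exists_eq_add_of_le' hv
  have e1 : rho N n 0 = ∑ i ∈ range k, n i * i + n k * k + n (k + 1) * (k + 1) +
      ∑ i ∈ range N, n (k + 2 + i) * (k + 2 + i) := by
    rw [rho]
    simp only [Nat.sub_zero]
    rw [ext (fun i => n i * i) (fun i hi => by rw [hN i hi, zero_mul]) (k + 2 + N) (by omega),
      Finset.sum_range_add, Finset.sum_range_succ, Finset.sum_range_succ]
  have e2 : rho N (hat n (k + 1)) 0 = ∑ i ∈ range k, n i * i +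
      ∑ i ∈ range N, n (k + 2 + i) * (k + i) := by
    rw [rho]
    simp only [Nat.sub_zero]
    rw [ext (fun i => hat n (k + 1) i * i) (fun i hi => by rw [hat_eq_zero hN _ hi, zero_mul])
      (k + N) (by omega), Finset.sum_range_add]
    congr 1
    · refine Finset.sum_congr rfl fun i hi => ?_
      rw [Finset.mem_range] at hi
      rw [hat, if_neg (by omega)]
    · refine Finset.sum_congr rfl fun i _ => ?_
      rw [hat, if_pos (by omega), show k + i + 2 = k + 2 + i by ring]
  have e3 : numGt N n (k + 1) = ∑ i ∈ range N, n (k + 2 + i) := by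
    have : numGt N n (k + 1) = ∑ i ∈ range N, if k + 1 < i then n i else 0 := by
      rw [numGt, Finset.sum_filter]
    rw [this, ext (fun i => if k + 1 < i then n i else 0)
      (fun i hi => by rw [hN i hi, ite_self]) (k + 2 + N) (by omega), Finset.sum_range_add,
      Finset.sum_eq_zero (fun i hi => if_neg (by rw [Finset.mem_range] at hi; omega)), zero_add]
    exact Finset.sum_congr rfl fun i _ => if_pos (by omega)
  have e4 : ∑ i ∈ range N, n (k + 2 + i) * (k + 2 + i) =
      ∑ i ∈ range N, n (k + 2 + i) * (k + i) + 2 * numGt N n (k + 1) := by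
    rw [e3, Finset.mul_sum, ← Finset.sum_add_distrib]
    exact Finset.sum_congr rfl fun i _ => by ring
  rw [e1, e2, e4, chainLen, Nat.add_sub_cancel]
  ring

theorem numGt_zero_pos_iff : 0 < numGt N n 0 ↔ 0 < rho N n 0 := by
  rw [Nat.pos_iff_ne_zero, Nat.pos_iff_ne_zero, not_iff_not, rho_eq_succ_add]
  constructor
  · intro h
    rw [h, add_zero]
    refine Finset.sum_eq_zero fun i hi => ?_
    rcases Nat.eq_zero_or_pos i with rfl | h0
    · simp
    · rw [Finset.sum_eq_zero_iff.1 h i (Finset.mem_filter.2 ⟨hi, h0⟩), zero_mul]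
  · omega

variable {K : Type*} [Field K] {N : ℕ} {n : ℕ → ℕ}

theorem maxRank_congr_of_eq {n' : ℕ → ℕ} (h : ∀ i, 0 < i → i < N → n i = n' i) (m : ℕ) :
    maxRank K N n m = maxRank K N n' m :=
  maxRank_congr (rho_congr h) m

theorem erase_eq_zero (hN : ∀ i, N ≤ i → n i = 0) (i j : ℕ) {k : ℕ} (h : N ≤ k) :
    erase n i j k = 0 := by
  rw [erase, hN k h, ite_self]

theorem erase_erase (i j : ℕ) : erase (erase n i i) j j = erase n i j := by
  funext k
  simp only [erase]
  split_ifs <;> first | rfl | omega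

theorem numGt_eq_zero_of_top {i w : ℕ} (h : ∀ j, i < j → n j = 0) (hw : i ≤ w) :
    numGt N n w = 0 :=
  Finset.sum_eq_zero fun j hj => h j (hw.trans_lt (Finset.mem_filter.1 hj).2)

theorem numGt_erase {i w : ℕ} (hi : i < N) (hw : w < i) :
    numGt N n w = n i + numGt N (erase n i i) w := by
  have h : i ∈ {j ∈ range N | w < j} := Finset.mem_filter.2 ⟨Finset.mem_range.2 hi, hw⟩
  rw [numGt, numGt, ← Finset.add_sum_erase _ _ h, ← Finset.add_sum_erase _ (erase n i i) h]
  congr 1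
  rw [erase, if_pos (Or.inl rfl), zero_add]
  refine Finset.sum_congr rfl fun k hk => ?_
  have := (Finset.mem_erase.1 hk).1
  rw [erase, if_neg (by omega)]

theorem IsMaxChain.erase_top {v i : ℕ} (h : IsMaxChain N n v) (hv : v = 2 ∨ 0 < n v) (hi : i < N)
    (hvi : v < i) (htop : ∀ j, i < j → n j = 0) :
    IsMaxChain N (erase n i i) v ∧ (v = 2 ∨ 0 < erase n i i v) ∧
      chainLen N n v = chainLen N (erase n i i) v + 2 * n i := by
  have h2 := h.two_le
  have low : ∀ w, 0 < w → w < i → chainLen N n w = chainLen N (erase n i i) w + 2 * n i := by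
    intro w h0 hw
    rw [chainLen, chainLen, numGt_erase hi hw, erase, if_neg (by omega), erase, if_neg (by omega)]
    omega
  have hlv := low v (by omega) hvi
  have htop' : ∀ j, i ≤ j → erase n i i j = 0 := by
    intro j hj
    rw [erase]
    split_ifs
    · rfl
    · exact htop j (by omega)
  have hev : erase n i i v = n v := by rw [erase, if_neg (by omega)]
  refine ⟨⟨h2, hv.imp_right fun h3 => by omega, fun w hw => ?_⟩, by rwa [hev], hlv⟩
  rcases lt_trichotomy w i with h3 | rfl | h3
  · have := low w (by omega) h3
    have := h.max w hw
    omega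
  · have h4 := h.max w hw
    rw [chainLen, numGt_eq_zero_of_top htop le_rfl] at h4
    rw [chainLen, numGt_eq_zero_of_top (fun j hj => htop' j (by omega)) le_rfl, htop' w le_rfl,
      show erase n w w (w - 1) = n (w - 1) by rw [erase, if_neg (by omega)]]
    have : 2 * n w ≤ w * n w := Nat.mul_le_mul_right _ hw
    omega
  · rw [chainLen, numGt_eq_zero_of_top (fun j hj => htop' j (by omega)) h3.le, htop' w h3.le,
      htop' (w - 1) (by omega)]
    simp

theorem hat_erase {v i : ℕ} (hv : 2 ≤ v) (hi : v < i) :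
    hat (erase n i i) v = erase (hat n v) (i - 2) (i - 2) := by
  funext k
  simp only [hat, erase]
  split_ifs <;> first | rfl | omega

variable (K N n) in
/-- Splitting off a longest chain computes the maximal ranks. -/
def ChainSplit : Prop := ∀ v, IsMaxChain N n v → ∀ m,
  maxRank K N n m = (chainLen N n v - m) + maxRank K N (hat n v) m

variable (K N n) in
/-- The maximal ranks are attained by one of three constructions involving the largest part. -/
def TopBound : Prop := ∀ i, 0 < i → i < N → 0 < n i → (∀ j, i < j → n j = 0) → ∀ m,
  maxRank K N n m ≤ maxRank K N (erase n i i) (m - 2 * n i) +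
      (2 * n i - m) * nullity K N (erase n i i) ∨
    maxRank K N n m ≤ (n i * i - m) + maxRank K N (erase n i i) m ∨
    maxRank K N n m ≤ (n i * i + n (i - 1) * (i - 1) - m) + maxRank K N (erase n i (i - 1)) m

theorem chain_le_top
    (hN : ∀ i, N ≤ i → n i = 0)
    (IH : ∀ n' : ℕ → ℕ, (∀ i, N ≤ i → n' i = 0) → rho N n' 0 < rho N n 0 →
      ChainSplit K N n' ∧ TopBound K N n')
    {v i : ℕ} (h : IsMaxChain N n v) (hv : v = 2 ∨ 0 < n v) (hi0 : 0 < i) (hi : i < N)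
    (hc : 0 < n i) (htop : ∀ j, i < j → n j = 0) (m : ℕ) :
    (chainLen N n v - m) + maxRank K N (hat n v) m ≤ maxRank K N (erase n i i) (m - 2 * n i) +
        (2 * n i - m) * nullity K N (erase n i i) ∨
      (chainLen N n v - m) + maxRank K N (hat n v) m ≤
        (n i * i - m) + maxRank K N (erase n i i) m ∨
      (chainLen N n v - m) + maxRank K N (hat n v) m ≤
        (n i * i + n (i - 1) * (i - 1) - m) + maxRank K N (erase n i (i - 1)) m := by
  have h2 := h.two_le
  rcases lt_trichotomy i v with hiv | rfl | hiv
  · have hnv := htop v hiv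
    obtain rfl : v = 2 := hv.resolve_right (by omega)
    obtain rfl : i = 1 := by omega
    right; left
    rw [chainLen, numGt_eq_zero_of_top htop (by omega), hnv,
      maxRank_congr_of_eq (n := hat n 2) (n' := erase n 1 1) fun k hk hkN => ?_]
    · simp
    · rw [hat, if_pos (by omega), htop _ (by omega), erase]
      split_ifs
      · rfl
      · rw [htop _ (by omega)]
  · right; right
    rw [chainLen, numGt_eq_zero_of_top htop le_rfl, mul_comm i, mul_comm (i - 1),
      maxRank_congr_of_eq (n := hat n i) (n' := erase n i (i - 1)) fun k hk hkN => ?_]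
    · simp
    · rw [hat, erase]
      split_ifs <;> first | rfl | omega | exact htop _ (by omega) |
        exact (htop _ (by omega)).trans (htop _ (by omega)).symm
  -- the largest part is not touched by the chain
  have hWi := h.max i (by omega)
  rw [chainLen, numGt_eq_zero_of_top htop le_rfl] at hWi
  have hici : i * n i = (i - 2) * n i + 2 * n i := by
    rw [← add_mul]; congr 1; omega
  have hid : (i - 1) * n (i - 1) = (i - 2 - 1) * n (i - 1) + 2 * n (i - 1) := by
    rw [← add_mul]; congr 1; omega
  have hci : n i ≤ (i - 2) * n i := Nat.le_mul_of_pos_left _ (by omega)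
  have hne : 0 < rho N n 0 := by
    rw [rho_erase_single n hi, mul_zero, Nat.sub_zero]
    have := Nat.mul_pos hc hi0
    omega
  obtain ⟨h1, hv1, hW1⟩ := h.erase_top hv hi hiv htop
  have hT := (IH (erase n i i) (fun k hk => erase_eq_zero hN i i hk) (by
    rw [rho_erase_single n hi, mul_zero, Nat.sub_zero]
    have := Nat.mul_pos hc hi0
    omega)).1 v h1
  rw [hat_erase h2 hiv] at hT
  have hhi : hat n v (i - 2) = n i := by
    rw [hat, if_pos (by omega), show i - 2 + 2 = i by omega]
  have hM := (IH (hat n v) (fun k hk => hat_eq_zero hN v hk) (by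
    have := rho_hat hN (show 0 < v by omega)
    have := h.pos_chainLen hN (numGt_zero_pos_iff.2 hne)
    omega)).2 (i - 2) (by omega) (by omega) (by rwa [hhi]) (fun j hj => by
      rw [hat, if_pos (by omega)]
      exact htop _ (by omega)) m
  rw [hhi] at hM
  set Y := erase (hat n v) (i - 2) (i - 2) with hY
  have hYm := maxRank_antitone (K := K) N Y
  have hχ : nullity K N (erase n i i) = 1 + nullity K N Y := by
    have := hYm zero_le_one
    rw [nullity, nullity, hT 0, hT 1]
    omega
  have ho1 : maxRank K N (erase n i i) (m - 2 * n i) + (2 * n i - m) * nullity K N (erase n i i) =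
      (chainLen N (erase n i i) v - (m - 2 * n i)) + maxRank K N Y (m - 2 * n i) +
        ((2 * n i - m) + (2 * n i - m) * nullity K N Y) := by
    rw [hχ, hT, mul_add, mul_one]
  have hYle := hYm (Nat.sub_le m (2 * n i))
  rw [ho1]
  have hb : (chainLen N n v - m) + ((n i * (i - 2) - m) + maxRank K N Y m) ≤
      (chainLen N (erase n i i) v - (m - 2 * n i)) + maxRank K N Y (m - 2 * n i) +
        ((2 * n i - m) + (2 * n i - m) * nullity K N Y) ∨
      (chainLen N n v - m) + ((n i * (i - 2) - m) + maxRank K N Y m) ≤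
        (n i * i - m) + maxRank K N (erase n i i) m := by
    rw [hT m, mul_comm _ (i - 2), mul_comm _ i]
    rcases le_or_gt m ((i - 2) * n i) with h3 | h3
    · right; omega
    · left; omega
  rcases hM with hM | hM | hM
  · left; omega
  · rcases hb with hb | hb
    · left; omega
    · right; left; omega
  have hY' : erase (hat n v) (i - 2) (i - 2 - 1) = erase Y (i - 2 - 1) (i - 2 - 1) :=
    (erase_erase _ _).symm
  have hYY' := add_maxRank_le (K := K) (rho_erase_single Y (show i - 2 - 1 < N by omega)) m
  rw [← hY'] at hYY'
  set Y' := erase (hat n v) (i - 2) (i - 2 - 1)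
  rcases le_or_gt (n i * (i - 2) + hat n v (i - 2 - 1) * (i - 2 - 1)) m with h3 | h3
  · left; omega
  rcases eq_or_ne i 3 with rfl | hi3
  · simp only [Nat.reduceSub, mul_zero, add_zero] at *
    rcases hb with hb | hb
    · left; omega
    · right; left; omega
  right; right
  rcases Nat.lt_or_ge v (i - 1) with hvi | hvi
  · have hhd : hat n v (i - 2 - 1) = n (i - 1) := by
      rw [hat, if_pos (by omega), show i - 2 - 1 + 2 = i - 1 by omega]
    have hed : erase n i i (i - 1) = n (i - 1) := by rw [erase, if_neg (by omega)]
    obtain ⟨h4, -, hW4⟩ := h1.erase_top hv1 (show i - 1 < N by omega) hvi fun j hj => by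
      rw [erase]
      split_ifs
      · rfl
      · exact htop _ (by omega)
    have hT4 := (IH (erase n i (i - 1)) (fun k hk => erase_eq_zero hN _ _ hk) (by
      rw [rho_erase_pair n hi0 hi, mul_zero, Nat.sub_zero]
      have := Nat.mul_pos hc hi0
      omega)).1 v (by rwa [erase_erase] at h4) m
    have h5 : hat (erase n i (i - 1)) v = Y' := by
      rw [← erase_erase, hat_erase h2 hvi, hat_erase h2 hiv, erase_erase,
        show i - 1 - 2 = i - 2 - 1 by omega]
    rw [erase_erase, hed] at hW4
    rw [h5] at hT4
    rw [hT4]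
    rw [hhd, mul_comm, mul_comm (n (i - 1))] at h3 hM
    rw [mul_comm, mul_comm (n (i - 1))]
    omega
  · obtain rfl : i = v + 1 := by omega
    have t1 := numGt_succ hN (v - 1)
    have t2 := numGt_succ hN v
    rw [numGt_eq_zero_of_top htop le_rfl] at t2
    rw [show v - 1 + 1 = v by omega] at t1
    have h4 := h.max (v - 1) (by omega)
    have hW : chainLen N n v = v * n v + (v - 1) * n (v - 1) + 2 * n (v + 1) := by
      rw [chainLen, t2, add_zero]
    rw [hW] at hWi h4 ⊢
    rw [chainLen, t1, t2] at h4
    simp only [Nat.add_sub_cancel] at *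
    rw [show v + 1 - 2 = v - 1 by omega] at *
    have hhd : hat n v (v - 1 - 1) = n (v - 1 - 1) := by rw [hat, if_neg (by omega)]
    have hsplit : v * n v = (v - 1 - 1) * n v + 2 * n v := by
      rw [← add_mul]; congr 1; omega
    have hc4 : n (v - 1 - 1) ≤ n v :=
      Nat.le_of_mul_le_mul_left (show (v - 1 - 1) * n (v - 1 - 1) ≤ (v - 1 - 1) * n v by omega)
        (by omega)
    have hc1 : n (v + 1) ≤ n (v - 1) :=
      Nat.le_of_mul_le_mul_left (show (v - 1) * n (v + 1) ≤ (v - 1) * n (v - 1) by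
        omega) (by omega)
    have m1 : (v - 1 - 1) * n (v - 1 - 1) ≤ (v - 1 - 1) * n v := Nat.mul_le_mul_left _ hc4
    have m2 : (v - 1) * n (v + 1) ≤ (v - 1) * n (v - 1) := Nat.mul_le_mul_left _ hc1
    have hZ := add_maxRank_le (K := K)
      (rho_erase_pair (erase n (v + 1) v) (show 0 < v - 1 by omega) (show v - 1 < N by omega)) m
    have e1 : erase n (v + 1) v (v - 1) = n (v - 1) := by rw [erase, if_neg (by omega)]
    have e2 : erase n (v + 1) v (v - 1 - 1) = n (v - 1 - 1) := by rw [erase, if_neg (by omega)]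
    have e3 : maxRank K N (erase (erase n (v + 1) v) (v - 1) (v - 1 - 1)) m = maxRank K N Y' m := by
      refine maxRank_congr_of_eq (fun k _ _ => ?_) m
      simp only [Y', erase, hat]
      split_ifs <;> first | rfl | omega | exact htop _ (by omega) | exact (htop _ (by omega)).symm |
        exact (htop _ (by omega)).trans (htop _ (by omega)).symm
    rw [e1, e2, e3, mul_comm, mul_comm (n (v - 1 - 1))] at hZ
    rw [hhd, mul_comm, mul_comm (n (v - 1 - 1))] at h3 hM
    rw [mul_comm (n (v + 1)), mul_comm (n v)]
    omega

theorem exists_top (h : 0 < numGt N n 0) (hN : ∀ i, N ≤ i → n i = 0) :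
    ∃ i, 0 < i ∧ i < N ∧ 0 < n i ∧ ∀ j, i < j → n j = 0 := by
  obtain ⟨p, h0, hp, -⟩ := exists_next hN h
  have hlt : ∀ q, 0 < n q → q < N := fun q hq => by
    by_contra h
    rw [hN q (by omega)] at hq
    omega
  obtain ⟨i, hi, hmax⟩ := Finset.exists_max_image {i ∈ range N | 0 < n i} id
    ⟨p, Finset.mem_filter.2 ⟨Finset.mem_range.2 (hlt p hp), hp⟩⟩
  rw [Finset.mem_filter] at hi
  have hle : ∀ q, 0 < n q → q ≤ i := fun q hq =>
    hmax q (Finset.mem_filter.2 ⟨Finset.mem_range.2 (hlt q hq), hq⟩)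
  refine ⟨i, h0.trans_le (hle p hp), hlt i hi.2, hi.2, fun j hj => ?_⟩
  by_contra h
  exact absurd (hle j (Nat.pos_of_ne_zero h)) (by omega)

variable (K) in
theorem maxRank_succ_and_split [Infinite K] (n : ℕ → ℕ) (hN : ∀ i, N ≤ i → n i = 0) :
    (ChainSplit K N n ∧ TopBound K N n) ∧
      ∀ m, maxRank K N n (m + 1) = maxRank K N (del N n) m := by
  induction hr : rho N n 0 using Nat.strong_induction_on generalizing n with
  | _ r ih =>
  subst hr
  have IH : ∀ n' : ℕ → ℕ, (∀ i, N ≤ i → n' i = 0) → rho N n' 0 < rho N n 0 →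
      ChainSplit K N n' ∧ TopBound K N n' := fun n' hn' h => (ih _ h n' hn' rfl).1
  have hle : ∀ m, maxRank K N n m ≤ rho N n 0 := fun m =>
    (maxRank_antitone N n (Nat.zero_le m)).trans (maxRank_zero N n).le
  have hdel : rho N (del N n) 0 ≤ rho N n 0 := by
    have := rho_del_add_card N n 0
    omega
  rcases Nat.eq_zero_or_pos (rho N n 0) with h0 | h0
  · refine ⟨⟨fun v hv m => ?_, fun i hi0 hi hc _ m => ?_⟩, fun m => ?_⟩
    · have h1 := rho_hat hN (show 0 < v by have := hv.two_le; omega)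
      have h2 := hle m
      have h3 := maxRank_antitone (K := K) N (hat n v) (Nat.zero_le m)
      rw [maxRank_zero] at h3
      omega
    · have := rho_erase_single n hi 0
      have := Nat.mul_pos hc hi0
      omega
    · have h2 := hle (m + 1)
      have h3 := maxRank_antitone (K := K) N (del N n) (Nat.zero_le m)
      rw [maxRank_zero] at h3
      omega
  have hne := numGt_zero_pos_iff.2 h0
  have main : ∀ v, IsMaxChain N n v → (v = 2 ∨ 0 < n v) →
      (∀ m, maxRank K N n m = (chainLen N n v - m) + maxRank K N (hat n v) m) ∧
      ∀ m, maxRank K N n (m + 1) = maxRank K N (del N n) m := by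
    intro v h hv
    have h2 := h.two_le
    have hlen := h.pos_chainLen hN hne
    have hrho := rho_hat hN (show 0 < v by omega)
    have hdelN : ∀ i, N ≤ i → del N n i = 0 := fun i hi => del_eq_zero hN hi
    have hrho' := rho_hat hdelN (show 0 < v by omega)
    have hhd : ∀ i, 0 < i → i < N → del N (hat n v) i = hat (del N n) v i := fun i hi _ =>
      h.hat_del hN hne hv hi
    have hcl := (h.tau_cases hN hne hv).2
    have hT := (IH (del N n) hdelN (by
      have h3 := rho_del_add_card N (hat n v) 0
      rw [rho_congr hhd] at h3
      omega)).1 v (h.del hN hne hv)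
    have hE := (ih _ (show rho N (hat n v) 0 < rho N n 0 by omega) (hat n v)
      (fun i hi => hat_eq_zero hN v hi) rfl).2
    have upper : ∀ m, maxRank K N (del N n) m =
        (chainLen N n v - (m + 1)) + maxRank K N (hat n v) (m + 1) := by
      intro m
      rw [hE, maxRank_congr_of_eq hhd, hT]
      omega
    have split : ∀ m, maxRank K N n m = (chainLen N n v - m) + maxRank K N (hat n v) m := by
      intro m
      apply le_antisymm
      · cases m with
        | zero => rw [maxRank_zero, maxRank_zero, hrho, Nat.sub_zero]
        | succ m =>
          rw [← upper]
          exact maxRank_le_del N n (Nat.succ_pos m)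
      · obtain ⟨i, hi0, hi, hc, htop⟩ := exists_top hne hN
        rcases chain_le_top hN IH h hv hi0 hi hc htop m with h3 | h3 | h3
        · exact h3.trans (le_maxRank_of_top hi0 hi (fun j hj _ => htop j hj) hc m)
        · exact h3.trans (add_maxRank_le (rho_erase_single n hi) m)
        · exact h3.trans (add_maxRank_le (rho_erase_pair n hi0 hi) m)
    exact ⟨split, fun m => (split _).trans (upper m).symm⟩
  obtain ⟨v₀, hv₀, hv₀'⟩ := exists_isMaxChain hN
  refine ⟨⟨fun v h => ?_, fun i hi0 hi hc htop m => ?_⟩, (main v₀ hv₀ hv₀').2⟩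
  · by_cases hv : v = 2 ∨ 0 < n v
    · exact (main v h hv).1
    · obtain ⟨h1, h2, h3, h4⟩ := h.reduce hN (by omega) (by omega)
      have := h.two_le
      intro m
      rw [(main (v - 1) h1 (Or.inr h2)).1 m, h3]
      congr 1
      refine maxRank_congr_of_eq (fun k _ _ => ?_) m
      simp only [hat]
      split_ifs with h5 h6 h6
      · rfl
      · rw [show k = v - 1 - 1 by omega, h4, show v - 1 - 1 + 2 = v by omega]
        omega
      · omega
      · rfl
  · rw [(main v₀ hv₀ hv₀').1 m]
    exact chain_le_top hN IH hv₀ hv₀' hi0 hi hc htop m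

section Transfer

variable {K : Type*} [Field K] {u : ℕ}

/-- The number of Jordan blocks of size `i` of `jordanMatrixM K u c ν`. -/
def mult (c ν : Fin u → ℕ) (i : ℕ) : ℕ := ∑ k with ν k = i, c k

theorem sum_mult_mul (c ν : Fin u → ℕ) (s : Finset ℕ) (f : ℕ → ℕ) :
    ∑ i ∈ s, mult c ν i * f i = ∑ k with ν k ∈ s, c k * f (ν k) := by
  rw [← Finset.sum_fiberwise_of_maps_to (t := s) (g := ν)
    fun k hk => (Finset.mem_filter.1 hk).2]
  refine Finset.sum_congr rfl fun i hi => ?_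
  rw [mult, Finset.sum_mul, Finset.filter_filter]
  refine Finset.sum_congr (Finset.filter_congr fun k _ => ?_) fun k hk => ?_
  · constructor
    · rintro rfl; exact ⟨hi, rfl⟩
    · exact fun h => h.2
  · rw [(Finset.mem_filter.1 hk).2.2]

theorem rho_mult {c ν : Fin u → ℕ} {N : ℕ} (hN : ∀ k, ν k < N) (l : ℕ) :
    rho N (mult c ν) l = ∑ k, c k * (ν k - l) := by
  rw [rho, sum_mult_mul c ν _ fun i => i - l]
  congr 1
  exact Finset.filter_true_of_mem fun k _ => Finset.mem_range.2 (hN k)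

theorem numGt_mult {c ν : Fin u → ℕ} {N : ℕ} (hN : ∀ k, ν k < N) (a : ℕ) :
    numGt N (mult c ν) a = ∑ k with a < ν k, c k := by
  have := sum_mult_mul c ν (range N |>.filter (a < ·)) fun _ => 1
  simp only [mul_one] at this
  rw [numGt, this]
  refine Finset.sum_congr (Finset.filter_congr fun k _ => ?_) fun _ _ => rfl
  rw [Finset.mem_filter, Finset.mem_range]
  exact ⟨fun h => h.2, fun h => ⟨hN k, h⟩⟩

theorem mult_eq_zero {c ν : Fin u → ℕ} {i : ℕ} (h : ∀ k, ν k ≠ i) : mult c ν i = 0 := by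
  rw [mult, Finset.filter_false_of_mem fun k _ => h k, Finset.sum_empty]

theorem rank_jordanMatrixM_pow (c ν : Fin u → ℕ) (l : ℕ) :
    (jordanMatrixM K u c ν ^ l).rank = ∑ k, c k * (ν k - l) := by
  let e : (Σ k : Fin u, Fin (c k) × Fin (ν k)) ≃ Σ b : (Σ k : Fin u, Fin (c k)), Fin (ν b.1) :=
    { toFun := fun p => ⟨⟨p.1, p.2.1⟩, p.2.2⟩
      invFun := fun q => ⟨q.1.1, q.1.2, q.2⟩
      left_inv := fun _ => rfl
      right_inv := fun _ => rfl }
  let Θ := LinearEquiv.funCongrLeft K K e.symm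
  have h : ∀ v, Θ (toLin' (jordanMatrixM K u c ν)ᵀ v) =
      jordanOp K (fun b : (Σ k : Fin u, Fin (c k)) => ν b.1) (Θ v) := by
    have h2 : Θ.toLinearMap ∘ₗ toLin' (jordanMatrixM K u c ν)ᵀ =
        jordanOp K (fun b : (Σ k : Fin u, Fin (c k)) => ν b.1) ∘ₗ Θ.toLinearMap := by
      refine (Pi.basisFun K _).ext fun ⟨k', b', a'⟩ => ?_
      have h3 : Θ (Pi.single ⟨k', b', a'⟩ 1) = Pi.single ⟨⟨k', b'⟩, a'⟩ 1 := by
        ext q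
        rw [LinearEquiv.funCongrLeft_apply, LinearMap.funLeft_apply, Pi.single_apply,
          Pi.single_apply]
        exact if_congr (Equiv.symm_apply_eq e) rfl rfl
      rw [Pi.basisFun_apply, LinearMap.comp_apply, LinearMap.comp_apply, LinearEquiv.coe_coe, h3,
        toLin'_apply, mulVec_single_one]
      ext ⟨⟨k, b⟩, a⟩
      have h6 : Θ ((jordanMatrixM K u c ν)ᵀ.col ⟨k', b', a'⟩) ⟨⟨k, b⟩, a⟩ =
        jordanMatrixM K u c ν ⟨k', b', a'⟩ ⟨k, b, a⟩ := rfl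
      rw [h6, jordanMatrixM]
      have h4 := jordanOp_pow_single (K := K)
        (fun b : (Σ k : Fin u, Fin (c k)) => ν b.1) 1 ⟨k', b'⟩ a'
      have h5 := jordanOp_pow_single_eq_zero (K := K)
        (fun b : (Σ k : Fin u, Fin (c k)) => ν b.1) 1 ⟨k', b'⟩ a'
      rw [pow_one] at h4 h5
      by_cases ha : (a' : ℕ) + 1 < ν k'
      · rw [h4 ha, Pi.single_apply]
        refine if_congr ?_ rfl rfl
        constructor
        · rintro ⟨hk, hb, ha⟩
          dsimp only at hk hb ha
          subst hk
          obtain rfl := Fin.ext hb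
          simp [ha]
        · intro hh
          obtain ⟨hh1, hh2⟩ := Sigma.mk.inj_iff.1 hh
          obtain ⟨rfl, hh3⟩ := Sigma.mk.inj_iff.1 hh1
          obtain rfl := eq_of_heq hh3
          rw [eq_of_heq hh2]
          exact ⟨rfl, rfl, rfl⟩
      · rw [h5 ha, if_neg]
        · rfl
        · rintro ⟨hk, hb, ha'⟩
          dsimp only at hk hb ha'
          subst hk
          have := a.2
          omega
    exact fun v => LinearMap.congr_fun h2 v
  have h1 := rk_eq_of_intertwine Θ (intertwine_pow Θ.toLinearMap h l)
  rw [rk_jordanOp_pow, ← toLin'_pow, ← transpose_pow] at h1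
  rw [← rank_transpose]
  refine h1.trans ?_
  rw [Fintype.sum_sigma]
  exact Finset.sum_congr rfl fun k _ => by simp

theorem hasType_jordanMatrixM {c ν : Fin u → ℕ} {N : ℕ} (hN : ∀ k, ν k < N) :
    HasType N (mult c ν) (toLin' (jordanMatrixM K u c ν)) := fun l => by
  rw [← toLin'_pow, rho_mult hN, ← rank_jordanMatrixM_pow (K := K)]
  rfl

theorem rank_pow_eq_maxRank {c ν : Fin u → ℕ} {N : ℕ} (hN : ∀ k, ν k < N)
    {A₀ : Matrix (Σ k : Fin u, Fin (c k) × Fin (ν k)) (Σ k : Fin u, Fin (c k) × Fin (ν k)) K}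
    (hJ : A₀ * jordanMatrixM K u c ν = jordanMatrixM K u c ν * A₀) (hnil : IsNilpotent A₀)
    (hmax : ∀ A : Matrix (Σ k : Fin u, Fin (c k) × Fin (ν k))
        (Σ k : Fin u, Fin (c k) × Fin (ν k)) K,
      A * jordanMatrixM K u c ν = jordanMatrixM K u c ν * A → IsNilpotent A →
      ∀ m : ℕ, (A ^ m).rank ≤ (A₀ ^ m).rank) (m : ℕ) :
    (A₀ ^ m).rank = maxRank K N (mult c ν) m := by
  have hT := hasType_jordanMatrixM (K := K) (c := c) hN
  apply le_antisymm
  · have hnil' : IsNilpotent (toLin' A₀) := by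
      obtain ⟨k, hk⟩ := hnil
      exact ⟨k, by rw [← toLin'_pow, hk, map_zero]⟩
    have hcomm : Commute (toLin' A₀) (toLin' (jordanMatrixM K u c ν)) := by
      rw [Commute, SemiconjBy, Module.End.mul_eq_comp, Module.End.mul_eq_comp, ← toLin'_mul, hJ, toLin'_mul]
    have := rk_pow_le_maxRank hT hnil' hcomm m
    rw [← toLin'_pow] at this
    exact this
  · obtain ⟨Θ, hΘ, -⟩ := exists_stdNil hT IsNilpotent.zero (Commute.zero_left _)
    obtain ⟨B, hB, hr⟩ := exists_maxRank K N (mult c ν) m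
    rw [← hr]
    have key : ∀ v, Θ (B v) = Θ.conj B (Θ v) := fun v => by
      rw [LinearEquiv.conj_apply_apply, LinearEquiv.symm_apply_apply]
    have hpow : ∀ k, Θ.conj B ^ k = Θ.conj (B ^ k) := fun k => (map_pow (Θ.conjAlgEquiv K) B k).symm
    have hnilB : IsNilpotent (LinearMap.toMatrix' (Θ.conj B)) := by
      obtain ⟨k, hk⟩ := isNilpotent_of_mem_stdNil hB
      refine ⟨k, toLin'.injective ?_⟩
      rw [toLin'_pow, toLin'_toMatrix', hpow, hk, map_zero, map_zero]
    have hcommB : LinearMap.toMatrix' (Θ.conj B) * jordanMatrixM K u c ν =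
        jordanMatrixM K u c ν * LinearMap.toMatrix' (Θ.conj B) := by
      apply toLin'.injective
      rw [toLin'_mul, toLin'_mul, toLin'_toMatrix', ← hΘ, ← LinearEquiv.conj_comp,
        ← LinearEquiv.conj_comp]
      exact congrArg Θ.conj hB.1.eq
    have := hmax _ hcommB hnilB m
    rw [rk_eq_of_intertwine Θ (intertwine_pow Θ.toLinearMap key m)]
    refine le_trans (le_of_eq ?_) this
    rw [Matrix.rank, ← toLin'_apply', toLin'_pow, toLin'_toMatrix']

end Transfer

section Chains

variable {u : ℕ} {c ν : Fin u → ℕ}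

theorem chainLen_mult {N : ℕ} (hN : ∀ k, ν k < N) {w : ℕ} (hw : 0 < w) :
    chainLen N (mult c ν) w =
      2 * (∑ k with w < ν k, c k) + ∑ k with ν k = w ∨ ν k = w - 1, c k * ν k := by
  have h := sum_mult_mul c ν {w, w - 1} fun i => i
  rw [Finset.sum_pair (by omega)] at h
  simp only [Finset.mem_insert, Finset.mem_singleton] at h
  rw [chainLen, numGt_mult hN, ← h]
  ring

theorem chainLen_le_of_groups {N : ℕ} (hN : ∀ k, ν k < N) (hν : StrictAnti ν)
    {W : Fin u → Fin u → ℕ}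
    (hW : ∀ a b : Fin u,
      W a b = 2 * (∑ k ∈ univ.filter (fun k : Fin u => k < a), c k) +
        ∑ k ∈ univ.filter (fun k : Fin u => a ≤ k ∧ k ≤ b), c k * ν k)
    {M : ℕ} (hmax : ∀ a b : Fin u, a ≤ b → ν a ≤ ν b + 1 → W a b ≤ M) {w : ℕ} (hw : 2 ≤ w) :
    chainLen N (mult c ν) w ≤ M := by
  have key : ∀ w, 2 ≤ w → (∃ k, ν k = w ∨ ν k = w - 1) → chainLen N (mult c ν) w ≤ M := by
    rintro w hw ⟨k, hk⟩
    set S : Finset (Fin u) := univ.filter fun k => ν k = w ∨ ν k = w - 1 with hS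
    have hne : S.Nonempty := ⟨k, by simpa [hS] using hk⟩
    have ha := S.min'_mem hne
    have hb := S.max'_mem hne
    refine le_trans ?_ (hmax (S.min' hne) (S.max' hne) (S.min'_le _ hb) ?_)
    · rw [chainLen_mult hN (by omega), hW]
      refine Nat.add_le_add (Nat.mul_le_mul_left _ (Finset.sum_le_sum_of_subset ?_))
        (Finset.sum_le_sum_of_subset ?_)
      · intro j hj
        simp only [hS, Finset.mem_filter, Finset.mem_univ, true_and] at hj ha ⊢
        exact hν.lt_iff_gt.1 (by omega)
      · intro j hj
        rw [Finset.mem_filter]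
        exact ⟨Finset.mem_univ _, S.min'_le _ hj, S.le_max' _ hj⟩
    · simp only [hS, Finset.mem_filter, Finset.mem_univ, true_and] at ha hb ⊢
      omega
  by_cases h : ∃ k, ν k = w ∨ ν k = w - 1
  · exact key w hw h
  · have h0 : ∀ i, i = w ∨ i = w - 1 → mult c ν i = 0 := fun i hi =>
      mult_eq_zero fun k hk => h ⟨k, by omega⟩
    have h1 : chainLen N (mult c ν) w = 2 * numGt N (mult c ν) w := by
      rw [chainLen, h0 w (Or.inl rfl), h0 _ (Or.inr rfl)]
      simp
    rcases Nat.eq_zero_or_pos (numGt N (mult c ν) w) with h2 | h2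
    · omega
    · have hN' : ∀ i, N ≤ i → mult c ν i = 0 := fun i hi =>
        mult_eq_zero fun k hk => absurd (hN k) (by omega)
      obtain ⟨p, hp, hp1, hp2⟩ := exists_next hN' h2
      have h3 : chainLen N (mult c ν) p ≤ M := by
        refine key p (by omega) ?_
        by_contra h4
        exact hp1.ne' (mult_eq_zero fun k hk => h4 ⟨k, Or.inl hk⟩)
      have h4 : 2 * mult c ν p ≤ p * mult c ν p := Nat.mul_le_mul_right _ (by omega)
      rw [chainLen] at h3
      omega

theorem le_chainLen {N : ℕ} (hN : ∀ k, ν k < N) (hν : StrictAnti ν) (hpos : ∀ k, 0 < ν k)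
    {a b : Fin u} (hab : ν a ≤ ν b + 1) :
    2 * (∑ k ∈ univ.filter (fun k : Fin u => k < a), c k) +
        ∑ k ∈ univ.filter (fun k : Fin u => a ≤ k ∧ k ≤ b), c k * ν k ≤
      chainLen N (mult c ν) (max (ν a) 2) := by
  have ha := hpos a
  have h1 : 2 * (∑ k ∈ univ.filter (fun k : Fin u => k < a), c k) +
      ∑ k ∈ univ.filter (fun k : Fin u => a ≤ k ∧ k ≤ b), c k * ν k ≤
      chainLen N (mult c ν) (ν a) := by
    rw [chainLen_mult hN ha]
    refine Nat.add_le_add (Nat.mul_le_mul_left _ (Finset.sum_le_sum_of_subset ?_))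
      (Finset.sum_le_sum_of_subset ?_)
    · intro j hj
      simp only [Finset.mem_filter, Finset.mem_univ, true_and] at hj ⊢
      exact hν hj
    · intro j hj
      simp only [Finset.mem_filter, Finset.mem_univ, true_and] at hj ⊢
      have h2 := hν.antitone hj.1
      have h3 := hν.antitone hj.2
      omega
  rcases le_or_gt 2 (ν a) with h | h
  · rwa [max_eq_left h]
  · have h2 : ν a = 1 := by omega
    have hN' : ∀ i, N ≤ i → mult c ν i = 0 := fun i hi =>
      mult_eq_zero fun k hk => absurd (hN k) (by omega)
    have h3 := numGt_succ hN' 1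
    rw [h2, chainLen] at h1
    rw [max_eq_right h.le, chainLen]
    simp only [Nat.sub_self, Nat.reduceAdd, Nat.reduceSub] at *
    omega

theorem hat_mult {νh : Fin u → ℕ} (hν : StrictAnti ν) (hpos : ∀ k, 0 < ν k) {a b : Fin u}
    (hab : ν a ≤ ν b + 1) (hlt : ∀ k, b < k → ν k + 1 < ν a)
    (hνh : ∀ k, νh k = if k < a then ν k - 2 else if k ≤ b then 0 else ν k) {i : ℕ} (hi : 0 < i) :
    hat (mult c ν) (max (ν a) 2) i = mult c νh i := by
  have ha := hpos a
  have h1 : ∀ k, k < a → ν a < ν k := fun k hk => hν hk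
  have h2 : ∀ k, ¬ k < a → ν k ≤ ν a := fun k hk => hν.antitone (not_lt.1 hk)
  have h3 : ∀ k, k ≤ b → ν b ≤ ν k := fun k hk => hν.antitone hk
  have h4 : ∀ k, ¬ k ≤ b → ν k + 1 < ν a := fun k hk => hlt k (not_le.1 hk)
  rw [hat]
  split_ifs with h
  · refine Finset.sum_congr (Finset.filter_congr fun k _ => ?_) fun _ _ => rfl
    have := h1 k
    have := h2 k
    have := h4 k
    rw [hνh]
    split_ifs <;> omega
  · refine Finset.sum_congr (Finset.filter_congr fun k _ => ?_) fun _ _ => rfl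
    have := h1 k
    have := h2 k
    have := h3 k
    have := h4 k
    rw [hνh]
    split_ifs <;> omega

end Chains

end Oblak

/-- (Oblak's conjecture.)  Suppose `K` is an infinite field.  Let `B` be the partition of `n`
with, for each `k`, `c k` parts equal to `ν k` (with `ν` strictly decreasing and positive);
`J` is the corresponding Jordan matrix.  For groups `a ≤ b` with `ν a - ν b ≤ 1`
let `W a b = 2·(c 0 + ... + c (a-1)) + Σ_{a ≤ k ≤ b} (c k)·(ν k)`, and choose `(a₀, b₀)`
maximizing `W`; this maximum is `ω₁(B)`.  Let `B̂` be the partition of `n - ω₁(B)` obtained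
by decreasing by `2` all parts in groups `k < a₀`, deleting the groups `a₀ ≤ k ≤ b₀`, and
keeping the groups `k > b₀` (zero parts are discarded automatically since they index empty
blocks), with Jordan matrix `Ĵ`.  If `A₀` has the maximum Jordan type `Q(B)` among nilpotent
matrices commuting with `J` and `Â₀` has the maximum Jordan type `Q(B̂)` among nilpotent
matrices commuting with `Ĵ`, then `Q(B) = (ω₁(B), ω̂_1, ..., ω̂_ẑ)` where
`Q(B̂) = (ω̂_1, ..., ω̂_ẑ)`; equivalently `rank A₀^m = (ω₁(B) - m)⁺ + rank Â₀^m` for all `m`. -/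
theorem oblak_conjecture
    (K : Type*) [Field K] [Infinite K]
    (u : ℕ) (hu : 0 < u) (ν c : Fin u → ℕ)
    (hνanti : StrictAnti ν) (hνpos : ∀ k, 0 < ν k) (hcpos : ∀ k, 0 < c k)
    (a₀ b₀ : Fin u) (hab : a₀ ≤ b₀) (har : ν a₀ ≤ ν b₀ + 1)
    (W : Fin u → Fin u → ℕ)
    (hW : ∀ a b : Fin u,
      W a b = 2 * (∑ k ∈ univ.filter (fun k : Fin u => k < a), c k) +
        ∑ k ∈ univ.filter (fun k : Fin u => a ≤ k ∧ k ≤ b), c k * ν k)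
    (hmax : ∀ a b : Fin u, a ≤ b → ν a ≤ ν b + 1 → W a b ≤ W a₀ b₀)
    (νh : Fin u → ℕ)
    (hνh : ∀ k, νh k = if k < a₀ then ν k - 2 else if k ≤ b₀ then 0 else ν k)
    (A₀ : Matrix (Σ k : Fin u, Fin (c k) × Fin (ν k))
      (Σ k : Fin u, Fin (c k) × Fin (ν k)) K)
    (hA₀J : A₀ * jordanMatrixM K u c ν = jordanMatrixM K u c ν * A₀)
    (hA₀nil : IsNilpotent A₀)
    (hA₀max : ∀ A : Matrix (Σ k : Fin u, Fin (c k) × Fin (ν k))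
        (Σ k : Fin u, Fin (c k) × Fin (ν k)) K,
      A * jordanMatrixM K u c ν = jordanMatrixM K u c ν * A → IsNilpotent A →
      ∀ m : ℕ, (A ^ m).rank ≤ (A₀ ^ m).rank)
    (Ah₀ : Matrix (Σ k : Fin u, Fin (c k) × Fin (νh k))
      (Σ k : Fin u, Fin (c k) × Fin (νh k)) K)
    (hAh₀J : Ah₀ * jordanMatrixM K u c νh = jordanMatrixM K u c νh * Ah₀)
    (hAh₀nil : IsNilpotent Ah₀)
    (hAh₀max : ∀ A : Matrix (Σ k : Fin u, Fin (c k) × Fin (νh k))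
        (Σ k : Fin u, Fin (c k) × Fin (νh k)) K,
      A * jordanMatrixM K u c νh = jordanMatrixM K u c νh * A → IsNilpotent A →
      ∀ m : ℕ, (A ^ m).rank ≤ (Ah₀ ^ m).rank) :
    ∀ m : ℕ, (A₀ ^ m).rank = (W a₀ b₀ - m) + (Ah₀ ^ m).rank := by
  obtain ⟨N, hN⟩ : ∃ N, ∀ k, ν k < N :=
    ⟨∑ k, ν k + 1, fun k => Nat.lt_succ_of_le (Finset.single_le_sum_of_canonicallyOrdered
      (Finset.mem_univ k))⟩
  have hNh : ∀ k, νh k < N := fun k => by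
    have := hN k
    rw [hνh]
    split_ifs <;> omega
  have hN' : ∀ i, N ≤ i → Oblak.mult c ν i = 0 := fun i hi =>
    Oblak.mult_eq_zero fun k hk => absurd (hN k) (by omega)
  have hlt : ∀ k, b₀ < k → ν k + 1 < ν a₀ := by
    intro k hk
    by_contra hle
    have h1 := hmax a₀ k (hab.trans hk.le) (not_lt.1 hle)
    rw [hW, hW] at h1
    refine absurd (Nat.le_of_add_le_add_left h1) (not_le.2 ?_)
    refine Finset.sum_lt_sum_of_subset (i := k) (fun j hj => ?_) ?_ ?_
      (Nat.mul_pos (hcpos k) (hνpos k)) fun _ _ _ => Nat.zero_le _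
    · rw [Finset.mem_filter] at hj ⊢
      exact ⟨hj.1, hj.2.1, hj.2.2.trans hk.le⟩
    · exact Finset.mem_filter.2 ⟨Finset.mem_univ _, hab.trans hk.le, le_rfl⟩
    · exact fun h => absurd (Finset.mem_filter.1 h).2.2 (not_le.2 hk)
  have hle : ∀ w, 2 ≤ w → Oblak.chainLen N (Oblak.mult c ν) w ≤ W a₀ b₀ := fun w hw =>
    Oblak.chainLen_le_of_groups hN hνanti hW hmax hw
  have hchain : Oblak.chainLen N (Oblak.mult c ν) (max (ν a₀) 2) = W a₀ b₀ :=
    (hle _ (le_max_right _ _)).antisymm (hW a₀ b₀ ▸ Oblak.le_chainLen hN hνanti hνpos har)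
  have hv : Oblak.IsMaxChain N (Oblak.mult c ν) (max (ν a₀) 2) := by
    refine ⟨le_max_right _ _, ?_, fun w hw => hchain ▸ hle w hw⟩
    rcases le_or_gt (ν a₀) 2 with h | h
    · exact Or.inl (max_eq_right h)
    · rw [max_eq_left h.le]
      refine Or.inr (Nat.add_pos_left ((hcpos a₀).trans_le ?_) _)
      exact Finset.single_le_sum_of_canonicallyOrdered
        (Finset.mem_filter.2 ⟨Finset.mem_univ a₀, rfl⟩)
  intro m
  rw [Oblak.rank_pow_eq_maxRank hN hA₀J hA₀nil hA₀max,
    Oblak.rank_pow_eq_maxRank hNh hAh₀J hAh₀nil hAh₀max, ← hchain,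
    (Oblak.maxRank_succ_and_split K _ hN').1.1 _ hv m]
  congr 1
  exact Oblak.maxRank_congr_of_eq
    (fun i hi _ => Oblak.hat_mult hνanti hνpos har hlt hνh hi) m
end

section
/- A matrix X ∈ M(n,K) commutes with J if and only if each block X_{h,k} is an upper triangular rectangular Toeplitz matrix; explicitly, XJ = JX if and only if for all h, k ∈ {1,...,t} and all valid indices a, b: (X_{h,k})_{a,b} = 0 whenever b − a < μ_k − min(μ_h, μ_k), and (X_{h,k})_{a,b} = (X_{h,k})_{a+1,b+1} whenever 1 ≤ a < μ_h and 1 ≤ b < μ_k. -/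
open Matrix

/-- The Jordan matrix of the partition `μ`. -/
def jordanMatrix (K : Type*) [Field K] (t : ℕ) (μ : Fin t → ℕ) :
    Matrix (Σ i : Fin t, Fin (μ i)) (Σ i : Fin t, Fin (μ i)) K :=
  fun p q => if p.1 = q.1 ∧ (p.2 : ℕ) + 1 = (q.2 : ℕ) then 1 else 0

section JordanMatrix

variable {K : Type*} [Field K] {t : ℕ} {μ : Fin t → ℕ}
  (X : Matrix (Σ i : Fin t, Fin (μ i)) (Σ i : Fin t, Fin (μ i)) K)

theorem mul_jordanMatrix_apply_zero (p : Σ i : Fin t, Fin (μ i)) (k : Fin t) (hb : 0 < μ k) :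
    (X * jordanMatrix K t μ) p ⟨k, ⟨0, hb⟩⟩ = 0 := by
  simp [Matrix.mul_apply, jordanMatrix]

theorem mul_jordanMatrix_apply_succ (p : Σ i : Fin t, Fin (μ i)) (k : Fin t) (b : ℕ)
    (hb : b + 1 < μ k) :
    (X * jordanMatrix K t μ) p ⟨k, ⟨b + 1, hb⟩⟩ = X p ⟨k, ⟨b, by omega⟩⟩ := by
  rw [Matrix.mul_apply, Finset.sum_eq_single ⟨k, ⟨b, by omega⟩⟩]
  · simp [jordanMatrix]
  · rintro ⟨j, c⟩ - hne
    have : ¬ (j = k ∧ (c : ℕ) + 1 = b + 1) := by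
      rintro ⟨rfl, hc⟩
      exact hne (by congr 1; ext; simpa using hc)
    simp only [jordanMatrix, if_neg this, mul_zero]
  · simp

theorem jordanMatrix_mul_apply_of_succ_lt (h : Fin t) (a : ℕ) (ha : a + 1 < μ h)
    (q : Σ i : Fin t, Fin (μ i)) :
    (jordanMatrix K t μ * X) ⟨h, ⟨a, by omega⟩⟩ q = X ⟨h, ⟨a + 1, ha⟩⟩ q := by
  rw [Matrix.mul_apply, Finset.sum_eq_single ⟨h, ⟨a + 1, ha⟩⟩]
  · simp [jordanMatrix]
  · rintro ⟨j, c⟩ - hne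
    have : ¬ (h = j ∧ a + 1 = (c : ℕ)) := by
      rintro ⟨rfl, hc⟩
      exact hne (by congr 1; ext; exact hc.symm)
    simp only [jordanMatrix, if_neg this, zero_mul]
  · simp

theorem jordanMatrix_mul_apply_of_succ_eq (h : Fin t) (a : Fin (μ h)) (ha : (a : ℕ) + 1 = μ h)
    (q : Σ i : Fin t, Fin (μ i)) :
    (jordanMatrix K t μ * X) ⟨h, a⟩ q = 0 := by
  rw [Matrix.mul_apply]
  refine Finset.sum_eq_zero ?_
  rintro ⟨j, c⟩ -
  have : ¬ (h = j ∧ (a : ℕ) + 1 = (c : ℕ)) := by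
    rintro ⟨rfl, hc⟩
    have := c.isLt
    omega
  simp only [jordanMatrix, if_neg this, zero_mul]

end JordanMatrix

/-- A Toeplitz block with zeros below the top of its first column vanishes strictly below the
main diagonal. -/
theorem toeplitz_eq_zero_of_lt {K : Type*} [Zero K] {m n : ℕ} (f : Fin m → Fin n → K)
    (hf : ∀ (a b : ℕ) (ha : a + 1 < m) (hb : b + 1 < n),
      f ⟨a, by omega⟩ ⟨b, by omega⟩ = f ⟨a + 1, ha⟩ ⟨b + 1, hb⟩)
    (h0 : ∀ (a : ℕ) (ha : a + 1 < m) (hb : 0 < n), f ⟨a + 1, ha⟩ ⟨0, hb⟩ = 0)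
    (b : ℕ) : ∀ (a : ℕ) (ha : a < m) (hb : b < n), b < a → f ⟨a, ha⟩ ⟨b, hb⟩ = 0 := by
  induction b with
  | zero =>
    rintro (_ | a) ha hb hab
    · omega
    · exact h0 a ha hb
  | succ b ih =>
    rintro (_ | a) ha hb hab
    · omega
    · rw [← hf a b ha hb]
      exact ih a _ _ (by omega)

/-- A Toeplitz block with zeros before the end of its last row vanishes strictly below the
diagonal through its last entry. -/
theorem toeplitz_eq_zero_of_add_lt {K : Type*} [Zero K] {m n : ℕ} (f : Fin m → Fin n → K)
    (hf : ∀ (a b : ℕ) (ha : a + 1 < m) (hb : b + 1 < n),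
      f ⟨a, by omega⟩ ⟨b, by omega⟩ = f ⟨a + 1, ha⟩ ⟨b + 1, hb⟩)
    (hlast : ∀ (a b : ℕ) (ha : a + 1 = m) (hb : b + 1 < n),
      f ⟨a, by omega⟩ ⟨b, by omega⟩ = 0)
    (d : ℕ) : ∀ (a b : ℕ) (ha : a < m) (hb : b < n), a + 1 + d = m → b + m < a + n →
      f ⟨a, ha⟩ ⟨b, hb⟩ = 0 := by
  induction d with
  | zero => exact fun a b ha hb had hab => hlast a b (by omega) (by omega)
  | succ d ih =>
    intro a b ha hb had hab
    rw [hf a b (by omega) (by omega)]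
    exact ih _ _ _ _ (by omega) (by omega)

/-- A matrix `X` commutes with the Jordan matrix `J` of type `B = (μ_1 ≥ ... ≥ μ_t)` if and
only if each block `X_{h,k}` (of size `μ_h × μ_k`) is an upper triangular rectangular
Toeplitz matrix: `(X_{h,k})_{a,b} = 0` whenever `b - a < μ_k - min (μ_h) (μ_k)`, and
`(X_{h,k})_{a,b} = (X_{h,k})_{a+1,b+1}` for all valid indices.  (Here `a, b` are 0-indexed
positions within the blocks.) -/
theorem commutes_iff_toeplitz_blocks
    (K : Type*) [Field K]
    (t : ℕ) (μ : Fin t → ℕ) (hpos : ∀ i, 0 < μ i)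
    (hmono : ∀ i j : Fin t, i ≤ j → μ j ≤ μ i)
    (X : Matrix (Σ i : Fin t, Fin (μ i)) (Σ i : Fin t, Fin (μ i)) K) :
    X * jordanMatrix K t μ = jordanMatrix K t μ * X ↔
    ∀ (h k : Fin t) (a : Fin (μ h)) (b : Fin (μ k)),
      (((b : ℕ) : ℤ) - ((a : ℕ) : ℤ) < (μ k : ℤ) - (min (μ h) (μ k) : ℤ) →
        X ⟨h, a⟩ ⟨k, b⟩ = 0) ∧
      (∀ (ha : (a : ℕ) + 1 < μ h) (hb : (b : ℕ) + 1 < μ k),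
        X ⟨h, a⟩ ⟨k, b⟩ = X ⟨h, ⟨(a : ℕ) + 1, ha⟩⟩ ⟨k, ⟨(b : ℕ) + 1, hb⟩⟩) := by
  constructor
  · intro hX h k
    have entry := fun p q => congrFun (congrFun hX p) q
    have shift : ∀ (a b : ℕ) (ha : a + 1 < μ h) (hb : b + 1 < μ k),
        X ⟨h, ⟨a, by omega⟩⟩ ⟨k, ⟨b, by omega⟩⟩ = X ⟨h, ⟨a + 1, ha⟩⟩ ⟨k, ⟨b + 1, hb⟩⟩ := by
      intro a b ha hb
      rw [← mul_jordanMatrix_apply_succ X _ k b hb, entry,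
        jordanMatrix_mul_apply_of_succ_lt X h a ha]
    refine fun a b => ⟨fun hab => ?_, fun ha hb => shift a b ha hb⟩
    rcases le_total (μ k) (μ h) with hle | hle
    · refine toeplitz_eq_zero_of_lt (fun a b => X ⟨h, a⟩ ⟨k, b⟩) shift (fun a ha hb => ?_)
        b a a.isLt b.isLt (by omega)
      rw [← jordanMatrix_mul_apply_of_succ_lt X h a ha, ← entry, mul_jordanMatrix_apply_zero]
    · refine toeplitz_eq_zero_of_add_lt (fun a b => X ⟨h, a⟩ ⟨k, b⟩) shift
        (fun a b ha hb => ?_) (μ h - (a + 1)) a b a.isLt b.isLt (by omega) (by omega)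
      rw [← mul_jordanMatrix_apply_succ X _ k b hb, entry,
        jordanMatrix_mul_apply_of_succ_eq X h _ ha]
  · intro hX
    ext ⟨h, a, ha⟩ ⟨k, b, hb⟩
    rcases Nat.lt_or_eq_of_le (Nat.succ_le_of_lt ha) with ha' | ha' <;> rcases b with _ | b
    · rw [mul_jordanMatrix_apply_zero, jordanMatrix_mul_apply_of_succ_lt X h a ha']
      exact ((hX h k _ _).1 (by simp only; omega)).symm
    · rw [mul_jordanMatrix_apply_succ, jordanMatrix_mul_apply_of_succ_lt X h a ha']
      exact (hX h k _ _).2 ha' hb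
    · rw [mul_jordanMatrix_apply_zero, jordanMatrix_mul_apply_of_succ_eq X h _ ha']
    · rw [mul_jordanMatrix_apply_succ, jordanMatrix_mul_apply_of_succ_eq X h _ ha']
      exact (hX h k _ _).1 (by simp only; omega)
end
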